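/- arXiv:math/0105016 — 3 statements merged into one kernel-verified Lean document; each statement's English description precedes it below -/
import Mathlib

section
/- Let Ω ⊆ ℂ be a nonempty open connected set such that the complement ℂ \ Ω contains at least two points. Then there exists a holomorphic covering map from the open unit disk D₁ = {z ∈ ℂ : |z| < 1} onto Ω, i.e. a holomorphic map f : D₁ → ℂ with f(D₁) = Ω which is a topological covering map onto Ω. -/
/-- `f` is a holomorphic covering map from `D ⊆ ℂ` onto `Ω ⊆ ℂ`: it is holomorphic
on `D`, its image of `D` is `Ω`, and the restricted map `D → Ω` is a topological
covering map. -/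
def IsHolomorphicCoveringOnto (f : ℂ → ℂ) (D Ω : Set ℂ) : Prop :=
  DifferentiableOn ℂ f D ∧ f '' D = Ω ∧
    ∀ h : Set.MapsTo f D Ω, IsCoveringMap (Set.MapsTo.restrict f D Ω h)

section

open scoped ComplexConjugate Real
open Complex Metric Set Filter Topology

local notation "𝔻" => Metric.ball (0 : ℂ) 1

/-- Montel's theorem, in terms of limits along an ultrafilter. -/
theorem exists_tendstoLocallyUniformlyOn_of_locally_bounded {ι : Type*} (𝒰 : Ultrafilter ι)
    {U : Set ℂ} (hU : IsOpen U) {F : ι → ℂ → ℂ} (hF : ∀ i, DifferentiableOn ℂ (F i) U)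
    (hb : ∀ z ∈ U, ∃ r > 0, ∃ M, ∀ i, ∀ w ∈ ball z r ∩ U, ‖F i w‖ ≤ M) :
    ∃ f : ℂ → ℂ, TendstoLocallyUniformlyOn F f 𝒰 U := by
  have hpt : ∀ z, ∃ a, z ∈ U → Tendsto (fun i ↦ F i z) 𝒰 (𝓝 a) := by
    intro z
    by_cases hz : z ∈ U
    · obtain ⟨r, hr, M, hM⟩ := hb z hz
      obtain ⟨a, -, ha⟩ := (isCompact_closedBall (0 : ℂ) M).ultrafilter_le_nhds
        (𝒰.map fun i ↦ F i z) (by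
          rw [le_principal_iff]
          exact mem_map.2 (univ_mem' fun i ↦ by simpa using hM i z ⟨mem_ball_self hr, hz⟩))
      exact ⟨a, fun _ ↦ ha⟩
    · exact ⟨0, fun h ↦ absurd h hz⟩
  choose f hf using hpt
  refine ⟨f, fun u hu z hz ↦ ?_⟩
  obtain ⟨ε, hε, hεu⟩ := Metric.mem_uniformity_dist.1 hu
  obtain ⟨r₀, hr₀, M, hM⟩ := hb z hz
  obtain ⟨r₁, hr₁, hrU⟩ := Metric.isOpen_iff.1 hU z hz
  obtain ⟨i₀⟩ : Nonempty ι := 𝒰.neBot.nonempty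
  set r := min r₀ r₁
  have hr : 0 < r := lt_min hr₀ hr₁
  have hM0 : 0 ≤ M := (norm_nonneg _).trans (hM i₀ z ⟨mem_ball_self hr₀, hz⟩)
  have hsub : ball z r ⊆ ball z r₀ ∩ U := fun w hw ↦
    ⟨ball_subset_ball (min_le_left _ _) hw, hrU (ball_subset_ball (min_le_right _ _) hw)⟩
  have hlip : ∀ i, ∀ w ∈ ball z r, dist (F i w) (F i z) ≤ 2 * M / r * dist w z := by
    intro i w hw
    refine dist_le_div_mul_dist_of_mapsTo_ball ((hF i).mono fun v hv ↦ (hsub hv).2) ?_ hw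
    intro v hv
    rw [mem_closedBall, dist_eq_norm]
    calc ‖F i v - F i z‖ ≤ ‖F i v‖ + ‖F i z‖ := norm_sub_le _ _
      _ ≤ 2 * M := by linarith [hM i v (hsub hv), hM i z (hsub (mem_ball_self hr))]
  have hlip' : ∀ w ∈ ball z r, dist (f w) (f z) ≤ 2 * M / r * dist w z := fun w hw ↦
    le_of_tendsto ((hf w (hsub hw).2).dist (hf z hz)) (.of_forall fun i ↦ hlip i w hw)
  set L := 2 * M / r
  have hL : 0 ≤ L := by positivity
  set s := min r (ε / (3 * (L + 1)))
  have hs : 0 < s := lt_min hr (by positivity)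
  refine ⟨ball z s, mem_nhdsWithin_of_mem_nhds (ball_mem_nhds z hs), ?_⟩
  filter_upwards [(Metric.tendsto_nhds.1 (hf z hz)) (ε / 3) (by positivity)] with i hi w hw
  refine hεu ?_
  have hwr : w ∈ ball z r := ball_subset_ball (min_le_left _ _) hw
  have h1 : L * dist w z ≤ ε / 3 := by
    have hw' : dist w z ≤ ε / (3 * (L + 1)) := (mem_ball.1 hw).le.trans (min_le_right _ _)
    calc L * dist w z ≤ (L + 1) * (ε / (3 * (L + 1))) := by gcongr; linarith
      _ = ε / 3 := by field_simp
  have h2 := hlip i w hwr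
  have h3 := hlip' w hwr
  have h4 := dist_triangle4 (f w) (f z) (F i z) (F i w)
  rw [dist_comm (f z), dist_comm (F i z) (F i w)] at h4
  linarith

/-- Hurwitz's theorem: a value of a non-constant locally uniform limit of holomorphic functions,
or a small perturbation of it, is taken nearby by the approximating functions. -/
theorem eventually_exists_eq_of_tendstoLocallyUniformlyOn {ι : Type*} {l : Filter ι}
    {U : Set ℂ} (hU : IsOpen U) {F : ι → ℂ → ℂ} {f : ℂ → ℂ}
    (hF : ∀ i, DifferentiableOn ℂ (F i) U) (hlim : TendstoLocallyUniformlyOn F f l U)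
    {w : ℂ} (hw : w ∈ U) (hf : ∀ᶠ z in 𝓝[≠] w, f z ≠ f w)
    {c : ι → ℂ} (hc : Tendsto c l (𝓝 (f w))) {ε : ℝ} (hε : 0 < ε) :
    ∀ᶠ i in l, ∃ z ∈ U, dist z w < ε ∧ F i z = c i := by
  rcases l.eq_or_neBot with rfl | hl
  · simp
  have hfd : DifferentiableOn ℂ f U := hlim.differentiableOn (.of_forall hF) hU
  obtain ⟨r₁, hr₁, hrU⟩ := Metric.isOpen_iff.1 hU w hw
  obtain ⟨r₂, hr₂, hne⟩ := Metric.mem_nhdsWithin_iff.1 hf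
  obtain ⟨r, hr, hrmin⟩ := exists_between (lt_min (lt_min hr₁ hr₂) hε)
  simp only [lt_min_iff] at hrmin
  have hcU : closedBall w r ⊆ U := (closedBall_subset_ball hrmin.1.1).trans hrU
  have hsph : sphere w r ⊆ U := sphere_subset_closedBall.trans hcU
  obtain ⟨z₀, hz₀, hmin⟩ := (isCompact_sphere w r).exists_isMinOn
    (NormedSpace.sphere_nonempty.2 hr.le)
    (f := fun z ↦ ‖f z - f w‖) ((hfd.continuousOn.mono hsph).sub continuousOn_const).norm
  set δ := ‖f z₀ - f w‖
  have hδ : 0 < δ := by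
    refine norm_pos_iff.2 (sub_ne_zero.2 (hne ⟨?_, ?_⟩))
    · rw [mem_ball, mem_sphere.1 hz₀]; exact hrmin.1.2
    · exact ne_of_mem_sphere hz₀ hr.ne'
  have hunif := (tendstoLocallyUniformlyOn_iff_forall_isCompact hU).1 hlim _ hcU
    (isCompact_closedBall w r)
  filter_upwards [Metric.tendstoUniformlyOn_iff.1 hunif (δ / 8) (by positivity),
    Metric.tendsto_nhds.1 hc (δ / 8) (by positivity)] with i hi hci
  have hsp : ∀ z ∈ sphere w r, δ / 2 ≤ ‖F i z - F i w‖ := by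
    intro z hz
    have h1 : δ ≤ dist (f z) (f w) := by rw [dist_eq_norm]; exact hmin hz
    have h2 := hi z (sphere_subset_closedBall hz)
    have h3 := hi w (mem_closedBall_self hr.le)
    have h4 := dist_triangle4 (f z) (F i z) (F i w) (f w)
    rw [dist_comm (F i w) (f w)] at h4
    rw [← dist_eq_norm]
    linarith
  have hdc : DiffContOnCl ℂ (F i) (ball w r) := by
    refine DifferentiableOn.diffContOnCl ?_
    rw [closure_ball w hr.ne']
    exact (hF i).mono hcU
  have hfreq : ∃ᶠ z in 𝓝 w, F i z ≠ F i w := by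
    intro hev
    have hev' : F i =ᶠ[𝓝 w] fun _ ↦ F i w := hev.mono fun z hz ↦ not_not.1 hz
    have hconst := ((hF i).mono (ball_subset_closedBall.trans hcU)).analyticOnNhd
      isOpen_ball |>.eqOn_of_preconnected_of_eventuallyEq analyticOnNhd_const
      (convex_ball w r).isPreconnected (mem_ball_self hr) hev'
    have hcl : EqOn (F i) (fun _ ↦ F i w) (closure (ball w r)) :=
      hconst.of_subset_closure (((hF i).mono hcU).continuousOn.mono
        closure_ball_subset_closedBall) continuousOn_const subset_closure subset_rfl
    rw [closure_ball w hr.ne'] at hcl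
    have := hsp z₀ hz₀
    rw [hcl (sphere_subset_closedBall hz₀), sub_self, norm_zero] at this
    linarith
  have hmem : c i ∈ ball (F i w) (δ / 2 / 2) := by
    have h3 := hi w (mem_closedBall_self hr.le)
    have := dist_triangle (c i) (f w) (F i w)
    rw [mem_ball]; linarith
  obtain ⟨z, hz, hzc⟩ := hdc.ball_subset_image_closedBall hr hsp hfreq hmem
  exact ⟨z, hcU hz, (mem_closedBall.1 hz).trans_lt hrmin.2, hzc⟩

/-- `ψ` is a holomorphic lift through `f`, with values in `U`, of the map `φ` of the unit disc. -/
structure IsDiscLift (f : ℂ → ℂ) (U : Set ℂ) (φ ψ : ℂ → ℂ) : Prop where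
  differentiableOn : DifferentiableOn ℂ ψ 𝔻
  mapsTo : MapsTo ψ 𝔻 U
  apply_eq : ∀ z ∈ 𝔻, f (ψ z) = φ z

/-- Every holomorphic map from the unit disc to `Ω` lifts through `f : U → ℂ`, with an arbitrary
choice of the value of the lift at one point. -/
def HasDiscLifting (f : ℂ → ℂ) (U Ω : Set ℂ) : Prop :=
  ∀ φ : ℂ → ℂ, DifferentiableOn ℂ φ 𝔻 → MapsTo φ 𝔻 Ω → ∀ z ∈ 𝔻, ∀ w ∈ U, f w = φ z →
    ∃ ψ : ℂ → ℂ, IsDiscLift f U φ ψ ∧ ψ z = w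

theorem HasDiscLifting.mono {f : ℂ → ℂ} {U Ω Ω' : Set ℂ} (h : HasDiscLifting f U Ω)
    (hΩ : Ω' ⊆ Ω) : HasDiscLifting f U Ω' :=
  fun φ hφ hm ↦ h φ hφ (hm.mono_right hΩ)

theorem HasDiscLifting.comp {f g : ℂ → ℂ} {U V Ω : Set ℂ} (hf : HasDiscLifting f U Ω)
    (hg : HasDiscLifting g V (U ∩ f ⁻¹' Ω)) (hgU : MapsTo g V U) :
    HasDiscLifting (f ∘ g) V Ω := by
  intro φ hφ hm z hz w hw hwz
  obtain ⟨ψ, hψ, hψz⟩ := hf φ hφ hm z hz (g w) (hgU hw) hwz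
  obtain ⟨χ, hχ, hχz⟩ := hg ψ hψ.differentiableOn (fun v hv ↦ ⟨hψ.mapsTo hv, by
    rw [mem_preimage, hψ.apply_eq v hv]; exact hm hv⟩) z hz w hw hψz.symm
  exact ⟨χ, ⟨hχ.differentiableOn, hχ.mapsTo, fun v hv ↦ by
    rw [Function.comp_apply, hχ.apply_eq v hv, hψ.apply_eq v hv]⟩, hχz⟩

theorem mapsTo_unitDisc_of_norm_le_one {g : ℂ → ℂ} (hg : DifferentiableOn ℂ g 𝔻)
    (hle : ∀ z ∈ 𝔻, ‖g z‖ ≤ 1) {z₁ : ℂ} (hz₁ : z₁ ∈ 𝔻) (hlt : ‖g z₁‖ < 1) : MapsTo g 𝔻 𝔻 := by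
  intro z hz
  rw [mem_ball_zero_iff]
  refine lt_of_le_of_ne (hle z hz) fun h ↦ ?_
  have := norm_eqOn_of_isPreconnected_of_isMaxOn (convex_ball (0 : ℂ) 1).isPreconnected
    isOpen_ball hg hz (fun w hw ↦ by simpa [h] using hle w hw) hz₁
  simp only [Function.comp_apply, Function.const_apply, h] at this
  linarith

theorem exists_tendstoLocallyUniformlyOn_of_mapsTo_unitDisc {ι : Type*} (𝒰 : Ultrafilter ι)
    {F : ι → ℂ → ℂ} (hF : ∀ i, DifferentiableOn ℂ (F i) 𝔻) (hm : ∀ i, MapsTo (F i) 𝔻 𝔻) :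
    ∃ f : ℂ → ℂ, TendstoLocallyUniformlyOn F f 𝒰 𝔻 :=
  exists_tendstoLocallyUniformlyOn_of_locally_bounded 𝒰 isOpen_ball hF fun _ _ ↦
    ⟨1, one_pos, 1, fun i _ hw ↦ (mem_ball_zero_iff.1 (hm i hw.2)).le⟩

/-- Lifts of maps of the disc persist under locally uniform limits. -/
theorem exists_isDiscLift_of_tendstoLocallyUniformlyOn {ι : Type*} (𝒰 : Ultrafilter ι)
    {F : ι → ℂ → ℂ} {f : ℂ → ℂ} (hF : ∀ i, DifferentiableOn ℂ (F i) 𝔻)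
    (hlim : TendstoLocallyUniformlyOn F f 𝒰 𝔻) {w : ℂ} (hw : w ∈ 𝔻)
    (hf : ∀ᶠ z in 𝓝[≠] w, f z ≠ f w) {φ : ι → ℂ → ℂ} {φ₀ : ℂ → ℂ}
    (hφ : ∀ z ∈ 𝔻, Tendsto (fun i ↦ φ i z) 𝒰 (𝓝 (φ₀ z))) {z₁ : ℂ} (hz₁ : z₁ ∈ 𝔻)
    (hw₁ : f w = φ₀ z₁)
    (H : ∀ᶠ i in 𝒰, ∀ v ∈ 𝔻, F i v = φ i z₁ → ∃ ψ, IsDiscLift (F i) 𝔻 (φ i) ψ ∧ ψ z₁ = v) :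
    ∃ ψ, IsDiscLift f 𝔻 φ₀ ψ ∧ ψ z₁ = w := by
  have hfd : DifferentiableOn ℂ f 𝔻 := hlim.differentiableOn (.of_forall hF) isOpen_ball
  obtain ⟨r₁, hr₁, hrU⟩ := Metric.isOpen_iff.1 (isOpen_ball (x := (0 : ℂ)) (ε := 1)) w hw
  obtain ⟨r₂, hr₂, hne⟩ := Metric.mem_nhdsWithin_iff.1 hf
  obtain ⟨r, hr, hrmin⟩ := exists_between (lt_min hr₁ hr₂)
  rw [lt_min_iff] at hrmin
  have hex : ∀ i, ∃ ψ : ℂ → ℂ, DifferentiableOn ℂ ψ 𝔻 ∧ MapsTo ψ 𝔻 𝔻 ∧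
      ((∃ χ, IsDiscLift (F i) 𝔻 (φ i) χ ∧ dist (χ z₁) w < r) →
        IsDiscLift (F i) 𝔻 (φ i) ψ ∧ dist (ψ z₁) w < r) := by
    intro i
    by_cases h : ∃ χ, IsDiscLift (F i) 𝔻 (φ i) χ ∧ dist (χ z₁) w < r
    · obtain ⟨χ, hχ, hd⟩ := h
      exact ⟨χ, hχ.differentiableOn, hχ.mapsTo, fun _ ↦ ⟨hχ, hd⟩⟩
    · exact ⟨0, differentiableOn_const 0, fun _ _ ↦ by simp, fun h' ↦ absurd h' h⟩
  choose ψ hψd hψm hψ using hex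
  have hev : ∀ᶠ i in 𝒰, IsDiscLift (F i) 𝔻 (φ i) (ψ i) ∧ dist (ψ i z₁) w < r := by
    filter_upwards [H, eventually_exists_eq_of_tendstoLocallyUniformlyOn isOpen_ball hF hlim hw hf
      (hw₁ ▸ hφ z₁ hz₁) hr] with i hi hv
    obtain ⟨v, hv, hvw, hvi⟩ := hv
    obtain ⟨χ, hχ, rfl⟩ := hi v hv hvi
    exact hψ i ⟨χ, hχ, hvw⟩
  obtain ⟨ψ₀, hψ₀⟩ := exists_tendstoLocallyUniformlyOn_of_mapsTo_unitDisc 𝒰 hψd hψm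
  have hψ₀d : DifferentiableOn ℂ ψ₀ 𝔻 := hψ₀.differentiableOn (.of_forall hψd) isOpen_ball
  have hdist : dist (ψ₀ z₁) w ≤ r :=
    le_of_tendsto ((hψ₀.tendsto_at hz₁).dist tendsto_const_nhds) (hev.mono fun i hi ↦ hi.2.le)
  have hmaps : MapsTo ψ₀ 𝔻 𝔻 := by
    refine mapsTo_unitDisc_of_norm_le_one hψ₀d (fun z hz ↦ ?_) hz₁ ?_
    · exact le_of_tendsto (hψ₀.tendsto_at hz).norm
        (.of_forall fun i ↦ (mem_ball_zero_iff.1 (hψm i hz)).le)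
    · exact mem_ball_zero_iff.1 (hrU (hdist.trans_lt hrmin.1))
  have happ : ∀ z ∈ 𝔻, f (ψ₀ z) = φ₀ z := by
    intro z hz
    have h1 : Tendsto (fun i ↦ F i (ψ i z)) 𝒰 (𝓝 (f (ψ₀ z))) :=
      hlim.tendsto_comp (hfd.continuousOn _ (hmaps hz)) (hmaps hz)
        (tendsto_nhdsWithin_iff.2 ⟨hψ₀.tendsto_at hz, .of_forall fun i ↦ hψm i hz⟩)
    refine tendsto_nhds_unique (h1.congr' (hev.mono fun i hi ↦ hi.1.apply_eq z hz)) (hφ z hz)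
  refine ⟨ψ₀, ⟨hψ₀d, hmaps, happ⟩, ?_⟩
  by_contra hcon
  exact hne ⟨hdist.trans_lt hrmin.2, hcon⟩ ((happ z₁ hz₁).trans hw₁.symm)

theorem eventually_ne_of_deriv_ne_zero {f : ℂ → ℂ} {U : Set ℂ} (hU : IsOpen U)
    (hUc : IsPreconnected U) (hf : DifferentiableOn ℂ f U) {z₀ : ℂ} (hz₀ : z₀ ∈ U)
    (h : deriv f z₀ ≠ 0) {w : ℂ} (hw : w ∈ U) : ∀ᶠ z in 𝓝[≠] w, f z ≠ f w := by
  have ha := hf.analyticOnNhd hU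
  refine ((ha w hw).eventually_eq_or_eventually_ne analyticAt_const).resolve_left fun hc ↦ h ?_
  have := ha.eqOn_of_preconnected_of_eventuallyEq analyticOnNhd_const hUc hw hc
  rw [(this.eventuallyEq_of_mem (hU.mem_nhds hz₀)).deriv_eq, deriv_const]

theorem exists_exp_eq_of_differentiableOn_unitDisc {h : ℂ → ℂ} (hh : DifferentiableOn ℂ h 𝔻)
    (h0 : ∀ z ∈ 𝔻, h z ≠ 0) : ∃ L : ℂ → ℂ, DifferentiableOn ℂ L 𝔻 ∧ ∀ z ∈ 𝔻, exp (L z) = h z := by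
  have hq : DifferentiableOn ℂ (fun z ↦ deriv h z / h z) 𝔻 := (hh.deriv isOpen_ball).div hh h0
  obtain ⟨L, hL0, hL⟩ := hq.isExactOn_ball.with_val_at 0 (log (h 0))
  have hLd : DifferentiableOn ℂ L 𝔻 := fun z hz ↦
    (hL z hz).differentiableAt.differentiableWithinAt
  refine ⟨L, hLd, fun z hz ↦ ?_⟩
  have hder : ∀ v ∈ 𝔻, HasDerivAt (fun z ↦ h z * exp (-L z)) 0 v := by
    intro v hv
    have h1 := (hh.differentiableAt (isOpen_ball.mem_nhds hv)).hasDerivAt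
    refine (h1.mul (hL v hv).neg.cexp).congr_deriv ?_
    field_simp [h0 v hv]
    ring
  have h00 : (0 : ℂ) ∈ 𝔻 := mem_ball_self one_pos
  have hc := isOpen_ball.is_const_of_deriv_eq_zero (convex_ball (0 : ℂ) 1).isPreconnected
    (fun v hv ↦ (hder v hv).differentiableAt.differentiableWithinAt)
    (fun v hv ↦ (hder v hv).deriv) hz h00
  simp only [hL0, exp_neg, exp_log (h0 0 h00), mul_inv_cancel₀ (h0 0 h00)] at hc
  field_simp at hc
  exact hc.symm

theorem exists_sq_eq_of_differentiableOn_unitDisc {h : ℂ → ℂ} (hh : DifferentiableOn ℂ h 𝔻)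
    (h0 : ∀ z ∈ 𝔻, h z ≠ 0) : ∃ s : ℂ → ℂ, DifferentiableOn ℂ s 𝔻 ∧ ∀ z ∈ 𝔻, s z ^ 2 = h z := by
  obtain ⟨L, hL, hLh⟩ := exists_exp_eq_of_differentiableOn_unitDisc hh h0
  refine ⟨fun z ↦ exp (L z / 2), (hL.div_const 2).cexp, fun z hz ↦ ?_⟩
  rw [← exp_nat_mul, ← hLh z hz]
  congr 1
  push_cast
  ring

theorem HasDiscLifting.exists_lift_ball {f : ℂ → ℂ} {U Ω : Set ℂ} (hf : HasDiscLifting f U Ω)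
    {w : ℂ} (hw : w ∈ U) {R : ℝ} (hR : 0 < R) (hball : ball (f w) R ⊆ Ω) :
    ∃ ψ, IsDiscLift f U (fun z ↦ f w + R * z) ψ ∧ ψ 0 = w := by
  refine hf _ (by fun_prop) (fun z hz ↦ hball ?_) 0 (mem_ball_self one_pos) w hw (by simp)
  rw [mem_ball_zero_iff] at hz
  simpa [abs_of_pos hR] using mul_lt_of_lt_one_right hR hz

theorem IsDiscLift.deriv_mul_deriv {f ψ : ℂ → ℂ} {U : Set ℂ} {a b : ℂ}
    (h : IsDiscLift f U (fun z ↦ a + b * z) ψ) (hf : DifferentiableAt ℂ f (ψ 0)) :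
    deriv f (ψ 0) * deriv ψ 0 = b := by
  have hψ : DifferentiableAt ℂ ψ 0 := h.differentiableOn.differentiableAt (ball_mem_nhds 0 one_pos)
  have h1 : f ∘ ψ =ᶠ[𝓝 0] fun z ↦ a + b * z :=
    eventuallyEq_of_mem (ball_mem_nhds 0 one_pos) h.apply_eq
  rw [← deriv_comp 0 hf hψ, h1.deriv_eq]
  simp

theorem HasDiscLifting.deriv_ne_zero {f : ℂ → ℂ} {U Ω : Set ℂ} (hf : HasDiscLifting f U Ω)
    (hΩ : IsOpen Ω) {w : ℂ} (hw : w ∈ U) (hwΩ : f w ∈ Ω) (hd : DifferentiableAt ℂ f w) :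
    deriv f w ≠ 0 := by
  obtain ⟨R, hR, hball⟩ := Metric.isOpen_iff.1 hΩ _ hwΩ
  obtain ⟨ψ, hψ, rfl⟩ := hf.exists_lift_ball hw hR hball
  intro h0
  have := hψ.deriv_mul_deriv hd
  rw [h0, zero_mul] at this
  exact hR.ne' (by exact_mod_cast this.symm)

theorem HasDiscLifting.le_norm_deriv {f : ℂ → ℂ} {Ω : Set ℂ} (hf : HasDiscLifting f 𝔻 Ω)
    (hfd : DifferentiableOn ℂ f 𝔻) {R : ℝ} (hR : 0 < R) (hball : ball (f 0) R ⊆ Ω) :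
    R ≤ ‖deriv f 0‖ := by
  obtain ⟨ψ, hψ, hψ0⟩ := hf.exists_lift_ball (mem_ball_self one_pos) hR hball
  have h1 : DifferentiableAt ℂ f (ψ 0) := by
    rw [hψ0]; exact hfd.differentiableAt (ball_mem_nhds 0 one_pos)
  have h2 := congrArg norm (hψ.deriv_mul_deriv h1)
  rw [norm_mul, hψ0, norm_real, Real.norm_of_nonneg hR.le] at h2
  have h3 : ‖deriv ψ 0‖ ≤ 1 := norm_deriv_le_one_of_mapsTo_ball hψ.differentiableOn
    (fun z hz ↦ by rw [hψ0]; exact ball_subset_closedBall (hψ.mapsTo hz)) one_pos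
  rw [← h2]
  exact mul_le_of_le_one_right (norm_nonneg _) h3

theorem neg_mem_unitDisc_iff {z : ℂ} : -z ∈ 𝔻 ↔ z ∈ 𝔻 := by
  rw [mem_ball_zero_iff, mem_ball_zero_iff, norm_neg]

/-- The automorphism of the unit disc sending `0` to `a`. -/
noncomputable def discShift (a z : ℂ) : ℂ := (z + a) / (1 + conj a * z)

theorem one_add_conj_mul_ne_zero {a z : ℂ} (ha : a ∈ 𝔻) (hz : z ∈ 𝔻) : 1 + conj a * z ≠ 0 := by
  rw [mem_ball_zero_iff] at ha hz
  intro h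
  have h1 : ‖conj a * z‖ = 1 := by rw [← norm_neg, ← eq_neg_of_add_eq_zero_left h, norm_one]
  rw [norm_mul, RCLike.norm_conj] at h1
  nlinarith [norm_nonneg a, norm_nonneg z]

theorem hasDerivAt_discShift {a z : ℂ} (ha : a ∈ 𝔻) (hz : z ∈ 𝔻) :
    HasDerivAt (discShift a) ((1 - a * conj a) / (1 + conj a * z) ^ 2) z := by
  have h1 : HasDerivAt (fun z ↦ z + a) 1 z := (hasDerivAt_id z).add_const a
  have h2 : HasDerivAt (fun z ↦ 1 + conj a * z) (conj a) z := by
    simpa using ((hasDerivAt_id z).const_mul (conj a)).const_add 1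
  refine (h1.div h2 (one_add_conj_mul_ne_zero ha hz)).congr_deriv ?_
  congr 1
  ring

theorem differentiableOn_discShift {a : ℂ} (ha : a ∈ 𝔻) : DifferentiableOn ℂ (discShift a) 𝔻 :=
  fun _ hz ↦ (hasDerivAt_discShift ha hz).differentiableAt.differentiableWithinAt

theorem mapsTo_discShift {a : ℂ} (ha : a ∈ 𝔻) : MapsTo (discShift a) 𝔻 𝔻 := by
  intro z hz
  have h0 := one_add_conj_mul_ne_zero ha hz
  rw [mem_ball_zero_iff] at *
  rw [discShift, norm_div, div_lt_one (norm_pos_iff.2 h0)]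
  refine lt_of_pow_lt_pow_left₀ 2 (norm_nonneg _) ?_
  have h1 : ‖1 + conj a * z‖ ^ 2 - ‖z + a‖ ^ 2 = (1 - ‖a‖ ^ 2) * (1 - ‖z‖ ^ 2) := by
    simp only [Complex.sq_norm, normSq_apply, add_re, add_im, mul_re, mul_im, conj_re, conj_im,
      one_re, one_im]
    ring
  have h2 : 0 < (1 - ‖a‖ ^ 2) * (1 - ‖z‖ ^ 2) := by
    apply mul_pos <;> nlinarith [norm_nonneg a, norm_nonneg z]
  linarith

theorem discShift_neg_discShift {a z : ℂ} (ha : a ∈ 𝔻) (hz : z ∈ 𝔻) :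
    discShift (-a) (discShift a z) = z := by
  have h0 := one_add_conj_mul_ne_zero ha hz
  have h1 := one_add_conj_mul_ne_zero ha (neg_mem_unitDisc_iff.2 ha)
  have h2 : 1 + conj (-a) * ((z + a) / (1 + conj a * z)) = (1 + conj a * -a) / (1 + conj a * z) := by
    rw [map_neg]
    field_simp
    ring
  rw [discShift, discShift, h2, div_eq_iff (div_ne_zero h1 h0), div_add' _ _ _ h0,
    mul_div_assoc']
  congr 1
  ring

theorem discShift_discShift_neg {a z : ℂ} (ha : a ∈ 𝔻) (hz : z ∈ 𝔻) :
    discShift a (discShift (-a) z) = z := by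
  simpa using discShift_neg_discShift (neg_mem_unitDisc_iff.2 ha) hz

theorem hasDiscLifting_discShift {a : ℂ} (ha : a ∈ 𝔻) : HasDiscLifting (discShift a) 𝔻 𝔻 := by
  intro φ hφ hm z hz w hw hwz
  have ha' := neg_mem_unitDisc_iff.2 ha
  refine ⟨discShift (-a) ∘ φ, ⟨(differentiableOn_discShift ha').comp hφ hm,
    (mapsTo_discShift ha').comp hm, fun v hv ↦ discShift_discShift_neg ha (hm hv)⟩, ?_⟩
  rw [Function.comp_apply, ← hwz, discShift_neg_discShift ha hw]

theorem hasDiscLifting_sq : HasDiscLifting (fun z ↦ z ^ 2) 𝔻 (𝔻 \ {0}) := by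
  intro φ hφ hm z hz w hw hwz
  obtain ⟨s, hs, hsφ⟩ := exists_sq_eq_of_differentiableOn_unitDisc hφ fun v hv ↦ (hm hv).2
  have hsm : MapsTo s 𝔻 𝔻 := by
    intro v hv
    have h1 := (hm hv).1
    rw [mem_ball_zero_iff, ← hsφ v hv, norm_pow] at h1
    rw [mem_ball_zero_iff]
    nlinarith [norm_nonneg (s v)]
  have h2 : s z = w ∨ -s z = w := by
    rcases sq_eq_sq_iff_eq_or_eq_neg.1 ((hsφ z hz).trans hwz.symm) with h | h
    · exact .inl h
    · exact .inr (by rw [h, neg_neg])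
  rcases h2 with h2 | h2
  · exact ⟨s, ⟨hs, hsm, hsφ⟩, h2⟩
  · exact ⟨fun v ↦ -s v, ⟨hs.neg, fun v hv ↦ neg_mem_unitDisc_iff.2 (hsm hv), fun v hv ↦ by
      rw [neg_sq, hsφ v hv]⟩, h2⟩

/-- For `a ≠ 0` in the unit disc, there is a holomorphic self-map of the disc fixing `0`, with
derivative there of norm less than `1`, through which every map of the disc omitting `a` lifts. -/
theorem exists_discLifting_diff_singleton {a : ℂ} (ha : a ∈ 𝔻) (ha0 : a ≠ 0) :
    ∃ g : ℂ → ℂ, DifferentiableOn ℂ g 𝔻 ∧ MapsTo g 𝔻 𝔻 ∧ g 0 = 0 ∧ ‖deriv g 0‖ < 1 ∧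
      HasDiscLifting g 𝔻 (𝔻 \ {a}) := by
  obtain ⟨b, hb⟩ := IsAlgClosed.exists_pow_nat_eq (-a) (n := 2) two_pos
  obtain rfl : a = -b ^ 2 := by rw [hb, neg_neg]
  have hb1 : ‖b‖ < 1 := by
    rw [mem_ball_zero_iff, norm_neg, norm_pow] at ha
    nlinarith [norm_nonneg b]
  have hbD : b ∈ 𝔻 := mem_ball_zero_iff.2 hb1
  have hb2 : b ^ 2 ∈ 𝔻 := neg_mem_unitDisc_iff.1 ha
  have h00 : (0 : ℂ) ∈ 𝔻 := mem_ball_self one_pos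
  have hsq : MapsTo (fun z : ℂ ↦ z ^ 2) 𝔻 𝔻 := by
    intro z hz
    rw [mem_ball_zero_iff] at *
    rw [norm_pow]
    nlinarith [norm_nonneg z]
  have hm0 : discShift b 0 = b := by simp [discShift]
  have hma : discShift (-b ^ 2) (b ^ 2) = 0 := by simp [discShift]
  refine ⟨discShift (-b ^ 2) ∘ (fun z ↦ z ^ 2) ∘ discShift b, ?_, ?_, ?_, ?_, ?_⟩
  · exact (differentiableOn_discShift ha).comp ((differentiableOn_discShift hbD).pow 2)
      (hsq.comp (mapsTo_discShift hbD))
  · exact (mapsTo_discShift ha).comp (hsq.comp (mapsTo_discShift hbD))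
  · simp [hm0, hma]
  · have h1 : HasDerivAt (fun z ↦ discShift b z ^ 2) _ 0 := (hasDerivAt_discShift hbD h00).pow 2
    have h2 := HasDerivAt.comp (h := fun z ↦ discShift b z ^ 2) (h₂ := discShift (-b ^ 2)) 0
      (hasDerivAt_discShift ha (by simpa [hm0] using hb2)) h1
    have h3 : deriv (discShift (-b ^ 2) ∘ (fun z ↦ z ^ 2) ∘ discShift b) 0 = _ := h2.deriv
    have hbb : b * conj b = (‖b‖ ^ 2 : ℝ) := by rw [mul_conj, normSq_eq_norm_sq]
    have h4 : (1 - -b ^ 2 * conj (-b ^ 2)) = ((1 - ‖b‖ ^ 4 : ℝ) : ℂ) := by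
      have : -b ^ 2 * conj (-b ^ 2) = (b * conj b) ^ 2 := by simp; ring
      rw [this, hbb]; push_cast; ring
    have h5 : 1 + conj (-b ^ 2) * b ^ 2 = ((1 - ‖b‖ ^ 4 : ℝ) : ℂ) := by
      rw [← h4]; simp; ring
    have h6 : (1 - b * conj b) = ((1 - ‖b‖ ^ 2 : ℝ) : ℂ) := by
      rw [hbb]; push_cast; ring
    have hpos : 0 < 1 - ‖b‖ ^ 2 := by nlinarith [norm_nonneg b]
    have hpos4 : 0 < 1 - ‖b‖ ^ 4 := by nlinarith [norm_nonneg b, sq_nonneg ‖b‖]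
    rw [h3, hm0, h4, h5, h6]
    simp only [mul_zero, add_zero, one_pow, div_one, norm_mul, norm_div, norm_pow, norm_real,
      Real.norm_of_nonneg hpos.le, Real.norm_of_nonneg hpos4.le, Nat.cast_ofNat, RCLike.norm_ofNat]
    rw [div_mul_eq_mul_div, div_lt_one (by positivity)]
    norm_num
    have : ‖b‖ ≠ 1 := hb1.ne
    have : 0 < (1 - ‖b‖) ^ 2 := by have := sub_pos.2 hb1; positivity
    have : 0 < (1 - ‖b‖ ^ 4) * ((1 - ‖b‖ ^ 2) * (1 - ‖b‖) ^ 2) := by positivity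
    nlinarith
  · refine (hasDiscLifting_discShift ha |>.mono sdiff_subset).comp ?_
      (hsq.comp (mapsTo_discShift hbD))
    refine (hasDiscLifting_sq.comp ((hasDiscLifting_discShift hbD).mono inter_subset_left)
      (mapsTo_discShift hbD)).mono fun z hz ↦ ⟨hz.1, ?_⟩
    rintro rfl
    exact hz.2.2 (by simp [discShift])

theorem exists_discLifting_of_subset_unitDisc {Ω : Set ℂ} (hΩ : IsOpen Ω) (hsub : Ω ⊆ 𝔻)
    (h0 : (0 : ℂ) ∈ Ω) :
    ∃ f : ℂ → ℂ, DifferentiableOn ℂ f 𝔻 ∧ MapsTo f 𝔻 Ω ∧ f 0 = 0 ∧ HasDiscLifting f 𝔻 Ω := by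
  have h00 : (0 : ℂ) ∈ 𝔻 := mem_ball_self one_pos
  obtain ⟨R, hR, hball⟩ := Metric.isOpen_iff.1 hΩ 0 h0
  set 𝓕 : Set (ℂ → ℂ) := {f | DifferentiableOn ℂ f 𝔻 ∧ MapsTo f 𝔻 𝔻 ∧ f 0 = 0 ∧
    HasDiscLifting f 𝔻 Ω}
  have hid : id ∈ 𝓕 := ⟨differentiableOn_id, fun z hz ↦ hz, rfl, fun φ hφ hm z _ w _ hwz ↦
    ⟨φ, ⟨hφ, fun v hv ↦ hsub (hm hv), fun _ _ ↦ rfl⟩, hwz.symm⟩⟩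
  obtain ⟨u, -, hu, huS⟩ := exists_seq_tendsto_sInf (S := (fun f ↦ ‖deriv f 0‖) '' 𝓕)
    ⟨_, mem_image_of_mem _ hid⟩ ⟨0, by rintro _ ⟨f, -, rfl⟩; exact norm_nonneg _⟩
  have hmin : ∀ f ∈ 𝓕, sInf ((fun f ↦ ‖deriv f 0‖) '' 𝓕) ≤ ‖deriv f 0‖ := fun f hf ↦
    csInf_le ⟨0, by rintro _ ⟨f, -, rfl⟩; exact norm_nonneg _⟩ (mem_image_of_mem _ hf)
  choose F hF hFu using huS
  obtain ⟨f, hf⟩ := exists_tendstoLocallyUniformlyOn_of_mapsTo_unitDisc (hyperfilter ℕ)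
    (fun n ↦ (hF n).1) (fun n ↦ (hF n).2.1)
  have hfd : DifferentiableOn ℂ f 𝔻 := hf.differentiableOn (.of_forall fun n ↦ (hF n).1) isOpen_ball
  have hderiv : ‖deriv f 0‖ = sInf ((fun f ↦ ‖deriv f 0‖) '' 𝓕) := by
    refine tendsto_nhds_unique ((hf.deriv (.of_forall fun n ↦ (hF n).1) isOpen_ball).tendsto_at
      h00).norm ?_
    simp only [Function.comp_apply, hFu]
    exact hu.mono_left Nat.hyperfilter_le_atTop
  have hf0 : f 0 = 0 := tendsto_nhds_unique (hf.tendsto_at h00) (by simp [fun n ↦ (hF n).2.2.1])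
  have hRf : R ≤ ‖deriv f 0‖ := by
    refine ge_of_tendsto ((hf.deriv (.of_forall fun n ↦ (hF n).1) isOpen_ball).tendsto_at
      h00).norm (.of_forall fun n ↦ ?_)
    exact (hF n).2.2.2.le_norm_deriv (hF n).1 hR (by rwa [(hF n).2.2.1])
  have hpos : 0 < ‖deriv f 0‖ := hR.trans_le hRf
  have hlift : HasDiscLifting f 𝔻 Ω := fun φ hφ hm z hz w hw hwz ↦
    exists_isDiscLift_of_tendstoLocallyUniformlyOn (hyperfilter ℕ) (fun n ↦ (hF n).1) hf hw
      (eventually_ne_of_deriv_ne_zero isOpen_ball (convex_ball _ _).isPreconnected hfd h00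
        (norm_pos_iff.1 hpos) hw) (φ := fun _ ↦ φ) (fun _ _ ↦ tendsto_const_nhds) hz hwz
      (.of_forall fun n v hv hvn ↦ (hF n).2.2.2 φ hφ hm z hz v hv hvn)
  have hmaps : MapsTo f 𝔻 𝔻 := by
    refine mapsTo_unitDisc_of_norm_le_one hfd (fun z hz ↦ ?_) h00 (by simp [hf0])
    exact le_of_tendsto (hf.tendsto_at hz).norm
      (.of_forall fun n ↦ (mem_ball_zero_iff.1 ((hF n).2.1 hz)).le)
  refine ⟨f, hfd, fun a ha ↦ ?_, hf0, hlift⟩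
  by_contra haΩ
  obtain ⟨g, hgd, hgm, hg0, hg1, hgl⟩ := exists_discLifting_diff_singleton ha
    (by rintro rfl; exact haΩ (by rwa [hf0]))
  have hcomp : f ∘ g ∈ 𝓕 := by
    refine ⟨hfd.comp hgd hgm, hmaps.comp hgm, by simp [hg0, hf0], hlift.comp (hgl.mono ?_) hgm⟩
    rintro z ⟨hz, hzΩ⟩
    exact ⟨hz, fun h ↦ haΩ (h ▸ hzΩ)⟩
  have h1 := hmin _ hcomp
  rw [← hderiv, deriv_comp 0 (by rw [hg0]; exact hfd.differentiableAt (isOpen_ball.mem_nhds h00))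
    (hgd.differentiableAt (isOpen_ball.mem_nhds h00)), hg0, norm_mul] at h1
  exact absurd h1 (not_le.2 (mul_lt_of_lt_one_right hpos hg1))

/-- A form of Bloch's theorem. -/
theorem exists_ball_subset_image_ball {f : ℂ → ℂ} {z₀ : ℂ} {R : ℝ} (hR : 0 < R)
    (hf : DifferentiableOn ℂ f (ball z₀ R)) :
    ∃ p, ball (f p) (R * ‖deriv f z₀‖ / 96) ⊆ f '' ball z₀ R := by
  rcases (norm_nonneg (deriv f z₀)).eq_or_lt with hD | hD
  · exact ⟨z₀, by simp [← hD]⟩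
  have hf' : DifferentiableOn ℂ (deriv f) (ball z₀ R) := hf.deriv isOpen_ball
  have hsub : closedBall z₀ (R / 2) ⊆ ball z₀ R := closedBall_subset_ball (by linarith)
  obtain ⟨p, hp, hmax⟩ := (isCompact_closedBall z₀ (R / 2)).exists_isMaxOn
    ⟨z₀, mem_closedBall_self (by positivity)⟩
    (f := fun z ↦ ‖deriv f z‖ * (R / 2 - dist z z₀))
    ((hf'.continuousOn.mono hsub).norm.mul (by fun_prop))
  set D := ‖deriv f z₀‖
  set A := ‖deriv f p‖ with hA
  obtain ⟨t, ht⟩ : ∃ t, t = (R / 2 - dist p z₀) / 2 := ⟨_, rfl⟩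
  have hAt : R / 2 * D ≤ A * (2 * t) := by
    have := hmax (mem_closedBall_self (x := z₀) (ε := R / 2) (by positivity))
    simp only [mem_ofPred_eq, dist_self] at this
    rw [ht]
    linarith
  have ht0 : 0 < t := by
    by_contra! h
    nlinarith [norm_nonneg (deriv f p), mul_pos hR hD]
  have hA0 : 0 < A := by
    by_contra! h
    nlinarith [mul_pos hR hD]
  have hpt : ball p t ⊆ closedBall z₀ (R / 2) := by
    intro z hz
    rw [mem_ball] at hz
    rw [mem_closedBall]
    linarith [dist_triangle z p z₀]
  have hbd : ∀ z ∈ ball p t, ‖deriv f z‖ ≤ 2 * A := by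
    intro z hz
    have h1 := hmax (hpt hz)
    simp only [mem_ofPred_eq] at h1
    rw [mem_ball] at hz
    have h2 : ‖deriv f z‖ * t ≤ ‖deriv f z‖ * (R / 2 - dist z z₀) := by
      gcongr
      linarith [dist_triangle z p z₀]
    have h3 : ‖deriv f z‖ * t ≤ 2 * A * t := by
      rw [← hA, show R / 2 - dist p z₀ = 2 * t by rw [ht]; ring] at h1
      linarith
    exact le_of_mul_le_mul_right h3 ht0
  have hlip : ∀ z ∈ ball p t, ‖deriv f z - deriv f p‖ ≤ 3 * A / t * dist z p := by
    intro z hz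
    rw [← dist_eq_norm]
    refine dist_le_div_mul_dist_of_mapsTo_ball (hf'.mono (hpt.trans hsub)) (fun v hv ↦ ?_) hz
    rw [mem_closedBall, dist_eq_norm]
    linarith [norm_sub_le (deriv f v) (deriv f p), hbd v hv]
  have hst : closedBall p (t / 6) ⊆ ball p t := closedBall_subset_ball (by linarith)
  have hfat : ∀ z ∈ closedBall p (t / 6), DifferentiableAt ℂ f z := fun z hz ↦
    hf.differentiableAt (isOpen_ball.mem_nhds (hsub (hpt (hst hz))))
  have hsphere : ∀ z ∈ sphere p (t / 6), A * t / 12 ≤ ‖f z - f p‖ := by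
    intro z hz
    have hzp : ‖z - p‖ = t / 6 := by rwa [← dist_eq_norm]
    have h1 := (convex_closedBall p (t / 6)).norm_image_sub_le_of_norm_deriv_le (𝕜 := ℂ)
      (f := fun z ↦ f z - deriv f p * z) (C := A / 2)
      (fun v hv ↦ (hfat v hv).sub (by fun_prop)) (fun v hv ↦ ?_)
      (mem_closedBall_self (by positivity)) (sphere_subset_closedBall hz)
    · have h2 : deriv f p * (z - p) = (f z - f p) -
          ((fun z ↦ f z - deriv f p * z) z - (fun z ↦ f z - deriv f p * z) p) := by ring
      have h3 := congrArg norm h2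
      rw [norm_mul, hzp] at h3
      rw [hzp] at h1
      linarith [h3.trans_le (norm_sub_le _ _)]
    · rw [deriv_fun_sub (hfat v hv) (by fun_prop), deriv_const_mul_id]
      refine (hlip v (hst hv)).trans ?_
      rw [div_mul_eq_mul_div, div_le_iff₀ ht0]
      have : dist v p ≤ t / 6 := hv
      nlinarith
  have hdc : DiffContOnCl ℂ f (ball p (t / 6)) := by
    refine DifferentiableOn.diffContOnCl fun z hz ↦ ?_
    exact (hfat z (closure_ball_subset_closedBall hz)).differentiableWithinAt
  have hfreq : ∃ᶠ z in 𝓝 p, f z ≠ f p :=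
    ((eventually_ne_of_deriv_ne_zero isOpen_ball (convex_ball z₀ R).isPreconnected hf
      (mem_ball_self hR) (norm_pos_iff.1 hD) (hsub hp)).frequently).filter_mono nhdsWithin_le_nhds
  refine ⟨p, (ball_subset_ball ?_).trans ((hdc.ball_subset_image_closedBall (by positivity)
    hsphere hfreq).trans (image_mono ((hst.trans hpt).trans hsub)))⟩
  linarith

theorem norm_deriv_le_of_mapsTo_of_sparse_compl {f : ℂ → ℂ} {Y : Set ℂ} {z₀ : ℂ} {R : ℝ}
    (hR : 0 < R) (hf : DifferentiableOn ℂ f (ball z₀ R)) (hm : MapsTo f (ball z₀ R) Y)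
    (hY : ∀ c, ∃ p ∉ Y, dist p c ≤ 2) : ‖deriv f z₀‖ ≤ 192 / R := by
  obtain ⟨p, hp⟩ := exists_ball_subset_image_ball hR hf
  obtain ⟨y, hy, hyd⟩ := hY (f p)
  by_contra! h
  rw [div_lt_iff₀ hR] at h
  obtain ⟨v, hv, rfl⟩ := hp (mem_ball.2 (show dist y (f p) < R * ‖deriv f z₀‖ / 96 by linarith))
  exact hy (hm hv)

theorem exists_discLifting_of_subset_ball {Ω : Set ℂ} (hΩ : IsOpen Ω) {y₀ : ℂ} {S : ℝ}
    (hS : 0 < S) (hsub : Ω ⊆ ball y₀ S) (h0 : y₀ ∈ Ω) :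
    ∃ f : ℂ → ℂ, DifferentiableOn ℂ f 𝔻 ∧ MapsTo f 𝔻 Ω ∧ f 0 = y₀ ∧ HasDiscLifting f 𝔻 Ω := by
  have hS' : (S : ℂ) ≠ 0 := by exact_mod_cast hS.ne'
  have hsub' : (fun z ↦ y₀ + S * z) ⁻¹' Ω ⊆ 𝔻 := by
    intro z hz
    have h1 := hsub hz
    rw [mem_ball_iff_norm, add_sub_cancel_left, norm_mul, norm_real, Real.norm_of_nonneg hS.le] at h1
    rw [mem_ball_zero_iff]
    by_contra! h2
    nlinarith
  obtain ⟨h, hd, hm, hh0, hl⟩ := exists_discLifting_of_subset_unitDisc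
    (hΩ.preimage (by fun_prop)) hsub' (by simpa)
  refine ⟨fun z ↦ y₀ + S * h z, by fun_prop, hm, by simp [hh0], fun φ hφ hφm z hz w hw hwz ↦ ?_⟩
  obtain ⟨ψ, hψ, hψz⟩ := hl (fun z ↦ (φ z - y₀) / S) (by fun_prop)
    (fun v hv ↦ by
      rw [mem_preimage, mul_div_cancel₀ _ hS', add_sub_cancel]
      exact hφm hv) z hz w hw
    (by rw [← hwz, add_sub_cancel_left, mul_div_cancel_left₀ _ hS'])
  refine ⟨ψ, ⟨hψ.differentiableOn, hψ.mapsTo, fun v hv ↦ ?_⟩, hψz⟩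
  rw [hψ.apply_eq v hv, mul_div_cancel₀ _ hS', add_sub_cancel]

theorem exists_discLifting_of_sparse_compl {Y : Set ℂ} (hY : IsOpen Y)
    (hs : ∀ c, ∃ p ∉ Y, dist p c ≤ 2) {y₀ : ℂ} (hy₀ : y₀ ∈ Y) :
    ∃ f : ℂ → ℂ, DifferentiableOn ℂ f 𝔻 ∧ MapsTo f 𝔻 Y ∧ f 0 = y₀ ∧ HasDiscLifting f 𝔻 Y := by
  have h00 : (0 : ℂ) ∈ 𝔻 := mem_ball_self one_pos
  have hex := fun n : ℕ ↦ exists_discLifting_of_subset_ball (Ω := Y ∩ ball y₀ (n + 1))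
    (hY.inter isOpen_ball) (by positivity) inter_subset_right
    ⟨hy₀, mem_ball_self (by positivity)⟩
  choose F hFd hFm hF0 hFl using hex
  have hder : ∀ n, ∀ w ∈ 𝔻, ‖deriv (F n) w‖ ≤ 192 / (1 - ‖w‖) := by
    intro n w hw
    have hsub : ball w (1 - ‖w‖) ⊆ 𝔻 := ball_subset_ball' (by rw [dist_zero_right]; linarith)
    exact norm_deriv_le_of_mapsTo_of_sparse_compl (by rw [mem_ball_zero_iff] at hw; linarith)
      ((hFd n).mono hsub) (fun z hz ↦ (hFm n (hsub hz)).1) hs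
  obtain ⟨f, hf⟩ := exists_tendstoLocallyUniformlyOn_of_locally_bounded (hyperfilter ℕ)
      isOpen_ball hFd fun z hz ↦ by
    rw [mem_ball_zero_iff] at hz
    refine ⟨(1 - ‖z‖) / 2, by linarith, ‖y₀‖ + 192 / ((1 - ‖z‖) / 2), fun n w hw ↦ ?_⟩
    have hw1 : w ∈ ball (0 : ℂ) ((1 + ‖z‖) / 2) := by
      have := norm_sub_norm_le w z
      have hwz := mem_ball_iff_norm.1 hw.1
      rw [mem_ball_zero_iff]
      linarith
    have h1 := (convex_ball (0 : ℂ) ((1 + ‖z‖) / 2)).norm_image_sub_le_of_norm_deriv_le (𝕜 := ℂ)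
      (f := F n) (C := 192 / ((1 - ‖z‖) / 2))
      (fun v hv ↦ (hFd n).differentiableAt (isOpen_ball.mem_nhds
        (ball_subset_ball (by linarith) hv))) (fun v hv ↦ ?_)
      (mem_ball_self (by positivity)) hw1
    · rw [hF0, sub_zero] at h1
      have h2 : 192 / ((1 - ‖z‖) / 2) * ‖w‖ ≤ 192 / ((1 - ‖z‖) / 2) :=
        mul_le_of_le_one_right (div_nonneg (by norm_num) (by linarith))
          (mem_ball_zero_iff.1 hw.2).le
      linarith [norm_sub_norm_le (F n w) y₀]
    · refine (hder n v (ball_subset_ball (by linarith) hv)).trans ?_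
      rw [mem_ball_zero_iff] at hv
      gcongr
      linarith
  have hfd : DifferentiableOn ℂ f 𝔻 := hf.differentiableOn (.of_forall hFd) isOpen_ball
  have hf0 : f 0 = y₀ := tendsto_nhds_unique (hf.tendsto_at h00) (by simp [hF0])
  obtain ⟨R, hR, hball⟩ := Metric.isOpen_iff.1 hY y₀ hy₀
  have hRf : min R 1 ≤ ‖deriv f 0‖ := by
    refine ge_of_tendsto ((hf.deriv (.of_forall hFd) isOpen_ball).tendsto_at
      h00).norm (.of_forall fun n ↦ ?_)
    refine (hFl n).le_norm_deriv (hFd n) (lt_min hR one_pos) ?_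
    rw [hF0]
    exact subset_inter ((ball_subset_ball (min_le_left _ _)).trans hball)
      (ball_subset_ball ((min_le_right _ _).trans (by simp)))
  have hne : ∀ w ∈ 𝔻, ∀ᶠ z in 𝓝[≠] w, f z ≠ f w := fun w hw ↦
    eventually_ne_of_deriv_ne_zero isOpen_ball (convex_ball _ _).isPreconnected hfd h00
      (norm_pos_iff.1 ((lt_min hR one_pos).trans_le hRf)) hw
  have hmaps : MapsTo f 𝔻 Y := by
    intro a ha
    by_contra haY
    obtain ⟨n, z, hz, -, hzn⟩ := (eventually_exists_eq_of_tendstoLocallyUniformlyOn isOpen_ball hFd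
      hf ha (hne a ha) (c := fun _ ↦ f a) tendsto_const_nhds one_pos).exists
    exact haY (hzn ▸ (hFm n hz).1)
  have hmul : ∀ {r : ℝ}, 0 < r → r < 1 → ∀ z ∈ 𝔻, (r : ℂ) * z ∈ ball (0 : ℂ) r := by
    intro r hr hr1 z hz
    rw [mem_ball_zero_iff] at *
    rw [norm_mul, norm_real, Real.norm_of_nonneg hr.le]
    exact mul_lt_of_lt_one_right hr hz
  have hshrink : ∀ φ : ℂ → ℂ, DifferentiableOn ℂ φ 𝔻 → MapsTo φ 𝔻 Y → ∀ r : ℝ, 0 < r → r < 1 →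
      ∀ z ∈ 𝔻, ∀ w ∈ 𝔻, f w = φ (r * z) →
        ∃ ψ, IsDiscLift f 𝔻 (fun z ↦ φ (r * z)) ψ ∧ ψ z = w := by
    intro φ hφ hm r hr hr1 z hz w hw hwz
    have hmul' : ∀ z ∈ 𝔻, (r : ℂ) * z ∈ 𝔻 := fun z hz ↦
      ball_subset_ball hr1.le (hmul hr hr1 z hz)
    have hφr : DifferentiableOn ℂ (fun z ↦ φ (r * z)) 𝔻 := hφ.comp (by fun_prop) hmul'
    obtain ⟨B, hB⟩ := ((isCompact_closedBall (0 : ℂ) r).image_of_continuousOn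
      (hφ.continuousOn.mono (closedBall_subset_ball hr1))).isBounded.subset_ball y₀
    refine exists_isDiscLift_of_tendstoLocallyUniformlyOn (hyperfilter ℕ) hFd hf hw (hne w hw)
      (φ := fun _ z ↦ φ (r * z)) (fun _ _ ↦ tendsto_const_nhds) hz hwz ?_
    filter_upwards [Nat.hyperfilter_le_atTop (eventually_ge_atTop ⌈B⌉₊)] with n hn v hv hvn
    refine hFl n _ hφr (fun u hu ↦ ⟨hm (hmul' u hu), ?_⟩) z hz v hv hvn
    refine ball_subset_ball ?_ (hB (mem_image_of_mem φ
      (ball_subset_closedBall (hmul hr hr1 u hu))))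
    have : B ≤ n := (Nat.le_ceil B).trans (by exact_mod_cast hn)
    linarith
  refine ⟨f, hfd, hmaps, hf0, fun φ hφ hm z hz w hw hwz ↦ ?_⟩
  have hr : ∀ n : ℕ, 0 < 1 - 1 / ((n : ℝ) + 2) ∧ 1 - 1 / ((n : ℝ) + 2) < 1 := by
    intro n
    have h1 : 1 / ((n : ℝ) + 2) < 1 := by
      rw [div_lt_one (by positivity)]
      linarith [n.cast_nonneg (α := ℝ)]
    have h2 : 0 < 1 / ((n : ℝ) + 2) := by positivity
    constructor <;> linarith
  have hrlim : Tendsto (fun n : ℕ ↦ 1 - 1 / ((n : ℝ) + 2)) atTop (𝓝 1) := by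
    simpa [add_assoc, one_add_one_eq_two] using
      (tendsto_one_div_add_atTop_nhds_zero_nat (𝕜 := ℝ)).comp (tendsto_add_atTop_nat 1)
        |>.const_sub 1
  refine exists_isDiscLift_of_tendstoLocallyUniformlyOn (hyperfilter ℕ) (F := fun _ ↦ f)
    (φ := fun n z ↦ φ (((1 - 1 / ((n : ℝ) + 2) : ℝ) : ℂ) * z)) (fun _ ↦ hfd)
    (fun u hu x _ ↦ ⟨univ, univ_mem, .of_forall fun _ _ _ ↦ refl_mem_uniformity hu⟩)
    hw (hne w hw) (fun v hv ↦ ?_) hz hwz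
    (.of_forall fun n v hv hvn ↦ hshrink φ hφ hm _ (hr n).1 (hr n).2 z hz v hv hvn)
  refine Tendsto.comp (hφ.differentiableAt (isOpen_ball.mem_nhds hv)).continuousAt ?_
  have := ((continuous_ofReal.tendsto 1).comp hrlim).mul_const v
  simp only [ofReal_one, one_mul] at this
  exact this.mono_left Nat.hyperfilter_le_atTop

theorem hasDiscLifting_cos : HasDiscLifting (fun z ↦ cos (π * z)) univ {1, -1}ᶜ := by
  intro φ hφ hm z hz w _ hwz
  have hpi : (π : ℂ) ≠ 0 := by exact_mod_cast Real.pi_ne_zero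
  obtain ⟨σ, hσ, hσφ⟩ := exists_sq_eq_of_differentiableOn_unitDisc (h := fun z ↦ 1 - φ z ^ 2)
    (by fun_prop) fun v hv h ↦ hm hv (sq_eq_sq_iff_eq_or_eq_neg.1 (by
      rw [one_pow]; exact (sub_eq_zero.1 h).symm))
  have hmul : ∀ v ∈ 𝔻, (φ v + I * σ v) * (φ v - I * σ v) = 1 := by
    intro v hv
    linear_combination hσφ v hv - σ v ^ 2 * I_sq
  obtain ⟨L, hL, hLφ⟩ := exists_exp_eq_of_differentiableOn_unitDisc
    (h := fun z ↦ φ z + I * σ z) (by fun_prop) fun v hv ↦ left_ne_zero_of_mul_eq_one (hmul v hv)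
  set ψ : ℂ → ℂ := fun v ↦ -I * L v / π with hψ
  have hψd : DifferentiableOn ℂ ψ 𝔻 := by fun_prop
  have hcos : ∀ v ∈ 𝔻, cos (π * ψ v) = φ v := by
    intro v hv
    have h1 : π * ψ v * I = L v := by
      simp only [hψ]
      field_simp
      linear_combination (-L v) * I_sq
    rw [cos, neg_mul, h1, exp_neg, hLφ v hv, inv_eq_of_mul_eq_one_right (hmul v hv)]
    ring
  obtain ⟨k, hk | hk⟩ := cos_eq_cos_iff.1 ((hcos z hz).trans hwz.symm)
  · refine ⟨fun v ↦ 2 * k + ψ v, ⟨by fun_prop, fun _ _ ↦ mem_univ _, fun v hv ↦ ?_⟩, ?_⟩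
    · rw [← hcos v hv]
      exact (cos_eq_cos_iff.2 ⟨k, .inl (by ring)⟩).symm
    · refine mul_left_cancel₀ hpi ?_
      rw [hk]
      ring
  · refine ⟨fun v ↦ 2 * k - ψ v, ⟨by fun_prop, fun _ _ ↦ mem_univ _, fun v hv ↦ ?_⟩, ?_⟩
    · rw [← hcos v hv]
      exact (cos_eq_cos_iff.2 ⟨k, .inr (by ring)⟩).symm
    · refine mul_left_cancel₀ hpi ?_
      rw [hk]
      ring

theorem cosh_add_one_le_cosh_add_pi {a : ℝ} (ha : 0 ≤ a) :
    Real.cosh a + 1 ≤ Real.cosh (a + π) := by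
  have h1 : 2 ≤ Real.cosh π := by
    rw [Real.cosh_eq]
    linarith [Real.add_one_le_exp π, Real.exp_pos (-π), Real.pi_gt_three]
  rw [Real.cosh_add]
  have h2 : 0 ≤ Real.sinh a * Real.sinh π :=
    mul_nonneg (Real.sinh_nonneg_iff.2 ha) (Real.sinh_nonneg_iff.2 Real.pi_pos.le)
  nlinarith [Real.one_le_cosh a]

theorem complex_cos_int_mul_pi (n : ℤ) : cos (n * π) = 1 ∨ cos (n * π) = -1 := by
  have h := Real.cos_int_mul_pi n
  rcases n.even_or_odd with hn | hn
  · rw [hn.neg_one_zpow] at h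
    exact .inl (by exact_mod_cast h)
  · rw [hn.neg_one_zpow] at h
    exact .inr (by exact_mod_cast h)

/-- The points where `cos (π * z)` is an integer are 2-dense in the plane. -/
theorem exists_dist_le_two_cos_eq_intCast (c : ℂ) :
    ∃ p : ℂ, dist p c ≤ 2 ∧ ∃ n : ℤ, cos (π * p) = n := by
  have hle : |c.im| ≤ |c.im| + 1 := by linarith
  obtain ⟨t, ht, htn⟩ := intermediate_value_Icc hle
    (f := fun t ↦ Real.cosh (π * t)) (by fun_prop)
    (show (⌈Real.cosh (π * |c.im|)⌉ : ℝ) ∈ _ from ⟨Int.le_ceil _, by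
      have h1 := cosh_add_one_le_cosh_add_pi (a := π * |c.im|) (by positivity)
      simp only [mul_add, mul_one]
      linarith [Int.ceil_lt_add_one (Real.cosh (π * |c.im|))]⟩)
  set n := ⌈Real.cosh (π * |c.im|)⌉
  obtain ⟨s, hs, hcosh⟩ : ∃ s, |s - c.im| ≤ 1 ∧ Real.cosh (π * s) = n := by
    rcases abs_cases c.im with ⟨h, -⟩ | ⟨h, -⟩
    · refine ⟨t, ?_, htn⟩
      rw [abs_le]
      constructor <;> linarith [ht.1, ht.2]
    · refine ⟨-t, ?_, by rw [mul_neg, Real.cosh_neg]; exact htn⟩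
      rw [abs_le]
      constructor <;> linarith [ht.1, ht.2]
  refine ⟨round c.re + s * I, ?_, ?_⟩
  · rw [dist_eq_norm]
    refine (norm_le_abs_re_add_abs_im _).trans ?_
    have := abs_sub_round c.re
    rw [abs_sub_comm] at this
    simp
    linarith
  · have h1 : (π : ℂ) * (round c.re + s * I) = (round c.re) * π + ((π * s : ℝ) : ℂ) * I := by
      push_cast; ring
    rw [h1, cos_add_mul_I, sin_int_mul_pi, ← ofReal_cosh, hcosh]
    rcases complex_cos_int_mul_pi (round c.re) with h | h
    · exact ⟨n, by rw [h]; simp⟩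
    · exact ⟨-n, by rw [h]; simp⟩

theorem exists_discLifting_of_two_point_complement {Ω : Set ℂ} (hΩ : IsOpen Ω) (hne : Ω.Nonempty)
    {p q : ℂ} (hp : p ∉ Ω) (hq : q ∉ Ω) (hpq : p ≠ q) :
    ∃ f : ℂ → ℂ, DifferentiableOn ℂ f 𝔻 ∧ MapsTo f 𝔻 Ω ∧ HasDiscLifting f 𝔻 Ω := by
  obtain ⟨x, hx⟩ := hne
  have hpi : (π : ℂ) ≠ 0 := by exact_mod_cast Real.pi_ne_zero
  have hpq' : p - q ≠ 0 := sub_ne_zero.2 hpq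
  set c : ℂ → ℂ := fun z ↦ cos (π * z) with hc
  set A : ℂ → ℂ := fun z ↦ (p + q) / 2 + (p - q) / 2 * z with hA
  have hAp : A 1 = p := by simp only [hA]; ring
  have hAq : A (-1) = q := by simp only [hA]; ring
  have hAinv : ∀ y, A ((y - (p + q) / 2) * (2 / (p - q))) = y := by
    intro y
    simp only [hA]
    field_simp
    ring
  have hAl : HasDiscLifting A univ Ω := by
    intro φ hφ hm z hz w _ hwz
    refine ⟨fun v ↦ (φ v - (p + q) / 2) * (2 / (p - q)), ⟨by fun_prop, fun _ _ ↦ mem_univ _,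
      fun v _ ↦ hAinv (φ v)⟩, ?_⟩
    simp only [← hwz, hA]
    field_simp
    ring
  have hcA : ∀ z, c z = 1 ∨ c z = -1 → A (c z) ∉ Ω := by
    rintro z (h | h) <;> rw [h]
    · rwa [hAp]
    · rwa [hAq]
  have hcsurj : Function.Surjective c := fun y ↦ by
    obtain ⟨v, hv⟩ := cos_surjective y
    exact ⟨v / π, by simp only [hc]; rw [mul_div_cancel₀ _ hpi, hv]⟩
  have hcint : ∀ n : ℤ, c n = 1 ∨ c n = -1 := fun n ↦ by
    simpa only [hc, mul_comm] using complex_cos_int_mul_pi n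
  have hAcl : HasDiscLifting (A ∘ c) univ Ω := by
    refine hAl.comp (hasDiscLifting_cos.mono ?_) (mapsTo_univ _ _)
    rintro z ⟨-, hz⟩ (rfl | rfl)
    · exact hp (hAp ▸ hz)
    · exact hq (hAq ▸ hz)
  have hAccl : HasDiscLifting ((A ∘ c) ∘ c) univ Ω := by
    refine hAcl.comp (hasDiscLifting_cos.mono ?_) (mapsTo_univ _ _)
    rintro z ⟨-, hz⟩ (rfl | rfl)
    · exact hcA 1 (by exact_mod_cast hcint 1) hz
    · exact hcA (-1) (by exact_mod_cast hcint (-1)) hz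
  have hcd : Differentiable ℂ c := by fun_prop
  have hd : Differentiable ℂ ((A ∘ c) ∘ c) := by fun_prop
  obtain ⟨u, hu⟩ := hcsurj ((x - (p + q) / 2) * (2 / (p - q)))
  obtain ⟨v, rfl⟩ := hcsurj u
  obtain ⟨g, hgd, hgm, -, hgl⟩ := exists_discLifting_of_sparse_compl
    (hΩ.preimage hd.continuous) (fun b ↦ by
      obtain ⟨y, hy, n, hn⟩ := exists_dist_le_two_cos_eq_intCast b
      exact ⟨y, fun h ↦ hcA (c y) (by simpa only [← hn] using hcint n) h, hy⟩)
    (y₀ := v) (by rw [mem_preimage, Function.comp_apply, Function.comp_apply, hu, hAinv]; exact hx)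
  exact ⟨((A ∘ c) ∘ c) ∘ g, hd.comp_differentiableOn hgd, hgm,
    hAccl.comp (hgl.mono inter_subset_right) (mapsTo_univ _ _)⟩

theorem IsDiscLift.eqOn {f φ ψ χ : ℂ → ℂ} {U : Set ℂ} (hU : IsOpen U)
    (hf : DifferentiableOn ℂ f U) (hf' : ∀ w ∈ U, deriv f w ≠ 0) (hψ : IsDiscLift f U φ ψ)
    (hχ : IsDiscLift f U φ χ) {z : ℂ} (hz : z ∈ 𝔻) (h : ψ z = χ z) : EqOn ψ χ 𝔻 := by
  have hzU := hψ.mapsTo hz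
  obtain ⟨g, hg⟩ : ∃ g : ℂ → ℂ, ∀ᶠ x in 𝓝 (ψ z), g (f x) = x :=
    ⟨_, (hf.analyticOnNhd hU _ hzU).hasStrictDerivAt.eventually_left_inverse (hf' _ hzU)⟩
  have hD := isOpen_ball.mem_nhds hz
  have h1 := (hψ.differentiableOn.differentiableAt hD).continuousAt.eventually hg
  have h2 := (hχ.differentiableOn.differentiableAt hD).continuousAt.eventually (h ▸ hg)
  refine (hψ.differentiableOn.analyticOnNhd isOpen_ball).eqOn_of_preconnected_of_eventuallyEq
    (hχ.differentiableOn.analyticOnNhd isOpen_ball) (convex_ball (0 : ℂ) 1).isPreconnected hz ?_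
  filter_upwards [h1, h2, hD] with v hv1 hv2 hv
  rw [← hv1, ← hv2, hψ.apply_eq v hv, hχ.apply_eq v hv]

theorem IsDiscLift.injOn {f φ ψ : ℂ → ℂ} {U : Set ℂ} (h : IsDiscLift f U φ ψ)
    (hφ : InjOn φ 𝔻) : InjOn ψ 𝔻 := fun a ha b hb hab ↦
  hφ ha hb (by rw [← h.apply_eq a ha, ← h.apply_eq b hb, hab])

theorem isOpen_image_unitDisc_of_injOn {ψ : ℂ → ℂ} (hψ : DifferentiableOn ℂ ψ 𝔻)
    (hinj : InjOn ψ 𝔻) : IsOpen (ψ '' 𝔻) := by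
  rcases (hψ.analyticOnNhd isOpen_ball).is_constant_or_isOpen
    (convex_ball (0 : ℂ) 1).isPreconnected with ⟨w, hw⟩ | h
  · have h0 : (0 : ℂ) ∈ 𝔻 := mem_ball_self one_pos
    have h1 : (1 / 2 : ℂ) ∈ 𝔻 := by rw [mem_ball_zero_iff]; norm_num
    have := hinj h0 h1 ((hw _ h0).trans (hw _ h1).symm)
    norm_num at this
  · exact h _ Subset.rfl isOpen_ball

theorem div_mem_unitDisc {x y : ℂ} {R : ℝ} (hR : 0 < R) (hy : y ∈ ball x R) :
    (y - x) / R ∈ 𝔻 := by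
  rw [mem_ball_iff_norm] at hy
  rw [mem_ball_zero_iff, norm_div, norm_real, Real.norm_of_nonneg hR.le]
  exact (div_lt_one hR).2 hy

theorem add_mul_mem_ball {x z : ℂ} {R : ℝ} (hR : 0 < R) (hz : z ∈ 𝔻) : x + R * z ∈ ball x R := by
  rw [mem_ball_zero_iff] at hz
  simpa [abs_of_pos hR] using mul_lt_of_lt_one_right hR hz

theorem add_mul_sub_div {x y : ℂ} {R : ℝ} (hR : 0 < R) : x + R * ((y - x) / R) = y := by
  have : (R : ℂ) ≠ 0 := by exact_mod_cast hR.ne'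
  rw [mul_div_cancel₀ _ this, add_sub_cancel]

theorem HasDiscLifting.exists_lift_ball_of_mem {f : ℂ → ℂ} {U Ω : Set ℂ}
    (hf : HasDiscLifting f U Ω) {x w : ℂ} (hw : w ∈ U) {R : ℝ} (hR : 0 < R)
    (hball : ball x R ⊆ Ω) (hfw : f w ∈ ball x R) :
    ∃ ψ, IsDiscLift f U (fun z ↦ x + R * z) ψ ∧ ψ ((f w - x) / R) = w :=
  hf _ (by fun_prop) (fun _ hz ↦ hball (add_mul_mem_ball hR hz)) _ (div_mem_unitDisc hR hfw) w hw
    (add_mul_sub_div hR).symm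

theorem HasDiscLifting.ball_subset_image {f : ℂ → ℂ} {U Ω : Set ℂ}
    (hf : HasDiscLifting f U Ω) {x w : ℂ} (hw : w ∈ U) {R : ℝ} (hR : 0 < R)
    (hball : ball x R ⊆ Ω) (hfw : f w ∈ ball x R) : ball x R ⊆ f '' U := by
  obtain ⟨ψ, hψ, -⟩ := hf.exists_lift_ball_of_mem hw hR hball hfw
  intro y hy
  have hy' := div_mem_unitDisc hR hy
  exact ⟨_, hψ.mapsTo hy', (hψ.apply_eq _ hy').trans (add_mul_sub_div hR)⟩

theorem HasDiscLifting.image_eq {f : ℂ → ℂ} {U Ω : Set ℂ} (hf : HasDiscLifting f U Ω)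
    (hΩ : IsOpen Ω) (hc : IsPreconnected Ω) (hU : U.Nonempty) (hm : MapsTo f U Ω) :
    f '' U = Ω := by
  have hu : IsOpen (f '' U) := by
    rw [Metric.isOpen_iff]
    rintro _ ⟨w, hw, rfl⟩
    obtain ⟨R, hR, hball⟩ := Metric.isOpen_iff.1 hΩ _ (hm hw)
    exact ⟨R, hR, hf.ball_subset_image hw hR hball (mem_ball_self hR)⟩
  have hv : IsOpen (Ω \ f '' U) := by
    rw [Metric.isOpen_iff]
    rintro x ⟨hx, hxU⟩
    obtain ⟨R, hR, hball⟩ := Metric.isOpen_iff.1 hΩ _ hx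
    refine ⟨R, hR, fun y hy ↦ ⟨hball hy, ?_⟩⟩
    rintro ⟨w, hw, rfl⟩
    exact hxU (hf.ball_subset_image hw hR hball hy (mem_ball_self hR))
  obtain ⟨w, hw⟩ := hU
  refine Subset.antisymm hm.image_subset (hc.subset_left_of_subset_union hu hv disjoint_sdiff_right
    (by simp) ⟨f w, hm hw, mem_image_of_mem f hw⟩)

theorem HasDiscLifting.isCoveringMap_restrict {f : ℂ → ℂ} {Ω : Set ℂ}
    (hf : HasDiscLifting f 𝔻 Ω) (hfd : DifferentiableOn ℂ f 𝔻) (hΩ : IsOpen Ω)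
    (hsurj : f '' 𝔻 = Ω) (hm : MapsTo f 𝔻 Ω) : IsCoveringMap (hm.restrict f 𝔻 Ω) := by
  rintro ⟨x, hx⟩
  obtain ⟨R, hR, hball⟩ := Metric.isOpen_iff.1 hΩ x hx
  have hR' : (R : ℂ) ≠ 0 := by exact_mod_cast hR.ne'
  have h00 : (0 : ℂ) ∈ 𝔻 := mem_ball_self one_pos
  have hf' : ∀ w ∈ 𝔻, deriv f w ≠ 0 := fun w hw ↦
    hf.deriv_ne_zero hΩ hw (hm hw) (hfd.differentiableAt (isOpen_ball.mem_nhds hw))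
  have hinj : InjOn (fun z : ℂ ↦ x + R * z) 𝔻 := fun a _ b _ hab ↦
    mul_left_cancel₀ hR' (add_left_cancel hab)
  set ι := {w : ℂ // w ∈ 𝔻 ∧ f w = x}
  have hlift : ∀ i : ι, ∃ ψ, IsDiscLift f 𝔻 (fun z ↦ x + R * z) ψ ∧ ψ 0 = i := by
    rintro ⟨w, hw, rfl⟩
    exact hf.exists_lift_ball hw hR hball
  choose ψ hψ hψ0 using hlift
  let _ : TopologicalSpace ι := ⊥
  have : DiscreteTopology ι := ⟨rfl⟩
  have : Nonempty 𝔻 := ⟨⟨0, h00⟩⟩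
  have : Nonempty ι := by
    obtain ⟨w, hw, hwx⟩ := hsurj.symm.subset hx
    exact ⟨⟨w, hw, hwx⟩⟩
  have hV : IsOpen ((↑) ⁻¹' ball x R : Set Ω) := isOpen_ball.preimage continuous_subtype_val
  have hUo : ∀ i, IsOpen ((↑) ⁻¹' (ψ i '' 𝔻) : Set 𝔻) := fun i ↦
    (isOpen_image_unitDisc_of_injOn (hψ i).differentiableOn ((hψ i).injOn hinj)).preimage
      continuous_subtype_val
  have hcont : Continuous (hm.restrict f 𝔻 Ω) := hfd.continuousOn.mapsToRestrict hm
  refine (IsEvenlyCovered.of_trivialization (I := ι) (t := hV.trivializationDiscrete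
    (fun i ↦ ((↑) ⁻¹' (ψ i '' 𝔻) : Set 𝔻)) _ ?_ ?_ ?_ ?_ ?_) ?_).to_isEvenlyCovered_preimage
  · intro i W hW
    refine ⟨fun h ↦ (h.preimage hcont).inter (hUo i), fun h ↦ ?_⟩
    have hO := isOpen_ball.isOpenMap_subtype_val _ h
    have hs : ContinuousOn (fun y ↦ ψ i ((y - x) / R)) (ball x R) :=
      (hψ i).differentiableOn.continuousOn.comp (by fun_prop) fun y hy ↦ div_mem_unitDisc hR hy
    convert (hs.isOpen_inter_preimage isOpen_ball hO).preimage
      (continuous_subtype_val (p := (· ∈ Ω))) using 1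
    ext y
    constructor
    · intro hy
      have hyD := div_mem_unitDisc hR (hW hy)
      refine ⟨hW hy, ⟨_, (hψ i).mapsTo hyD⟩, ⟨?_, mem_image_of_mem _ hyD⟩, rfl⟩
      have he : hm.restrict f 𝔻 Ω ⟨_, (hψ i).mapsTo hyD⟩ = y :=
        Subtype.ext (((hψ i).apply_eq _ hyD).trans (add_mul_sub_div hR))
      rwa [mem_preimage, he]
    · rintro ⟨hy, v, ⟨hv, -⟩, hvy⟩
      have hyD := div_mem_unitDisc hR hy
      have he : hm.restrict f 𝔻 Ω v = y := Subtype.ext <| by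
        rw [MapsTo.val_restrict_apply, hvy, (hψ i).apply_eq _ hyD, add_mul_sub_div hR]
      rwa [mem_preimage, he] at hv
  · rintro i ⟨_, _⟩ ⟨a, ha, rfl⟩ ⟨_, _⟩ ⟨b, hb, rfl⟩ hab
    have h1 : f (ψ i a) = f (ψ i b) := congrArg Subtype.val hab
    rw [(hψ i).apply_eq a ha, (hψ i).apply_eq b hb] at h1
    exact Subtype.ext (congrArg (ψ i) (hinj ha hb h1))
  · intro i y hy
    have hyD := div_mem_unitDisc hR hy
    exact ⟨⟨_, (hψ i).mapsTo hyD⟩, mem_image_of_mem _ hyD,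
      Subtype.ext (((hψ i).apply_eq _ hyD).trans (add_mul_sub_div hR))⟩
  · intro i j hij
    refine Set.disjoint_left.2 ?_
    rintro ⟨_, _⟩ ⟨a, ha, rfl⟩ ⟨b, hb, hab⟩
    refine hij (Subtype.ext ?_)
    have h1 := congrArg f hab
    rw [(hψ j).apply_eq b hb, (hψ i).apply_eq a ha] at h1
    obtain rfl := hinj hb ha h1
    rw [← hψ0 i, ← hψ0 j]
    exact (hψ i).eqOn isOpen_ball hfd hf' (hψ j) ha hab.symm h00
  · rintro ⟨w, hw⟩ hfw
    obtain ⟨χ, hχ, hχw⟩ := hf.exists_lift_ball_of_mem hw hR hball hfw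
    have hwD := div_mem_unitDisc hR hfw
    refine mem_iUnion.2 ⟨⟨χ 0, hχ.mapsTo h00, by simp [hχ.apply_eq 0 h00]⟩, _, hwD, ?_⟩
    exact ((hψ _).eqOn isOpen_ball hfd hf' hχ h00 (hψ0 _) hwD).trans hχw
  · exact mem_ball_self hR

end

/-- If `Ω ⊆ ℂ` is a nonempty open connected set whose complement contains at least
two points, then there is a holomorphic covering map from the unit disk onto `Ω`. -/
theorem exists_holomorphic_covering_of_two_point_complement
    (Ω : Set ℂ) (hne : Ω.Nonempty) (hopen : IsOpen Ω) (hconn : IsConnected Ω)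
    (h2 : ∃ p q : ℂ, p ∉ Ω ∧ q ∉ Ω ∧ p ≠ q) :
    ∃ f : ℂ → ℂ, IsHolomorphicCoveringOnto f (Metric.ball 0 1) Ω := by
  obtain ⟨p, q, hp, hq, hpq⟩ := h2
  obtain ⟨f, hfd, hfm, hfl⟩ := exists_discLifting_of_two_point_complement hopen hne hp hq hpq
  have him := hfl.image_eq hopen hconn.isPreconnected ⟨0, Metric.mem_ball_self one_pos⟩ hfm
  exact ⟨f, hfd, him, hfl.isCoveringMap_restrict hfd hopen him⟩
end

section
/- There exists a holomorphic covering map from the open unit disk D₁ = {z ∈ ℂ : |z| < 1} onto the twice-punctured plane ℂ \ {0, 1}, i.e. a holomorphic map ψ : D₁ → ℂ with ψ(D₁) = ℂ \ {0,1} which is a topological covering map onto ℂ \ {0,1}. -/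
section

open Complex Filter Topology
open UpperHalfPlane hiding I I_im
open scoped ModularForm

section Covering
variable {E X : Type*} [TopologicalSpace E] [TopologicalSpace X] {p : E → X}

theorem IsLocalHomeomorph.isOpen_image_section (hp : IsLocalHomeomorph p) {W : Set X} {s : X → E}
    (hW : IsOpen W) (hs : ContinuousOn s W) (hps : ∀ y ∈ W, p (s y) = y) : IsOpen (s '' W) := by
  rw [isOpen_iff_mem_nhds]
  rintro _ ⟨y, hy, rfl⟩
  obtain ⟨φ, hφ, rfl⟩ := hp (s y)
  have hW' : ∀ᶠ e in 𝓝 (s y), φ e ∈ W :=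
    hp.continuous.continuousAt.eventually_mem (by rw [hps y hy]; exact hW.mem_nhds hy)
  have hsφ : ContinuousAt (fun e ↦ s (φ e)) (s y) :=
    ContinuousAt.comp (by rw [hps y hy]; exact hs.continuousAt (hW.mem_nhds hy))
      hp.continuous.continuousAt
  have hmem : ∀ᶠ e in 𝓝 (s y), s (φ e) ∈ φ.source :=
    hsφ.eventually_mem (by rw [hps y hy]; exact φ.open_source.mem_nhds hφ)
  filter_upwards [hW', hmem, φ.open_source.mem_nhds hφ] with e he hse heφ
  exact ⟨φ e, he, φ.injOn hse heφ (hps _ he)⟩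

theorem IsLocalHomeomorph.isCoveringMap_of_forall_exists_section [T2Space E]
    [LocallyConnectedSpace X] (hp : IsLocalHomeomorph p) (hsurj : Function.Surjective p)
    (h : ∀ x : X, ∃ U ∈ 𝓝 x, ∀ e, p e ∈ U →
      ∃ s : X → E, ContinuousOn s U ∧ (∀ y ∈ U, p (s y) = y) ∧ s (p e) = e) :
    IsCoveringMap p := by
  have hdisc (x : X) : DiscreteTopology (p ⁻¹' {x}) :=
    (IsDiscrete.of_openPartialHomeomorph p subset_rfl fun e _ ↦
      (hp e).imp fun φ hφ ↦ ⟨hφ.1, hφ.2.symm⟩).1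
  intro x
  obtain ⟨U, hU, hsec⟩ := h x
  have hxU : x ∈ interior U := mem_interior_iff_mem_nhds.mpr hU
  set V := connectedComponentIn (interior U) x
  have hVo : IsOpen V := isOpen_interior.connectedComponentIn
  have hxV : x ∈ V := mem_connectedComponentIn hxU
  have hVU : V ⊆ U := (connectedComponentIn_subset _ _).trans interior_subset
  have hV : IsPreconnected V := isPreconnected_connectedComponentIn
  have huniq {s t : X → E} (hs : ContinuousOn s V) (ht : ContinuousOn t V)
      (hps : ∀ y ∈ V, p (s y) = y) (hpt : ∀ y ∈ V, p (t y) = y) {y : X} (hy : y ∈ V)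
      (hst : s y = t y) : V.EqOn s t :=
    (T2Space.isSeparatedMap p).eqOn_of_comp_eqOn hp.isLocallyInjective hV hs ht
      (fun z hz ↦ (hps z hz).trans (hpt z hz).symm) hy hst
  have hsec' (i : p ⁻¹' {x}) :
      ∃ s : X → E, ContinuousOn s V ∧ (∀ y ∈ V, p (s y) = y) ∧ s x = i := by
    obtain ⟨s, hs, hps, hsi⟩ := hsec i (hVU (by rwa [show p i = x from i.2]))
    exact ⟨s, hs.mono hVU, fun y hy ↦ hps y (hVU hy), by rwa [show p i = x from i.2] at hsi⟩
  choose s hs hps hsx using hsec'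
  obtain ⟨e₀, he₀⟩ := hsurj x
  have : Nonempty (p ⁻¹' {x}) := ⟨⟨e₀, he₀⟩⟩
  have : Nonempty (X → E) := ⟨fun _ ↦ e₀⟩
  have himage (i) {W : Set X} (hW : W ⊆ V) : p ⁻¹' W ∩ s i '' V = s i '' W := by
    ext e
    constructor
    · rintro ⟨he, y, hy, rfl⟩
      exact ⟨y, by rwa [Set.mem_preimage, hps i y hy] at he, rfl⟩
    · rintro ⟨y, hy, rfl⟩
      exact ⟨by rwa [Set.mem_preimage, hps i y (hW hy)], y, hW hy, rfl⟩
  refine IsEvenlyCovered.of_trivialization (t := IsOpen.trivializationDiscrete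
    (fun i ↦ s i '' V) V hVo ?_ ?_ ?_ ?_ ?_) hxV
  · intro i W hW
    rw [himage i hW]
    refine ⟨fun h ↦ hp.isOpen_image_section h ((hs i).mono hW) fun y hy ↦ hps i y (hW hy),
      fun h ↦ ?_⟩
    have := hp.isOpenMap _ h
    rwa [Set.image_image, Set.image_congr fun y hy ↦ hps i y (hW hy), Set.image_id'] at this
  · rintro i _ ⟨y, hy, rfl⟩ _ ⟨z, hz, rfl⟩ hyz
    rw [hps i y hy, hps i z hz] at hyz
    rw [hyz]
  · exact fun i y hy ↦ ⟨s i y, ⟨y, hy, rfl⟩, hps i y hy⟩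
  · intro i j hij
    refine Set.disjoint_left.mpr ?_
    rintro _ ⟨y, hy, rfl⟩ ⟨z, hz, hzy⟩
    have hyz : z = y := by rw [← hps j z hz, hzy, hps i y hy]
    rw [hyz] at hzy
    refine hij (Subtype.ext ?_)
    rw [← hsx i, ← hsx j]
    exact huniq (hs i) (hs j) (hps i) (hps j) hy hzy.symm hxV
  · intro e he
    obtain ⟨t, ht, hpt, hte⟩ := hsec e (hVU he)
    refine Set.mem_iUnion.mpr ⟨⟨t x, hpt x (hVU hxV)⟩, p e, he, ?_⟩
    rw [huniq (hs _) (ht.mono hVU) (hps _) (fun y hy ↦ hpt y (hVU hy)) hxV (hsx _) he, hte]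

theorem IsLocalHomeomorph.surjective_of_forall_exists_section [PreconnectedSpace X] [Nonempty E]
    (hp : IsLocalHomeomorph p)
    (h : ∀ x : X, ∃ U ∈ 𝓝 x, ∀ e, p e ∈ U →
      ∃ s : X → E, ContinuousOn s U ∧ (∀ y ∈ U, p (s y) = y) ∧ s (p e) = e) :
    Function.Surjective p := by
  have hclosed : IsClosed (Set.range p) := by
    rw [← closure_subset_iff_isClosed]
    intro x hx
    obtain ⟨U, hU, hs⟩ := h x
    obtain ⟨_, hyU, e, rfl⟩ := mem_closure_iff_nhds.mp hx U hU
    obtain ⟨s, -, hps, -⟩ := hs e hyU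
    exact ⟨s x, hps x (mem_of_mem_nhds hU)⟩
  rw [← Set.range_eq_univ]
  exact IsClopen.eq_univ ⟨hclosed, hp.isOpenMap.isOpen_range⟩ (Set.range_nonempty p)

theorem IsLocalHomeomorph.exists_nhds_section_of_isCompact [T2Space X]
    (hp : IsLocalHomeomorph p) {K : Set E} (hK : IsCompact K) (x : X) :
    ∃ U ∈ 𝓝 x, ∀ e ∈ K, p e ∈ U →
      ∃ s : X → E, ContinuousOn s U ∧ (∀ y ∈ U, p (s y) = y) ∧ s (p e) = e := by
  choose φ hφ hpφ using hp
  have hp : IsLocalHomeomorph p := fun e ↦ ⟨φ e, hφ e, hpφ e⟩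
  obtain ⟨t, ht, hcover⟩ := (hK.inter_right (isClosed_singleton.preimage hp.continuous
    : IsClosed (p ⁻¹' {x}))).elim_nhds_subcover (fun e ↦ (φ e).source)
      fun e _ ↦ (φ e).open_source.mem_nhds (hφ e)
  refine ⟨(⋂ e ∈ t, (φ e).target) ∩ (p '' (K \ ⋃ e ∈ t, (φ e).source))ᶜ, inter_mem ?_ ?_, ?_⟩
  · rw [biInter_finset_mem]
    intro e he
    refine (φ e).open_target.mem_nhds ?_
    rw [← (ht e he).2, congrFun (hpφ e) e]
    exact (φ e).map_source (hφ e)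
  · refine IsClosed.compl_mem_nhds (((hK.diff (isOpen_biUnion fun e _ ↦
      (φ e).open_source)).image hp.continuous).isClosed) ?_
    rintro ⟨e, ⟨heK, he⟩, hex⟩
    exact he (hcover ⟨heK, hex⟩)
  · rintro e heK ⟨h1, h2⟩
    have he : e ∈ ⋃ e ∈ t, (φ e).source := by
      by_contra hne
      exact h2 ⟨e, ⟨heK, hne⟩, rfl⟩
    obtain ⟨i, hi, hei⟩ := Set.mem_iUnion₂.mp he
    have htarget {y} (hy : y ∈ (⋂ e ∈ t, (φ e).target) ∩ (p '' (K \ ⋃ e ∈ t, (φ e).source))ᶜ) :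
        y ∈ (φ i).target := Set.mem_iInter₂.mp hy.1 i hi
    refine ⟨(φ i).symm, (φ i).continuousOn_symm.mono fun y hy ↦ htarget hy, fun y hy ↦ ?_, ?_⟩
    · rw [hpφ i, (φ i).right_inv (htarget hy)]
    · rw [hpφ i, (φ i).left_inv hei]

theorem IsLocalHomeomorph.exists_nhds_section_of_symmetries [T2Space X]
    (hp : IsLocalHomeomorph p) {F : Set (X ≃ₜ X)} (hF : F.Finite) {K : Set E} (hK : IsCompact K)
    {N : Set X} {x : X} (hN : N ∈ 𝓝 x)
    (h : ∀ e, p e ∈ N → ∃ g : E ≃ₜ E, g e ∈ K ∧ ∃ σ ∈ F, ∀ e', p (g e') = σ (p e')) :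
    ∃ U ∈ 𝓝 x, ∀ e, p e ∈ U →
      ∃ s : X → E, ContinuousOn s U ∧ (∀ y ∈ U, p (s y) = y) ∧ s (p e) = e := by
  choose V hV hs using hp.exists_nhds_section_of_isCompact hK
  refine ⟨N ∩ ⋂ σ ∈ F, σ ⁻¹' V (σ x), inter_mem hN ?_, ?_⟩
  · rw [biInter_mem hF]
    exact fun σ _ ↦ σ.continuous.continuousAt (hV _)
  · rintro e ⟨heN, heV⟩
    obtain ⟨g, hgK, σ, hσ, hg⟩ := h e heN
    have hmaps : Set.MapsTo σ (N ∩ ⋂ σ ∈ F, σ ⁻¹' V (σ x)) (V (σ x)) := fun y hy ↦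
      Set.mem_iInter₂.mp hy.2 σ hσ
    obtain ⟨s, hsc, hps, hse⟩ := hs (σ x) (g e) hgK (by rw [hg]; exact hmaps ⟨heN, heV⟩)
    refine ⟨g.symm ∘ s ∘ σ, g.symm.continuous.comp_continuousOn
      (hsc.comp σ.continuous.continuousOn hmaps), fun y hy ↦ σ.injective ?_, ?_⟩
    · rw [← hg, Function.comp_apply, Function.comp_apply, g.apply_symm_apply, hps _ (hmaps hy)]
    · rw [Function.comp_apply, Function.comp_apply, ← hg, hse, g.symm_apply_apply]

end Covering

/-- A holomorphic function on `ℍ` with the level one modular transformation law of weight `k`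
and vanishing at `i∞` is a cusp form. -/
theorem exists_cuspForm_of_generators {k : ℤ} {f : ℂ → ℂ}
    (hf : DifferentiableOn ℂ f {τ | 0 < τ.im})
    (hT : ∀ τ : ℂ, 0 < τ.im → f (τ + 1) = f τ)
    (hS : ∀ τ : ℂ, 0 < τ.im → f (-1 / τ) = τ ^ k * f τ)
    (h0 : Tendsto f (comap im atTop) (𝓝 0)) :
    ∃ g : CuspForm (MonoidHom.range (Matrix.SpecialLinearGroup.mapGL ℝ (n := Fin 2) (R := ℤ))) k,
      ∀ τ : ℍ, g τ = f τ := by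
  have hT' : (fun τ : ℍ ↦ f τ) ∣[k] ModularGroup.T = (fun τ : ℍ ↦ f τ) := by
    ext τ
    have hd : denom (ModularGroup.T : GL (Fin 2) ℝ) (τ : ℂ) = 1 := by
      simp [ModularGroup.denom_apply, ModularGroup.coe_T]
    rw [ModularForm.SL_slash_apply, modular_T_smul, hd, one_zpow, mul_one, UpperHalfPlane.coe_vadd,
      ofReal_one, add_comm, hT τ τ.im_pos]
  have hS' : (fun τ : ℍ ↦ f τ) ∣[k] ModularGroup.S = (fun τ : ℍ ↦ f τ) := by
    ext τ
    have : (τ : ℂ) ≠ 0 := τ.ne_zero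
    rw [SlashInvariantForm.slash_S_apply]
    have h := hS τ τ.im_pos
    simp only
    rw [show (-(τ : ℂ))⁻¹ = -1 / τ by rw [inv_neg, neg_div, one_div], h, mul_comm, ← mul_assoc,
      ← zpow_add₀ this]
    simp
  have hγ := SlashInvariantForm.slash_action_generators_SL2Z hS' hT'
  refine ⟨{ toFun := fun τ : ℍ ↦ f τ, slash_action_eq' := ?_, holo' := ?_, zero_at_cusps' := ?_ },
    fun τ ↦ rfl⟩
  · rintro _ ⟨A, rfl⟩
    exact hγ A
  · rw [UpperHalfPlane.mdifferentiable_iff]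
    refine hf.congr fun z hz ↦ ?_
    simp [ofComplex_apply_of_im_pos hz]
  · intro c hc
    rw [Subgroup.IsArithmetic.isCusp_iff_isCusp_SL2Z] at hc
    rw [OnePoint.isZeroAt_iff_forall_SL2Z hc]
    intro γ _
    change IsZeroAtImInfty ((fun τ : ℍ ↦ f τ) ∣[k] γ)
    rw [hγ]
    exact h0.comp (tendsto_comap_iff.mpr tendsto_comap)

theorem eq_zero_of_weight_lt_twelve {k : ℤ} (hk : k < 12) {f : ℂ → ℂ}
    (hf : DifferentiableOn ℂ f {τ | 0 < τ.im})
    (hT : ∀ τ : ℂ, 0 < τ.im → f (τ + 1) = f τ)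
    (hS : ∀ τ : ℂ, 0 < τ.im → f (-1 / τ) = τ ^ k * f τ)
    (h0 : Tendsto f (comap im atTop) (𝓝 0)) {τ : ℂ} (hτ : 0 < τ.im) : f τ = 0 := by
  obtain ⟨g, hg⟩ := exists_cuspForm_of_generators hf hT hS h0
  have := rank_zero_iff_forall_zero.mp (CuspForm.rank_eq_zero_of_weight_lt_twelve hk) g
  simpa [this] using (hg ⟨τ, hτ⟩).symm

theorem ne_zero_of_weight_twelve {f : ℂ → ℂ}
    (hf : DifferentiableOn ℂ f {τ | 0 < τ.im})
    (hT : ∀ τ : ℂ, 0 < τ.im → f (τ + 1) = f τ)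
    (hS : ∀ τ : ℂ, 0 < τ.im → f (-1 / τ) = τ ^ (12 : ℤ) * f τ)
    (h0 : Tendsto f (comap im atTop) (𝓝 0)) {σ : ℂ} (hσ : 0 < σ.im) (hne : f σ ≠ 0)
    {τ : ℂ} (hτ : 0 < τ.im) : f τ ≠ 0 := by
  obtain ⟨g, hg⟩ := exists_cuspForm_of_generators hf hT hS h0
  obtain ⟨c, rfl⟩ := CuspForm.exists_smul_discriminant_of_weight_eq_twelve g
  have key : ∀ z : ℍ, f z = c * ModularForm.discriminant z := fun z ↦ by simp [← hg z]
  have hc : c ≠ 0 := by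
    rintro rfl
    exact hne (by simpa using key ⟨σ, hσ⟩)
  have := key ⟨τ, hτ⟩
  simp only at this
  rw [this]
  exact mul_ne_zero hc (ModularForm.discriminant_ne_zero _)

/-- The fourth power of the Jacobi theta constant `θ₂`. -/
noncomputable def thetaTwoPow (τ : ℂ) : ℂ :=
  cexp (Real.pi * I * τ) * jacobiTheta₂ (τ / 2) τ ^ 4

/-- The fourth power of the Jacobi theta constant `θ₃`. -/
noncomputable def thetaThreePow (τ : ℂ) : ℂ := jacobiTheta τ ^ 4

/-- The fourth power of the Jacobi theta constant `θ₄`. -/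
noncomputable def thetaFourPow (τ : ℂ) : ℂ := thetaThreePow (τ + 1)

theorem thetaFourPow_add_one (τ : ℂ) : thetaFourPow (τ + 1) = thetaThreePow τ := by
  rw [thetaFourPow, thetaThreePow, thetaThreePow, ← jacobiTheta_two_add τ]
  ring_nf

theorem thetaThreePow_add_one (τ : ℂ) : thetaThreePow (τ + 1) = thetaFourPow τ := rfl

theorem jacobiTheta_add_one (τ : ℂ) : jacobiTheta (τ + 1) = jacobiTheta₂ (1 / 2) τ := by
  refine tsum_congr fun n ↦ ?_
  rw [jacobiTheta₂_term, exp_eq_exp_iff_exists_int]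
  obtain ⟨m, hm⟩ : (2 : ℤ) ∣ n ^ 2 - n := by
    rw [show n ^ 2 - n = n * (n - 1) by ring]
    exact even_iff_two_dvd.mp (Int.even_mul_pred_self n)
  refine ⟨m, ?_⟩
  have hm' : (n : ℂ) ^ 2 - n = 2 * m := by exact_mod_cast hm
  linear_combination (Real.pi * I : ℂ) * hm'

theorem thetaTwoPow_add_one (τ : ℂ) : thetaTwoPow (τ + 1) = -thetaTwoPow τ := by
  have h : jacobiTheta₂ ((τ + 1) / 2) (τ + 1) = jacobiTheta₂ (τ / 2) τ := by
    refine tsum_congr fun n ↦ ?_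
    rw [jacobiTheta₂_term, jacobiTheta₂_term, exp_eq_exp_iff_exists_int]
    obtain ⟨m, hm⟩ : (2 : ℤ) ∣ n ^ 2 + n := by
      rw [show n ^ 2 + n = n * (n + 1) by ring]
      exact even_iff_two_dvd.mp (Int.even_mul_succ_self n)
    refine ⟨m, ?_⟩
    have hm' : (n : ℂ) ^ 2 + n = 2 * m := by exact_mod_cast hm
    linear_combination (Real.pi * I : ℂ) * hm'
  rw [thetaTwoPow, thetaTwoPow, h, mul_add, exp_add, mul_one, exp_pi_mul_I]
  ring

theorem neg_I_mul_cpow_half_pow_four (τ : ℂ) : ((-I * τ) ^ (1 / 2 : ℂ)) ^ 4 = -τ ^ 2 := by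
  rw [← cpow_nat_mul, show ((4 : ℕ) : ℂ) * (1 / 2) = (2 : ℕ) by norm_num, cpow_natCast, mul_pow,
    neg_sq, I_sq]
  ring

theorem ne_zero_of_im_pos {τ : ℂ} (hτ : 0 < τ.im) : τ ≠ 0 := by
  rintro rfl
  simp at hτ

theorem im_neg_one_div_pos {τ : ℂ} (hτ : 0 < τ.im) : 0 < (-1 / τ).im := by
  rw [neg_div, neg_im, one_div, inv_im, neg_div, neg_neg]
  exact div_pos hτ (normSq_pos.mpr (ne_zero_of_im_pos hτ))

theorem thetaThreePow_neg_one_div {τ : ℂ} (hτ : 0 < τ.im) :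
    thetaThreePow (-1 / τ) = -τ ^ 2 * thetaThreePow τ := by
  have h := jacobiTheta_S_smul ⟨τ, hτ⟩
  rw [modular_S_smul] at h
  simp only at h
  rw [show (-τ)⁻¹ = -1 / τ by rw [inv_neg, neg_div, one_div]] at h
  rw [thetaThreePow, h, mul_pow, neg_I_mul_cpow_half_pow_four, thetaThreePow]

theorem thetaFourPow_neg_one_div {τ : ℂ} (hτ : 0 < τ.im) :
    thetaFourPow (-1 / τ) = -τ ^ 2 * thetaTwoPow τ := by
  have h0 := ne_zero_of_im_pos hτ
  rw [thetaFourPow, thetaThreePow, jacobiTheta_add_one, thetaTwoPow,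
    jacobiTheta₂_functional_equation (τ / 2) τ, mul_pow, mul_pow, ← exp_nat_mul, div_pow, one_pow,
    neg_I_mul_cpow_half_pow_four, show τ / 2 / τ = 1 / 2 by field_simp,
    show ((4 : ℕ) : ℂ) * (-Real.pi * I * (τ / 2) ^ 2 / τ) = -(Real.pi * I * τ) by
      push_cast; field_simp; norm_num, exp_neg]
  have := exp_ne_zero (Real.pi * I * τ)
  field_simp

theorem thetaTwoPow_neg_one_div {τ : ℂ} (hτ : 0 < τ.im) :
    thetaTwoPow (-1 / τ) = -τ ^ 2 * thetaFourPow τ := by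
  have h0 := ne_zero_of_im_pos hτ
  have h := thetaFourPow_neg_one_div (im_neg_one_div_pos hτ)
  rw [show -1 / (-1 / τ) = τ by field_simp] at h
  rw [h]
  field_simp

theorem differentiableAt_thetaThreePow {τ : ℂ} (hτ : 0 < τ.im) :
    DifferentiableAt ℂ thetaThreePow τ := (differentiableAt_jacobiTheta hτ).pow 4

theorem differentiableAt_thetaFourPow {τ : ℂ} (hτ : 0 < τ.im) :
    DifferentiableAt ℂ thetaFourPow τ :=
  have h : DifferentiableAt ℂ thetaThreePow (τ + 1) :=
    differentiableAt_thetaThreePow (by simpa using hτ)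
  h.comp τ (by fun_prop)

theorem differentiableAt_thetaTwoPow {τ : ℂ} (hτ : 0 < τ.im) :
    DifferentiableAt ℂ thetaTwoPow τ := by
  have h1 : DifferentiableAt ℂ (fun p : ℂ × ℂ ↦ jacobiTheta₂ p.1 p.2) (τ / 2, τ) :=
    (hasFDerivAt_jacobiTheta₂ (τ / 2) hτ).differentiableAt
  have h2 : DifferentiableAt ℂ (fun t : ℂ ↦ jacobiTheta₂ (t / 2) t) τ :=
    h1.comp (f := fun t : ℂ ↦ (t / 2, t)) τ (by fun_prop)
  exact (by fun_prop : DifferentiableAt ℂ (fun t : ℂ ↦ cexp (Real.pi * I * t)) τ).mul (h2.pow 4)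

theorem tendsto_thetaThreePow : Tendsto thetaThreePow (comap im atTop) (𝓝 1) := by
  have h : Tendsto (fun τ ↦ jacobiTheta τ - 1) (comap im atTop) (𝓝 0) := by
    refine isBigO_at_im_infty_jacobiTheta_sub_one.trans_tendsto ?_
    refine (Real.tendsto_exp_atBot.comp ?_).comp tendsto_comap
    exact tendsto_id.const_mul_atTop_of_neg (by simpa using Real.pi_pos)
  have := (h.add_const 1).pow 4
  simp only [sub_add_cancel, zero_add, one_pow] at this
  exact this

theorem tendsto_add_one_comap_im :
    Tendsto (fun τ : ℂ ↦ τ + 1) (comap im atTop) (comap im atTop) := by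
  rw [tendsto_comap_iff]
  refine tendsto_comap.congr fun τ ↦ by simp

theorem tendsto_thetaFourPow : Tendsto thetaFourPow (comap im atTop) (𝓝 1) :=
  tendsto_thetaThreePow.comp tendsto_add_one_comap_im

theorem norm_jacobiTheta₂_half_le : ∃ C : ℝ, ∀ τ : ℂ, 1 ≤ τ.im → ‖jacobiTheta₂ (τ / 2) τ‖ ≤ C := by
  have hs : Summable fun n : ℤ ↦ ‖jacobiTheta₂_term n (I / 2) I‖ :=
    ((summable_jacobiTheta₂_term_iff _ _).mpr (by simp)).norm
  have hle (τ : ℂ) (hτ : 1 ≤ τ.im) (n : ℤ) :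
      ‖jacobiTheta₂_term n (τ / 2) τ‖ ≤ ‖jacobiTheta₂_term n (I / 2) I‖ := by
    rw [norm_jacobiTheta₂_term, norm_jacobiTheta₂_term, Real.exp_le_exp]
    have h1 : (τ / 2).im = τ.im / 2 := by simp
    have h2 : (I / 2).im = 1 / 2 := by simp
    rw [h1, h2, I_im]
    have hn : (0 : ℝ) ≤ n ^ 2 + n := by
      have : (0 : ℤ) ≤ n ^ 2 + n := by
        rcases le_or_gt 0 n with h | h <;> nlinarith
      exact_mod_cast this
    have : 0 ≤ Real.pi * (n ^ 2 + n) * (τ.im - 1) :=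
      mul_nonneg (mul_nonneg Real.pi_pos.le hn) (by linarith)
    nlinarith
  refine ⟨∑' n : ℤ, ‖jacobiTheta₂_term n (I / 2) I‖, fun τ hτ ↦ ?_⟩
  exact tsum_of_norm_bounded hs.hasSum (hle τ hτ)

theorem tendsto_thetaTwoPow : Tendsto thetaTwoPow (comap im atTop) (𝓝 0) := by
  obtain ⟨C, hC⟩ := norm_jacobiTheta₂_half_le
  have h : Tendsto (fun τ : ℂ ↦ Real.exp (-Real.pi * τ.im) * C ^ 4) (comap im atTop) (𝓝 0) := by
    rw [← zero_mul (C ^ 4)]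
    refine Tendsto.mul_const _ ((Real.tendsto_exp_atBot.comp ?_).comp tendsto_comap)
    exact tendsto_id.const_mul_atTop_of_neg (by simpa using Real.pi_pos)
  refine squeeze_zero_norm' ?_ h
  filter_upwards [tendsto_comap.eventually (eventually_ge_atTop (1 : ℝ))] with τ hτ
  rw [thetaTwoPow, norm_mul, norm_pow, norm_exp]
  have : (Real.pi * I * τ).re = -Real.pi * τ.im := by simp
  rw [this]
  gcongr
  exact hC τ hτ

theorem isOpen_im_pos : IsOpen {τ : ℂ | 0 < τ.im} := isOpen_lt continuous_const continuous_im

/-- Jacobi's identity `θ₂⁴ + θ₄⁴ = θ₃⁴`. -/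
theorem thetaTwoPow_add_thetaFourPow {τ : ℂ} (hτ : 0 < τ.im) :
    thetaTwoPow τ + thetaFourPow τ = thetaThreePow τ := by
  have h := eq_zero_of_weight_lt_twelve (k := 4) (by norm_num)
    (f := fun τ ↦ (thetaTwoPow τ + thetaFourPow τ - thetaThreePow τ) ^ 2)
    (fun σ hσ ↦ (((differentiableAt_thetaTwoPow hσ).add (differentiableAt_thetaFourPow hσ)).sub
      (differentiableAt_thetaThreePow hσ)).pow 2 |>.differentiableWithinAt)
    (fun σ hσ ↦ by
      simp only [thetaTwoPow_add_one, thetaFourPow_add_one, thetaThreePow_add_one]; ring)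
    (fun σ hσ ↦ by
      simp only [thetaTwoPow_neg_one_div hσ, thetaFourPow_neg_one_div hσ,
        thetaThreePow_neg_one_div hσ]
      norm_cast; ring)
    (by simpa using ((tendsto_thetaTwoPow.add tendsto_thetaFourPow).sub
      tendsto_thetaThreePow).pow 2) hτ
  exact sub_eq_zero.mp (pow_eq_zero_iff two_ne_zero |>.mp h)

theorem thetaTwoPow_mul_I_ne_zero {t : ℝ} (ht : 0 < t) : thetaTwoPow (t * I) ≠ 0 := by
  have hterm (n : ℤ) : jacobiTheta₂_term n (t * I / 2) (t * I) =
      (Real.exp (-Real.pi * (n ^ 2 + n) * t) : ℝ) := by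
    rw [jacobiTheta₂_term, ofReal_exp]
    congr 1
    push_cast
    linear_combination (Real.pi * (n ^ 2 + n) * t : ℂ) * I_sq
  have hs : Summable fun n : ℤ ↦ Real.exp (-Real.pi * (n ^ 2 + n) * t) := by
    have h := (summable_jacobiTheta₂_term_iff (t * I / 2) (t * I)).mpr (by simpa using ht)
    simp_rw [hterm] at h
    exact_mod_cast h
  have hpos : 0 < ∑' n : ℤ, Real.exp (-Real.pi * (n ^ 2 + n) * t) :=
    hs.tsum_pos (fun n ↦ (Real.exp_pos _).le) 0 (Real.exp_pos _)
  refine mul_ne_zero (exp_ne_zero _) (pow_ne_zero 4 ?_)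
  rw [jacobiTheta₂, tsum_congr hterm, ← ofReal_tsum]
  exact_mod_cast hpos.ne'

theorem exists_thetaPow_prod_ne_zero :
    ∃ σ : ℂ, 0 < σ.im ∧ thetaTwoPow σ * thetaThreePow σ * thetaFourPow σ ≠ 0 := by
  have hI : Tendsto (fun t : ℝ ↦ (t * I : ℂ)) atTop (comap im atTop) := by
    rw [tendsto_comap_iff]
    exact tendsto_id.congr fun t ↦ by simp
  obtain ⟨t, h3, h4, ht⟩ := ((hI.eventually
    (tendsto_thetaThreePow.eventually_ne one_ne_zero)).and ((hI.eventually
    (tendsto_thetaFourPow.eventually_ne one_ne_zero)).and (eventually_gt_atTop 0))).exists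
  exact ⟨t * I, by simpa using ht, mul_ne_zero (mul_ne_zero (thetaTwoPow_mul_I_ne_zero ht) h3) h4⟩

theorem thetaPow_prod_ne_zero {τ : ℂ} (hτ : 0 < τ.im) :
    thetaTwoPow τ * thetaThreePow τ * thetaFourPow τ ≠ 0 := by
  obtain ⟨σ, hσ, hne⟩ := exists_thetaPow_prod_ne_zero
  have h := ne_zero_of_weight_twelve
    (f := fun τ ↦ (thetaTwoPow τ * thetaThreePow τ * thetaFourPow τ) ^ 2)
    (fun σ hσ ↦ (((differentiableAt_thetaTwoPow hσ).mul (differentiableAt_thetaThreePow hσ)).mul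
      (differentiableAt_thetaFourPow hσ)).pow 2 |>.differentiableWithinAt)
    (fun σ hσ ↦ by
      simp only [thetaTwoPow_add_one, thetaFourPow_add_one, thetaThreePow_add_one]; ring)
    (fun σ hσ ↦ by
      simp only [thetaTwoPow_neg_one_div hσ, thetaFourPow_neg_one_div hσ,
        thetaThreePow_neg_one_div hσ]
      norm_cast; ring)
    (by simpa using ((tendsto_thetaTwoPow.mul tendsto_thetaThreePow).mul
      tendsto_thetaFourPow).pow 2) hσ (pow_ne_zero 2 hne) hτ
  exact fun h0 ↦ h (by simp [h0])

theorem tendsto_deriv_comap_im_atTop {f : ℂ → ℂ} {c : ℂ}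
    (hf : ∀ τ : ℂ, 0 < τ.im → DifferentiableAt ℂ f τ)
    (h : Tendsto f (comap im atTop) (𝓝 c)) : Tendsto (deriv f) (comap im atTop) (𝓝 0) := by
  rw [Metric.tendsto_nhds] at h ⊢
  intro ε hε
  have h' := h (ε / 2) (half_pos hε)
  rw [eventually_comap, eventually_atTop] at h' ⊢
  obtain ⟨A, hA⟩ := h'
  refine ⟨max A 1 + 1, fun y hy τ hτ ↦ ?_⟩
  have him {z : ℂ} (hz : z ∈ Metric.closedBall τ 1) : max A 1 ≤ z.im := by
    have h1 : |(z - τ).im| ≤ 1 := (abs_im_le_norm _).trans (by simpa [dist_eq_norm] using hz)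
    rw [sub_im, abs_le] at h1
    linarith
  have hd : DiffContOnCl ℂ (fun z ↦ f z - c) (Metric.ball τ 1) := by
    apply DifferentiableOn.diffContOnCl
    intro z hz
    rw [closure_ball τ one_ne_zero] at hz
    have := him hz
    exact ((hf z (by linarith [le_max_right A 1])).sub_const c).differentiableWithinAt
  have hb := norm_deriv_le_of_forall_mem_sphere_norm_le one_pos hd (C := ε / 2) fun z hz ↦ by
    have := him (Metric.sphere_subset_closedBall hz)
    rw [← dist_eq_norm]
    exact (hA z.im ((le_max_left A 1).trans this) z rfl).le
  rw [deriv_sub_const, div_one] at hb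
  rw [dist_zero_right]
  linarith

/-- The Wronskian of `θ₂⁴` and `θ₃⁴`. -/
noncomputable def thetaWronskian (τ : ℂ) : ℂ :=
  deriv thetaTwoPow τ * thetaThreePow τ - thetaTwoPow τ * deriv thetaThreePow τ

theorem deriv_thetaFourPow {τ : ℂ} (hτ : 0 < τ.im) :
    deriv thetaFourPow τ = deriv thetaThreePow τ - deriv thetaTwoPow τ := by
  rw [← deriv_sub (differentiableAt_thetaThreePow hτ) (differentiableAt_thetaTwoPow hτ)]
  refine EventuallyEq.deriv_eq ?_
  filter_upwards [isOpen_im_pos.mem_nhds hτ] with σ hσ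
  rw [Pi.sub_apply, ← thetaTwoPow_add_thetaFourPow hσ, add_sub_cancel_left]

theorem thetaWronskian_add_one {τ : ℂ} (hτ : 0 < τ.im) :
    thetaWronskian (τ + 1) = -thetaWronskian τ := by
  have h2 : deriv thetaTwoPow (τ + 1) = -deriv thetaTwoPow τ := by
    rw [← deriv_comp_add_const, funext thetaTwoPow_add_one, deriv.fun_neg]
  have h3 : deriv thetaThreePow (τ + 1) = deriv thetaFourPow τ := by
    rw [← deriv_comp_add_const]
    rfl
  rw [thetaWronskian, h2, h3, deriv_thetaFourPow hτ, thetaTwoPow_add_one, thetaThreePow_add_one,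
    thetaWronskian, ← thetaTwoPow_add_thetaFourPow hτ]
  ring

theorem deriv_neg_one_div_of_weight_two {f g : ℂ → ℂ}
    (hf : ∀ τ : ℂ, 0 < τ.im → DifferentiableAt ℂ f τ)
    (hg : ∀ τ : ℂ, 0 < τ.im → DifferentiableAt ℂ g τ)
    (h : ∀ τ : ℂ, 0 < τ.im → f (-1 / τ) = -τ ^ 2 * g τ) {τ : ℂ} (hτ : 0 < τ.im) :
    deriv f (-1 / τ) = -2 * τ ^ 3 * g τ - τ ^ 4 * deriv g τ := by
  have h0 := ne_zero_of_im_pos hτ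
  have hinv : HasDerivAt (fun z : ℂ ↦ -1 / z) (1 / τ ^ 2) τ := by
    simpa [neg_div, one_div] using (hasDerivAt_inv h0).fun_neg
  have h1 := (hf _ (im_neg_one_div_pos hτ)).hasDerivAt.comp τ hinv
  have h2 : HasDerivAt (fun z : ℂ ↦ -z ^ 2 * g z) (-(2 * τ) * g τ + -τ ^ 2 * deriv g τ) τ := by
    simpa using ((hasDerivAt_pow 2 τ).fun_neg).fun_mul (hg τ hτ).hasDerivAt
  have h3 := h1.unique (h2.congr_of_eventuallyEq (by
    filter_upwards [isOpen_im_pos.mem_nhds hτ] with σ hσ using h σ hσ))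
  generalize deriv f (-1 / τ) = d at h3 ⊢
  field_simp at h3
  linear_combination h3

theorem thetaWronskian_neg_one_div {τ : ℂ} (hτ : 0 < τ.im) :
    thetaWronskian (-1 / τ) = -τ ^ 6 * thetaWronskian τ := by
  rw [thetaWronskian, deriv_neg_one_div_of_weight_two (fun _ ↦ differentiableAt_thetaTwoPow)
      (fun _ ↦ differentiableAt_thetaFourPow) (fun _ ↦ thetaTwoPow_neg_one_div) hτ,
    deriv_neg_one_div_of_weight_two (fun _ ↦ differentiableAt_thetaThreePow)
      (fun _ ↦ differentiableAt_thetaThreePow) (fun _ ↦ thetaThreePow_neg_one_div) hτ,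
    thetaTwoPow_neg_one_div hτ, thetaThreePow_neg_one_div hτ, deriv_thetaFourPow hτ,
    thetaWronskian, ← thetaTwoPow_add_thetaFourPow hτ]
  ring

/-- The modular `λ` function. -/
noncomputable def modularLambda (τ : ℂ) : ℂ := thetaTwoPow τ / thetaThreePow τ

theorem thetaTwoPow_ne_zero {τ : ℂ} (hτ : 0 < τ.im) : thetaTwoPow τ ≠ 0 :=
  left_ne_zero_of_mul (left_ne_zero_of_mul (thetaPow_prod_ne_zero hτ))

theorem thetaThreePow_ne_zero {τ : ℂ} (hτ : 0 < τ.im) : thetaThreePow τ ≠ 0 :=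
  right_ne_zero_of_mul (left_ne_zero_of_mul (thetaPow_prod_ne_zero hτ))

theorem thetaFourPow_ne_zero {τ : ℂ} (hτ : 0 < τ.im) : thetaFourPow τ ≠ 0 :=
  right_ne_zero_of_mul (thetaPow_prod_ne_zero hτ)

theorem differentiableAt_modularLambda {τ : ℂ} (hτ : 0 < τ.im) :
    DifferentiableAt ℂ modularLambda τ :=
  (differentiableAt_thetaTwoPow hτ).div (differentiableAt_thetaThreePow hτ)
    (thetaThreePow_ne_zero hτ)

theorem deriv_modularLambda {τ : ℂ} (hτ : 0 < τ.im) :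
    deriv modularLambda τ = thetaWronskian τ / thetaThreePow τ ^ 2 :=
  ((differentiableAt_thetaTwoPow hτ).hasDerivAt.div (differentiableAt_thetaThreePow hτ).hasDerivAt
    (thetaThreePow_ne_zero hτ)).deriv

theorem tendsto_modularLambda : Tendsto modularLambda (comap im atTop) (𝓝 0) := by
  have := tendsto_thetaTwoPow.div tendsto_thetaThreePow one_ne_zero
  rw [zero_div] at this
  exact this

theorem modularLambda_ne_zero {τ : ℂ} (hτ : 0 < τ.im) : modularLambda τ ≠ 0 :=
  div_ne_zero (thetaTwoPow_ne_zero hτ) (thetaThreePow_ne_zero hτ)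

theorem one_sub_modularLambda {τ : ℂ} (hτ : 0 < τ.im) :
    1 - modularLambda τ = thetaFourPow τ / thetaThreePow τ := by
  have := thetaThreePow_ne_zero hτ
  rw [modularLambda, one_sub_div this, ← thetaTwoPow_add_thetaFourPow hτ, add_sub_cancel_left]

theorem modularLambda_ne_one {τ : ℂ} (hτ : 0 < τ.im) : modularLambda τ ≠ 1 := by
  intro h
  have h1 := one_sub_modularLambda hτ
  rw [h, sub_self] at h1
  exact div_ne_zero (thetaFourPow_ne_zero hτ) (thetaThreePow_ne_zero hτ) h1.symm

theorem modularLambda_neg_one_div {τ : ℂ} (hτ : 0 < τ.im) :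
    modularLambda (-1 / τ) = 1 - modularLambda τ := by
  have h0 := ne_zero_of_im_pos hτ
  rw [one_sub_modularLambda hτ, modularLambda, thetaTwoPow_neg_one_div hτ,
    thetaThreePow_neg_one_div hτ, mul_div_mul_left _ _ (neg_ne_zero.mpr (pow_ne_zero 2 h0))]

theorem modularLambda_add_one {τ : ℂ} (hτ : 0 < τ.im) :
    modularLambda (τ + 1) = modularLambda τ / (modularLambda τ - 1) := by
  have h3 := thetaThreePow_ne_zero hτ
  have h4 := thetaFourPow_ne_zero hτ
  rw [show modularLambda τ - 1 = -(1 - modularLambda τ) by ring, one_sub_modularLambda hτ,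
    modularLambda, modularLambda, thetaTwoPow_add_one, thetaThreePow_add_one]
  field_simp

theorem exists_thetaWronskian_ne_zero : ∃ σ : ℂ, 0 < σ.im ∧ thetaWronskian σ ≠ 0 := by
  by_contra! h
  have hconst : ∀ τ : ℂ, 0 < τ.im → modularLambda τ = modularLambda I := fun τ hτ ↦
    isOpen_im_pos.is_const_of_deriv_eq_zero (convex_halfSpace_im_gt 0).isPreconnected
      (fun σ hσ ↦ (differentiableAt_modularLambda hσ).differentiableWithinAt)
      (fun σ hσ ↦ by simp [deriv_modularLambda hσ, h σ hσ]) hτ (by simp)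
  have hI : Tendsto (fun t : ℝ ↦ (t * I : ℂ)) atTop (comap im atTop) := by
    rw [tendsto_comap_iff]
    exact tendsto_id.congr fun t ↦ by simp
  have hlim : Tendsto (fun _ : ℝ ↦ modularLambda I) atTop (𝓝 0) :=
    (tendsto_modularLambda.comp hI).congr' (by
      filter_upwards [eventually_gt_atTop 0] with t ht using hconst _ (by simpa using ht))
  exact modularLambda_ne_zero (τ := I) (by simp) (tendsto_const_nhds_iff.mp hlim)

theorem thetaWronskian_ne_zero {τ : ℂ} (hτ : 0 < τ.im) : thetaWronskian τ ≠ 0 := by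
  obtain ⟨σ, hσ, hne⟩ := exists_thetaWronskian_ne_zero
  have hd2 : DifferentiableOn ℂ thetaTwoPow {τ | 0 < τ.im} :=
    fun z hz ↦ (differentiableAt_thetaTwoPow hz).differentiableWithinAt
  have hd3 : DifferentiableOn ℂ thetaThreePow {τ | 0 < τ.im} :=
    fun z hz ↦ (differentiableAt_thetaThreePow hz).differentiableWithinAt
  have h := ne_zero_of_weight_twelve (f := fun τ ↦ thetaWronskian τ ^ 2)
    ((((hd2.deriv isOpen_im_pos).mul hd3).sub (hd2.mul (hd3.deriv isOpen_im_pos))).pow 2)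
    (fun σ hσ ↦ by simp only [thetaWronskian_add_one hσ]; ring)
    (fun σ hσ ↦ by simp only [thetaWronskian_neg_one_div hσ]; norm_cast; ring)
    (by
      have h2 := tendsto_deriv_comap_im_atTop (fun _ ↦ differentiableAt_thetaTwoPow)
        tendsto_thetaTwoPow
      have h3 := tendsto_deriv_comap_im_atTop (fun _ ↦ differentiableAt_thetaThreePow)
        tendsto_thetaThreePow
      have := ((h2.mul tendsto_thetaThreePow).sub (tendsto_thetaTwoPow.mul h3)).pow 2
      rw [zero_mul, zero_mul, sub_zero, zero_pow two_ne_zero] at this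
      exact this)
    hσ (pow_ne_zero 2 hne) hτ
  exact fun h0 ↦ h (by simp [h0])

theorem deriv_modularLambda_ne_zero {τ : ℂ} (hτ : 0 < τ.im) : deriv modularLambda τ ≠ 0 := by
  rw [deriv_modularLambda hτ]
  exact div_ne_zero (thetaWronskian_ne_zero hτ) (pow_ne_zero 2 (thetaThreePow_ne_zero hτ))

/-- The modular `λ` function as a map from the upper half-plane to the twice-punctured plane. -/
noncomputable def lambdaMap (τ : ℍ) : ({0, 1}ᶜ : Set ℂ) :=
  ⟨modularLambda τ, by simp [modularLambda_ne_zero τ.im_pos, modularLambda_ne_one τ.im_pos]⟩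

theorem isLocalHomeomorph_lambdaMap : IsLocalHomeomorph lambdaMap := by
  have hopen : IsOpen ({0, 1}ᶜ : Set ℂ) := (Set.toFinite {0, 1}).isClosed.isOpen_compl
  have hL : IsLocalHomeomorphOn modularLambda {τ | 0 < τ.im} := by
    intro τ hτ
    have hdiff : DifferentiableOn ℂ modularLambda {τ | 0 < τ.im} :=
      fun σ hσ ↦ (differentiableAt_modularLambda hσ).differentiableWithinAt
    have han := hdiff.analyticAt (isOpen_im_pos.mem_nhds hτ)
    have hd := han.hasStrictDerivAt.hasStrictFDerivAt_equiv (deriv_modularLambda_ne_zero hτ)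
    exact ⟨hd.toOpenPartialHomeomorph modularLambda, hd.mem_toOpenPartialHomeomorph_source, rfl⟩
  have hcoe : IsLocalHomeomorphOn (UpperHalfPlane.coe : ℍ → ℂ) Set.univ :=
    isOpenEmbedding_coe.isLocalHomeomorph.isLocalHomeomorphOn
  have hcomp : IsLocalHomeomorph (modularLambda ∘ (UpperHalfPlane.coe : ℍ → ℂ)) := by
    rw [isLocalHomeomorph_iff_isLocalHomeomorphOn_univ]
    exact hL.comp hcoe fun τ _ ↦ τ.im_pos
  exact IsLocalHomeomorph.of_comp (g := Subtype.val) hcomp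
    hopen.isOpenEmbedding_subtypeVal.isLocalHomeomorph
    (Continuous.subtype_mk hcomp.continuous _)

theorem mem_compl_zero_one {w : ℂ} : w ∈ ({0, 1}ᶜ : Set ℂ) ↔ w ≠ 0 ∧ w - 1 ≠ 0 := by
  simp [sub_eq_zero]

theorem one_sub_mem {w : ℂ} (hw : w ∈ ({0, 1}ᶜ : Set ℂ)) : 1 - w ∈ ({0, 1}ᶜ : Set ℂ) := by
  rw [mem_compl_zero_one] at hw ⊢
  exact ⟨by rw [← neg_sub]; exact neg_ne_zero.mpr hw.2, by simpa using hw.1⟩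

theorem div_sub_one_sub_one {w : ℂ} (hw : w ∈ ({0, 1}ᶜ : Set ℂ)) :
    w / (w - 1) - 1 = (w - 1)⁻¹ := by
  rw [mem_compl_zero_one] at hw
  rw [div_sub_one hw.2, sub_sub_cancel, one_div]

theorem div_sub_one_mem {w : ℂ} (hw : w ∈ ({0, 1}ᶜ : Set ℂ)) :
    w / (w - 1) ∈ ({0, 1}ᶜ : Set ℂ) := by
  rw [mem_compl_zero_one, div_sub_one_sub_one hw]
  rw [mem_compl_zero_one] at hw
  exact ⟨div_ne_zero hw.1 hw.2, inv_ne_zero hw.2⟩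

/-- The involution `w ↦ 1 - w` of the twice-punctured plane. -/
def anharmonicS : ({0, 1}ᶜ : Set ℂ) ≃ₜ ({0, 1}ᶜ : Set ℂ) where
  toFun w := ⟨1 - w, one_sub_mem w.2⟩
  invFun w := ⟨1 - w, one_sub_mem w.2⟩
  left_inv w := by simp
  right_inv w := by simp
  continuous_toFun := by fun_prop
  continuous_invFun := by fun_prop

theorem div_sub_one_div_sub_one {w : ℂ} (hw : w ∈ ({0, 1}ᶜ : Set ℂ)) :
    w / (w - 1) / (w / (w - 1) - 1) = w := by
  rw [div_sub_one_sub_one hw, div_inv_eq_mul, div_mul_cancel₀ _ (mem_compl_zero_one.mp hw).2]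

theorem continuous_div_sub_one :
    Continuous fun w : ({0, 1}ᶜ : Set ℂ) ↦
      (⟨w / (w - 1), div_sub_one_mem w.2⟩ : ({0, 1}ᶜ : Set ℂ)) :=
  (continuous_subtype_val.div (continuous_subtype_val.sub continuous_const)
    fun w ↦ (mem_compl_zero_one.mp w.2).2).subtype_mk _

/-- The involution `w ↦ w / (w - 1)` of the twice-punctured plane. -/
noncomputable def anharmonicT : ({0, 1}ᶜ : Set ℂ) ≃ₜ ({0, 1}ᶜ : Set ℂ) where
  toFun w := ⟨w / (w - 1), div_sub_one_mem w.2⟩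
  invFun w := ⟨w / (w - 1), div_sub_one_mem w.2⟩
  left_inv w := Subtype.ext (div_sub_one_div_sub_one w.2)
  right_inv w := Subtype.ext (div_sub_one_div_sub_one w.2)
  continuous_toFun := continuous_div_sub_one
  continuous_invFun := continuous_div_sub_one

theorem anharmonicS_mul_self : anharmonicS * anharmonicS = 1 := by
  ext w
  exact sub_sub_cancel 1 (w : ℂ)

theorem anharmonicT_mul_self : anharmonicT * anharmonicT = 1 := by
  ext w
  exact div_sub_one_div_sub_one w.2

theorem anharmonicS_mul_T_mul_S :
    anharmonicS * anharmonicT * anharmonicS = anharmonicT * anharmonicS * anharmonicT := by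
  ext w
  have hw := mem_compl_zero_one.mp w.2
  change 1 - (1 - (w : ℂ)) / (1 - w - 1) = (1 - (w : ℂ) / (w - 1)) / (1 - (w : ℂ) / (w - 1) - 1)
  rw [← neg_sub ((w : ℂ) / (w - 1)) 1, div_sub_one_sub_one w.2, sub_sub_cancel_left]
  have h : -((w : ℂ) - 1)⁻¹ - 1 = -w / (w - 1) := by
    rw [eq_div_iff hw.2, sub_mul, neg_mul, inv_mul_cancel₀ hw.2]
    ring
  rw [h]
  have h0 := hw.1
  have h1 := hw.2
  field_simp
  ring

/-- The anharmonic transformations of the twice-punctured plane, which permute `0`, `1` and `∞`. -/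
def anharmonicSet : Set (({0, 1}ᶜ : Set ℂ) ≃ₜ ({0, 1}ᶜ : Set ℂ)) :=
  {1, anharmonicS, anharmonicT, anharmonicS * anharmonicT, anharmonicT * anharmonicS,
    anharmonicS * anharmonicT * anharmonicS}

theorem anharmonicS_mul_mem {σ} (h : σ ∈ anharmonicSet) :
    anharmonicS * σ ∈ anharmonicSet := by
  have hS (τ) : anharmonicS * (anharmonicS * τ) = τ := by
    rw [← mul_assoc, anharmonicS_mul_self, one_mul]
  rcases h with rfl | rfl | rfl | rfl | rfl | rfl <;>
    simp [anharmonicSet, hS, mul_assoc, anharmonicS_mul_self]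

theorem anharmonicT_mul_mem {σ} (h : σ ∈ anharmonicSet) :
    anharmonicT * σ ∈ anharmonicSet := by
  have hT (τ) : anharmonicT * (anharmonicT * τ) = τ := by
    rw [← mul_assoc, anharmonicT_mul_self, one_mul]
  have hST : anharmonicS * (anharmonicT * anharmonicS) =
      anharmonicT * (anharmonicS * anharmonicT) := by
    simpa only [mul_assoc] using anharmonicS_mul_T_mul_S
  rcases h with rfl | rfl | rfl | rfl | rfl | rfl <;>
    simp [anharmonicSet, hT, hST, mul_assoc, anharmonicT_mul_self]

theorem lambdaMap_S_smul (τ : ℍ) : lambdaMap (ModularGroup.S • τ) = anharmonicS (lambdaMap τ) := by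
  refine Subtype.ext ?_
  change modularLambda (ModularGroup.S • τ : ℍ) = 1 - modularLambda τ
  rw [modular_S_smul, ← modularLambda_neg_one_div τ.im_pos, UpperHalfPlane.coe_mk, inv_neg,
    neg_div, one_div]

theorem lambdaMap_T_smul (τ : ℍ) : lambdaMap (ModularGroup.T • τ) = anharmonicT (lambdaMap τ) := by
  refine Subtype.ext ?_
  change modularLambda (ModularGroup.T • τ : ℍ) = modularLambda τ / (modularLambda τ - 1)
  rw [modular_T_smul, ← modularLambda_add_one τ.im_pos, coe_vadd, ofReal_one, add_comm]

theorem exists_lambdaMap_smul (γ : Matrix.SpecialLinearGroup (Fin 2) ℤ) :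
    ∃ σ ∈ anharmonicSet, ∀ τ : ℍ, lambdaMap (γ • τ) = σ (lambdaMap τ) := by
  have hγ : γ ∈ Subgroup.closure {ModularGroup.S, ModularGroup.T} := by
    rw [SpecialLinearGroup.SL2Z_generators]
    trivial
  induction hγ using Subgroup.closure_induction_left with
  | one => exact ⟨1, Or.inl rfl, fun τ ↦ by rw [one_smul]; rfl⟩
  | mul_left g hg y _ ih =>
    obtain ⟨σ, hσ, h⟩ := ih
    rcases hg with rfl | rfl
    · exact ⟨anharmonicS * σ, anharmonicS_mul_mem hσ, fun τ ↦ by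
        rw [mul_smul, lambdaMap_S_smul, h]; rfl⟩
    · exact ⟨anharmonicT * σ, anharmonicT_mul_mem hσ, fun τ ↦ by
        rw [mul_smul, lambdaMap_T_smul, h]; rfl⟩
  | inv_mul_cancel g hg y _ ih =>
    obtain ⟨σ, hσ, h⟩ := ih
    rcases hg with rfl | rfl
    · refine ⟨anharmonicS * σ, anharmonicS_mul_mem hσ, fun τ ↦ anharmonicS.injective ?_⟩
      rw [mul_smul, ← lambdaMap_S_smul, smul_inv_smul, h, ← Homeomorph.mul_apply, ← mul_assoc,
        anharmonicS_mul_self, one_mul]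
    · refine ⟨anharmonicT * σ, anharmonicT_mul_mem hσ, fun τ ↦ anharmonicT.injective ?_⟩
      rw [mul_smul, ← lambdaMap_T_smul, smul_inv_smul, h, ← Homeomorph.mul_apply, ← mul_assoc,
        anharmonicT_mul_self, one_mul]

theorem isCompact_fd_inter_preimage_lambdaMap {L : Set ({0, 1}ᶜ : Set ℂ)} (hL : IsCompact L) :
    IsCompact (ModularGroup.fd ∩ lambdaMap ⁻¹' L) := by
  have hL0 : ∀ᶠ w in 𝓝 (0 : ℂ), w ∉ Subtype.val '' L := by
    refine (hL.image continuous_subtype_val).isClosed.compl_mem_nhds ?_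
    rintro ⟨w, -, hw⟩
    exact (mem_compl_zero_one.mp w.2).1 hw
  have h := tendsto_modularLambda.eventually hL0
  rw [eventually_comap, eventually_atTop] at h
  obtain ⟨A, hA⟩ := h
  refine (ModularGroup.isCompact_truncatedFundamentalDomain A).of_isClosed_subset
    (ModularGroup.isClosed_fd.inter (hL.isClosed.preimage isLocalHomeomorph_lambdaMap.continuous))
    fun τ hτ ↦ ⟨hτ.1, le_of_not_ge fun h ↦ hA τ.im h τ rfl ⟨_, hτ.2, rfl⟩⟩

theorem exists_nhds_section_lambdaMap (x : ({0, 1}ᶜ : Set ℂ)) :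
    ∃ U ∈ 𝓝 x, ∀ τ, lambdaMap τ ∈ U → ∃ s : ({0, 1}ᶜ : Set ℂ) → ℍ,
      ContinuousOn s U ∧ (∀ y ∈ U, lambdaMap (s y) = y) ∧ s (lambdaMap τ) = τ := by
  have : LocallyCompactSpace ({0, 1}ᶜ : Set ℂ) :=
    (Set.toFinite {0, 1}).isClosed.isOpen_compl.locallyCompactSpace
  obtain ⟨N, hN, hNx⟩ := exists_compact_mem_nhds x
  have hF : anharmonicSet.Finite := by
    simp only [anharmonicSet, Set.finite_insert, Set.finite_singleton]
  refine isLocalHomeomorph_lambdaMap.exists_nhds_section_of_symmetries hF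
    (isCompact_fd_inter_preimage_lambdaMap
      (hF.isCompact_biUnion fun σ _ ↦ hN.image σ.continuous)) hNx fun τ hτ ↦ ?_
  obtain ⟨γ, hγ⟩ := ModularGroup.exists_smul_mem_fd τ
  obtain ⟨σ, hσ, h⟩ := exists_lambdaMap_smul γ
  have : ContinuousConstSMul (Matrix.SpecialLinearGroup (Fin 2) ℤ) ℍ :=
    ⟨fun γ ↦ continuous_const_smul (γ : GL (Fin 2) ℝ)⟩
  exact ⟨Homeomorph.smul γ, ⟨hγ, Set.mem_biUnion hσ ⟨_, hτ, (h τ).symm⟩⟩, σ, hσ, h⟩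

theorem surjective_lambdaMap : Function.Surjective lambdaMap := by
  have : PreconnectedSpace ({0, 1}ᶜ : Set ℂ) :=
    Subtype.preconnectedSpace ((Set.toFinite {0, 1}).countable.isConnected_compl_of_one_lt_rank
      (by simp)).isPreconnected
  exact isLocalHomeomorph_lambdaMap.surjective_of_forall_exists_section
    exists_nhds_section_lambdaMap

theorem isCoveringMap_lambdaMap : IsCoveringMap lambdaMap := by
  have : LocallyConnectedSpace ({0, 1}ᶜ : Set ℂ) :=
    (Set.toFinite {0, 1}).isClosed.isOpen_compl.locallyConnectedSpace
  exact isLocalHomeomorph_lambdaMap.isCoveringMap_of_forall_exists_section surjective_lambdaMap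
    exists_nhds_section_lambdaMap

theorem im_cayley (z : ℂ) :
    (I * (1 + z) / (1 - z)).im = (1 - ‖z‖ ^ 2) / normSq (1 - z) := by
  rw [mul_div_assoc, I_mul_im, div_re, ← normSq_eq_norm_sq, ← add_div, normSq_apply z]
  simp
  ring

theorem one_sub_ne_zero_of_mem_ball {z : ℂ} (hz : z ∈ Metric.ball (0 : ℂ) 1) : 1 - z ≠ 0 := by
  rintro h
  simp [← sub_eq_zero.mp h] at hz

theorem im_cayley_pos {z : ℂ} (hz : z ∈ Metric.ball (0 : ℂ) 1) :
    0 < (I * (1 + z) / (1 - z)).im := by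
  rw [im_cayley]
  rw [mem_ball_zero_iff] at hz
  refine div_pos ?_ (normSq_pos.mpr (one_sub_ne_zero_of_mem_ball (by simpa using hz)))
  nlinarith [norm_nonneg z]

theorem add_I_ne_zero_of_im_pos {τ : ℂ} (hτ : 0 < τ.im) : τ + I ≠ 0 := by
  intro h
  have := congrArg Complex.im h
  rw [add_im, I_im, zero_im] at this
  linarith

theorem inv_cayley_mem_ball {τ : ℂ} (hτ : 0 < τ.im) :
    (τ - I) / (τ + I) ∈ Metric.ball (0 : ℂ) 1 := by
  rw [mem_ball_zero_iff, norm_div, div_lt_one (norm_pos_iff.mpr (add_I_ne_zero_of_im_pos hτ)),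
    ← sq_lt_sq₀ (norm_nonneg _) (norm_nonneg _), ← normSq_eq_norm_sq, ← normSq_eq_norm_sq,
    normSq_apply, normSq_apply]
  simp
  nlinarith

/-- The Cayley transform from the unit disc to the upper half-plane. -/
noncomputable def cayleyHomeomorph : Metric.ball (0 : ℂ) 1 ≃ₜ ℍ where
  toFun z := ⟨I * (1 + z) / (1 - z), im_cayley_pos z.2⟩
  invFun τ := ⟨(τ - I) / (τ + I), inv_cayley_mem_ball τ.im_pos⟩
  left_inv z := by
    have h := one_sub_ne_zero_of_mem_ball z.2
    refine Subtype.ext ?_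
    have h2 := add_I_ne_zero_of_im_pos (im_cayley_pos z.2)
    simp only
    rw [div_eq_iff h2]
    field_simp
    ring
  right_inv τ := by
    have h := add_I_ne_zero_of_im_pos τ.im_pos
    refine UpperHalfPlane.ext ?_
    have h2 := one_sub_ne_zero_of_mem_ball (inv_cayley_mem_ball τ.im_pos)
    simp only
    rw [div_eq_iff h2]
    field_simp
    ring
  continuous_toFun := by
    rw [isEmbedding_coe.continuous_iff]
    exact (continuous_const.mul (continuous_const.add continuous_subtype_val)).div
      (continuous_const.sub continuous_subtype_val) fun z ↦ one_sub_ne_zero_of_mem_ball z.2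
  continuous_invFun :=
    ((continuous_coe.sub continuous_const).div (continuous_coe.add continuous_const)
      fun τ ↦ add_I_ne_zero_of_im_pos τ.im_pos).subtype_mk _

theorem isHolomorphicCoveringOnto_modularLambda :
    IsHolomorphicCoveringOnto (fun z ↦ modularLambda (I * (1 + z) / (1 - z)))
      (Metric.ball 0 1) (({0, 1} : Set ℂ)ᶜ) := by
  refine ⟨fun z hz ↦ ?_, ?_, fun _ ↦ isCoveringMap_lambdaMap.comp_homeomorph cayleyHomeomorph⟩
  · have h : DifferentiableAt ℂ (fun z : ℂ ↦ I * (1 + z) / (1 - z)) z :=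
      DifferentiableAt.div (by fun_prop) (by fun_prop) (one_sub_ne_zero_of_mem_ball hz)
    exact ((differentiableAt_modularLambda (im_cayley_pos hz)).comp z h).differentiableWithinAt
  · ext w
    constructor
    · rintro ⟨z, hz, rfl⟩
      exact (lambdaMap (cayleyHomeomorph ⟨z, hz⟩)).2
    · intro hw
      obtain ⟨z, hz⟩ := (surjective_lambdaMap.comp cayleyHomeomorph.surjective) ⟨w, hw⟩
      exact ⟨z, z.2, congrArg Subtype.val hz⟩

end

/-- There is a holomorphic covering map from the unit disk onto the twice-punctured
plane `ℂ \ {0, 1}`. -/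
theorem exists_holomorphic_covering_twice_punctured_plane :
    ∃ ψ : ℂ → ℂ, IsHolomorphicCoveringOnto ψ (Metric.ball 0 1) (({0, 1} : Set ℂ)ᶜ) := by
  exact ⟨_, isHolomorphicCoveringOnto_modularLambda⟩
end

section
/- Let Ω' ⊆ ℂ be a nonempty open connected set and suppose there exists a holomorphic covering map ψ : D₁ → ℂ with ψ(D₁) = Ω' which is a topological covering map onto Ω'. Then for every nonempty open connected subset Ω ⊆ Ω', there exists a holomorphic covering map φ : D₁ → ℂ with φ(D₁) = Ω which is a topological covering map onto Ω. -/
section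

open Metric Set Filter Topology

/-- A continuous solution `h` of `F ∘ h = k` is differentiable where `F'` does not vanish. -/
lemma differentiableAt_of_comp_eq {F k h : ℂ → ℂ} {F' b : ℂ} (hF : HasStrictDerivAt F F' (h b))
    (hF' : F' ≠ 0) (hk : DifferentiableAt ℂ k b) (hh : ContinuousAt h b)
    (heq : ∀ᶠ y in 𝓝 b, F (h y) = k y) : DifferentiableAt ℂ h b := by
  have hinv := (hF.hasStrictFDerivAt_equiv hF').eventually_left_inverse
  have hloc := (hF.to_localInverse hF').hasDerivAt.differentiableAt
  rw [heq.self_of_nhds] at hloc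
  refine (hloc.comp b hk).congr_of_eventuallyEq ?_
  filter_upwards [heq, hh.eventually hinv] with y hy hy'
  rw [Function.comp_apply, ← hy]
  exact hy'.symm

/-- A continuous local right inverse of a holomorphic function is holomorphic. -/
lemma differentiableAt_of_comp_eq_id {F h : ℂ → ℂ} {b : ℂ}
    (hF : ∀ᶠ z in 𝓝 (h b), DifferentiableAt ℂ F z) (hh : ∀ᶠ y in 𝓝 b, ContinuousAt h y)
    (heq : ∀ᶠ y in 𝓝 b, F (h y) = y) : DifferentiableAt ℂ h b := by
  have hFa : AnalyticAt ℂ F (h b) := Complex.analyticAt_iff_eventually_differentiableAt.2 hF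
  have hbc : ContinuousAt h b := hh.self_of_nhds
  have hne : ∀ᶠ z in 𝓝[≠] (h b), deriv F z ≠ 0 := by
    refine hFa.deriv.eventually_eq_zero_or_eventually_ne_zero.resolve_left fun h0 ↦ ?_
    obtain ⟨ε, hε, hball⟩ := Metric.eventually_nhds_iff_ball.1 (h0.and hF)
    have hconst : ∀ z ∈ ball (h b) ε, F z = F (h b) := fun z hz ↦
      isOpen_ball.is_const_of_deriv_eq_zero (convex_ball _ _).isPreconnected
        (fun w hw ↦ (hball w hw).2.differentiableWithinAt) (fun w hw ↦ (hball w hw).1) hz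
        (mem_ball_self hε)
    have h1 : ∀ᶠ y in 𝓝 b, y = b := by
      filter_upwards [hbc.eventually (ball_mem_nhds _ hε), heq] with y hy hy'
      rw [← hy', hconst _ hy, heq.self_of_nhds]
    obtain ⟨y, hy, hy'⟩ := ((h1.filter_mono nhdsWithin_le_nhds).and
      (self_mem_nhdsWithin : ({b}ᶜ : Set ℂ) ∈ 𝓝[≠] b)).exists
    exact hy' hy
  have htend : Tendsto h (𝓝[≠] b) (𝓝[≠] (h b)) := by
    refine tendsto_nhdsWithin_iff.2 ⟨hbc.tendsto.mono_left nhdsWithin_le_nhds, ?_⟩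
    filter_upwards [heq.filter_mono nhdsWithin_le_nhds, self_mem_nhdsWithin] with y hy hyb hyh
    rw [mem_singleton_iff] at hyh
    exact hyb (by rw [mem_singleton_iff, ← hy, hyh, heq.self_of_nhds])
  refine (Complex.analyticAt_of_differentiable_on_punctured_nhds_of_continuousAt ?_
    hbc).differentiableAt
  filter_upwards [htend.eventually hne, htend.eventually (hF.filter_mono nhdsWithin_le_nhds
    |>.and (hFa.eventually_analyticAt.filter_mono nhdsWithin_le_nhds)),
    hh.filter_mono nhdsWithin_le_nhds, heq.eventually_nhds.filter_mono nhdsWithin_le_nhds]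
    with y hy1 hy2 hy3 hy4
  exact differentiableAt_of_comp_eq hy2.2.hasStrictDerivAt hy1 differentiableAt_id hy3 hy4

/-- A map with a continuous section through every point of the preimage of a connected open set
evenly covers that set. -/
lemma isEvenlyCovered_of_sections {E X : Type*} [TopologicalSpace E] [TopologicalSpace X]
    [T2Space E] {p : E → X} (hp : Continuous p) (hinj : IsLocallyInjective p) {U : Set X}
    (hU : IsOpen U) (hc : IsPreconnected U) {x : X} (hx : x ∈ U)
    (hs : ∀ e, p e ∈ U → ∃ s : X → E, ContinuousOn s U ∧ s (p e) = e ∧ ∀ y ∈ U, p (s y) = y) :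
    IsEvenlyCovered p x (p ⁻¹' {x}) := by
  have hdisc : DiscreteTopology (p ⁻¹' {x}) := by
    refine discreteTopology_iff_isOpen_singleton.2 fun e ↦ ?_
    obtain ⟨W, hW, heW, hWi⟩ := hinj e
    refine ⟨W, hW, ?_⟩
    ext e'
    simp only [mem_preimage, mem_singleton_iff]
    refine ⟨fun h ↦ Subtype.ext (hWi h heW ?_), fun h ↦ h ▸ heW⟩
    exact e'.2.trans e.2.symm
  have hs' : ∀ e : E, ∃ s : X → E, p e ∈ U →
      ContinuousOn s U ∧ s (p e) = e ∧ ∀ y ∈ U, p (s y) = y := fun e ↦ by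
    by_cases h : p e ∈ U
    · exact (hs e h).imp fun s hs _ ↦ hs
    · exact ⟨fun _ ↦ e, fun h' ↦ (h h').elim⟩
  choose s hs using hs'
  have hun : ∀ e e' : E, p e ∈ U → p e' ∈ U → ∀ y ∈ U, s e y = s e' y → EqOn (s e) (s e') U := by
    intro e e' he he' y hy hyy
    refine (T2Space.isSeparatedMap p).eqOn_of_comp_eqOn hinj hc (hs e he).1 (hs e' he').1
      (fun y hy ↦ ?_) hy hyy
    simp only [Function.comp_apply]
    rw [(hs e he).2.2 y hy, (hs e' he').2.2 y hy]
  have hfU : ∀ i : p ⁻¹' {x}, p i.1 ∈ U := fun i ↦ by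
    rw [show p i.1 = x from i.2]; exact hx
  have hsi : ∀ i : p ⁻¹' {x}, s i.1 x = i.1 := fun i ↦ by
    have := (hs i.1 (hfU i)).2.1
    rwa [show p i.1 = x from i.2] at this
  refine ⟨hdisc, U, hx, hU, hU.preimage hp, ⟨⟨
    fun e ↦ (⟨p e.1, e.2⟩, ⟨s e.1 x, (hs e.1 e.2).2.2 x hx⟩),
    fun q ↦ ⟨s q.2.1 q.1.1, by
      rw [mem_preimage, (hs q.2.1 (hfU q.2)).2.2 _ q.1.2]; exact q.1.2⟩, ?_, ?_⟩, ?_, ?_⟩, ?_⟩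
  · rintro ⟨e, he⟩
    have he1 : p (s e x) ∈ U := by rw [(hs e he).2.2 x hx]; exact hx
    have h1 := hun (s e x) e he1 he x hx (hsi ⟨s e x, (hs e he).2.2 x hx⟩) he
    exact Subtype.ext (h1.trans (hs e he).2.1)
  · rintro ⟨⟨y, hy⟩, i⟩
    have h0 := (hs i.1 (hfU i)).2.2 y hy
    have he1 : p (s i.1 y) ∈ U := by rw [h0]; exact hy
    have h2 := (hs (s i.1 y) he1).2.1
    rw [h0] at h2
    have h1 := hun (s i.1 y) i.1 he1 (hfU i) y hy h2 hx
    exact Prod.ext (Subtype.ext h0) (Subtype.ext (h1.trans (hsi i)))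
  · refine Continuous.prodMk (by fun_prop) ((IsLocallyConstant.iff_eventually_eq _).2 ?_).continuous
    rintro ⟨e, he⟩
    obtain ⟨W, hW, heW, hWi⟩ := hinj e
    have hcont : ContinuousAt (fun e' ↦ s e (p e')) e :=
      ((hs e he).1.continuousAt (hU.mem_nhds he)).comp hp.continuousAt
    have hmem : ∀ᶠ e' in 𝓝 e, s e (p e') ∈ W :=
      hcont.eventually (by
        simp only [(hs e he).2.1]; exact hW.mem_nhds heW)
    filter_upwards [continuousAt_subtype_val.eventually (hmem.and (hW.mem_nhds heW))] with e' he'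
    have h1 : s e (p e'.1) = e'.1 := hWi he'.1 he'.2 ((hs e he).2.2 _ e'.2)
    refine Subtype.ext (hun _ _ e'.2 he _ e'.2 ?_ hx)
    rw [h1, (hs _ e'.2).2.1]
  · refine Continuous.subtype_mk (continuous_prod_of_discrete_right.2 fun i ↦ ?_) _
    exact (hs i.1 (hfU i)).1.comp_continuous continuous_subtype_val fun y ↦ y.2
  · intro e; rfl

/-- Pointwise limits along an ultrafilter of maps into the unit disk exist. -/
lemma exists_tendsto_ultrafilter {ι : Type*} (u : Ultrafilter ι) {F : ι → ℂ → ℂ} {V : Set ℂ}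
    (hF : ∀ z ∈ V, ∀ᶠ n in u, F n z ∈ ball (0 : ℂ) 1) :
    ∃ f : ℂ → ℂ, ∀ z ∈ V, Tendsto (F · z) u (𝓝 (f z)) := by
  have h : ∀ z, ∃ w : ℂ, z ∈ V → Tendsto (F · z) u (𝓝 w) := fun z ↦ by
    by_cases hz : z ∈ V
    · obtain ⟨w, -, hw⟩ := (isCompact_closedBall (0 : ℂ) 1).ultrafilter_le_nhds (u.map (F · z))
        (le_principal_iff.2 ((hF z hz).mono fun n hn ↦ ball_subset_closedBall hn))
      exact ⟨w, fun _ ↦ hw⟩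
    · exact ⟨0, fun h ↦ (hz h).elim⟩
  choose f hf using h
  exact ⟨f, hf⟩

/-- A pointwise limit of holomorphic maps into the unit disk is a locally uniform limit. -/
lemma tendstoLocallyUniformlyOn_of_mapsTo_ball {ι : Type*} {l : Filter ι} [l.NeBot]
    {F : ι → ℂ → ℂ} {f : ℂ → ℂ} {V : Set ℂ} (hV : IsOpen V)
    (hF : ∀ᶠ n in l, DifferentiableOn ℂ (F n) V ∧ MapsTo (F n) V (ball 0 1))
    (hf : ∀ z ∈ V, Tendsto (F · z) l (𝓝 (f z))) : TendstoLocallyUniformlyOn F f l V := by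
  rw [Metric.tendstoLocallyUniformlyOn_iff]
  intro ε hε z hz
  obtain ⟨r, hr, hrV⟩ := Metric.isOpen_iff.1 hV z hz
  have hlip : ∀ᶠ n in l, ∀ y ∈ ball z r, dist (F n y) (F n z) ≤ 2 / r * dist y z := by
    filter_upwards [hF] with n hn y hy
    refine Complex.dist_le_div_mul_dist_of_mapsTo_ball (hn.1.mono hrV) (fun w hw ↦ ?_) hy
    have h1 := hn.2 (hrV hw)
    have h2 := hn.2 hz
    rw [mem_ball] at h1 h2
    rw [mem_closedBall]
    linarith [dist_triangle_right (F n w) (F n z) 0]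
  have hlip' : ∀ y ∈ ball z r, dist (f y) (f z) ≤ 2 / r * dist y z := fun y hy ↦
    le_of_tendsto ((hf y (hrV hy)).dist (hf z hz)) (hlip.mono fun n hn ↦ hn y hy)
  set δ := min r (r * ε / 6) with hδ
  have hδ0 : 0 < δ := by positivity
  refine ⟨ball z δ, mem_nhdsWithin_of_mem_nhds (ball_mem_nhds _ hδ0), ?_⟩
  filter_upwards [hlip, (Metric.tendsto_nhds.1 (hf z hz)) (ε / 3) (by positivity)] with n h1 h2 y hy
  have hyr : y ∈ ball z r := ball_subset_ball (min_le_left _ _) hy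
  have hb : 2 / r * dist y z ≤ ε / 3 := by
    have : dist y z ≤ r * ε / 6 := hy.le.trans (min_le_right _ _)
    calc 2 / r * dist y z ≤ 2 / r * (r * ε / 6) := by gcongr
      _ = ε / 3 := by field_simp; norm_num
  have h3 := h1 y hyr
  have h4 := hlip' y hyr
  rw [dist_comm (F n y)] at h3
  rw [dist_comm (F n z)] at h2
  linarith [dist_triangle4 (f y) (f z) (F n z) (F n y)]

/-- A holomorphic map from a disk to the closed unit disk with a value in the open unit disk
takes all its values there. -/
lemma mapsTo_ball_of_norm_le_one {f : ℂ → ℂ} {c p : ℂ} {R : ℝ}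
    (hf : DifferentiableOn ℂ f (ball c R)) (hle : ∀ z ∈ ball c R, ‖f z‖ ≤ 1)
    (hp : p ∈ ball c R) (hfp : ‖f p‖ < 1) : MapsTo f (ball c R) (ball 0 1) := by
  intro z hz
  rw [mem_ball_zero_iff]
  refine lt_of_le_of_ne (hle z hz) fun h1 ↦ hfp.ne ?_
  have := Complex.norm_eqOn_of_isPreconnected_of_isMaxOn (convex_ball c R).isPreconnected
    isOpen_ball hf hz (fun w hw ↦ by simpa [h1] using hle w hw) hp
  simpa [h1] using this

/-- Hurwitz: a limit of maps omitting the value `a` on a disk omits `a` or is constant. -/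
lemma eqOn_const_of_tendsto_ne {ι : Type*} {l : Filter ι} [l.NeBot]
    {F : ι → ℂ → ℂ} {f : ℂ → ℂ} {c a z₀ : ℂ} {R : ℝ}
    (hF : ∀ᶠ n in l, DifferentiableOn ℂ (F n) (ball c R) ∧ ∀ z ∈ ball c R, F n z ≠ a)
    (hf : TendstoLocallyUniformlyOn F f l (ball c R)) (hz₀ : z₀ ∈ ball c R) (hfz : f z₀ = a) :
    ∀ z ∈ ball c R, f z = a := by
  have hfd : DifferentiableOn ℂ f (ball c R) :=
    hf.differentiableOn (hF.mono fun n hn ↦ hn.1) isOpen_ball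
  have han : AnalyticOnNhd ℂ f (ball c R) := hfd.analyticOnNhd isOpen_ball
  rcases (han z₀ hz₀).eventually_eq_or_eventually_ne (analyticAt_const (v := a)) with h | h
  · exact han.eqOn_of_preconnected_of_eventuallyEq (fun _ _ ↦ analyticAt_const)
      (convex_ball c R).isPreconnected hz₀ h
  exfalso
  obtain ⟨ε, hε, hball⟩ := Metric.eventually_nhds_iff_ball.1
    ((eventually_nhdsWithin_iff.1 h).and (isOpen_ball.mem_nhds hz₀))
  set ρ := ε / 2 with hρ
  have hρ0 : 0 < ρ := by positivity
  have hsub : closedBall z₀ ρ ⊆ ball z₀ ε := closedBall_subset_ball (by linarith)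
  have hsubV : closedBall z₀ ρ ⊆ ball c R := fun z hz ↦ (hball z (hsub hz)).2
  have hsne : (sphere z₀ ρ).Nonempty := NormedSpace.sphere_nonempty.2 hρ0.le
  obtain ⟨y, hy, hmin⟩ := (isCompact_sphere z₀ ρ).exists_isMinOn hsne
    ((hfd.continuousOn.mono (sphere_subset_closedBall.trans hsubV)).sub
      (continuousOn_const (c := a))).norm
  set m := ‖f y - a‖ with hm
  have hm0 : 0 < m := norm_pos_iff.2 (sub_ne_zero.2 ((hball y
    (hsub (sphere_subset_closedBall hy))).1 (ne_of_mem_sphere hy hρ0.ne')))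
  have hunif := (tendstoLocallyUniformlyOn_iff_forall_isCompact isOpen_ball).1 hf
    (closedBall z₀ ρ) hsubV (isCompact_closedBall _ _)
  obtain ⟨n, hn1, hn2⟩ := ((Metric.tendstoUniformlyOn_iff.1 hunif (m / 2) (by positivity)).and
    hF).exists
  have hbd : ∀ z ∈ frontier (ball z₀ ρ), ‖(F n z - a)⁻¹‖ ≤ (m / 2)⁻¹ := by
    intro z hz
    rw [frontier_ball _ hρ0.ne'] at hz
    rw [norm_inv]
    refine inv_anti₀ (by positivity) ?_
    have h1 : m ≤ ‖f z - a‖ := hmin hz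
    have h2 := hn1 z (sphere_subset_closedBall hz)
    rw [dist_eq_norm] at h2
    linarith [norm_sub_le_norm_sub_add_norm_sub (f z) (F n z) a]
  have hdc : DiffContOnCl ℂ (fun z ↦ (F n z - a)⁻¹) (ball z₀ ρ) := by
    refine DifferentiableOn.diffContOnCl ?_
    rw [closure_ball _ hρ0.ne']
    exact ((hn2.1.mono hsubV).sub_const a).fun_inv fun z hz ↦ sub_ne_zero.2 (hn2.2 z (hsubV hz))
  have := Complex.norm_le_of_forall_mem_frontier_norm_le isBounded_ball hdc hbd
    (subset_closure (mem_ball_self hρ0))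
  rw [norm_inv, inv_le_inv₀ (norm_pos_iff.2 (sub_ne_zero.2 (hn2.2 _ hz₀))) (by positivity)] at this
  have h2 := hn1 z₀ (mem_closedBall_self hρ0.le)
  rw [hfz, dist_comm, dist_eq_norm] at h2
  linarith

/-- The involutive automorphism of the unit disk exchanging `0` and `a`. -/
noncomputable def diskInvolution (a z : ℂ) : ℂ := (a - z) / (1 - (starRingEnd ℂ) a * z)

section diskInvolution

variable {a z : ℂ}

lemma one_sub_conj_mul_ne_zero (ha : a ∈ ball (0 : ℂ) 1) (hz : z ∈ ball (0 : ℂ) 1) :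
    1 - (starRingEnd ℂ) a * z ≠ 0 := by
  rw [mem_ball_zero_iff] at ha hz
  refine sub_ne_zero.2 fun h ↦ ?_
  have h1 : ‖(starRingEnd ℂ) a * z‖ < 1 := by
    rw [norm_mul, RCLike.norm_conj]
    exact mul_lt_one_of_nonneg_of_lt_one_left (norm_nonneg _) ha hz.le
  rw [← h, norm_one] at h1
  exact lt_irrefl _ h1

lemma diskInvolution_mem_ball (ha : a ∈ ball (0 : ℂ) 1) (hz : z ∈ ball (0 : ℂ) 1) :
    diskInvolution a z ∈ ball (0 : ℂ) 1 := by
  have hne := one_sub_conj_mul_ne_zero ha hz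
  rw [mem_ball_zero_iff] at ha hz ⊢
  rw [diskInvolution, norm_div, div_lt_one (norm_pos_iff.2 hne)]
  refine lt_of_pow_lt_pow_left₀ 2 (norm_nonneg _) ?_
  have hkey : ‖1 - (starRingEnd ℂ) a * z‖ ^ 2 - ‖a - z‖ ^ 2
      = (1 - ‖a‖ ^ 2) * (1 - ‖z‖ ^ 2) := by
    simp only [← Complex.normSq_eq_norm_sq, Complex.normSq_apply, Complex.sub_re, Complex.sub_im,
      Complex.mul_re, Complex.mul_im, Complex.conj_re, Complex.conj_im, Complex.one_re,
      Complex.one_im]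
    ring
  have h1 : 0 < 1 - ‖a‖ ^ 2 := by nlinarith [norm_nonneg a]
  have h2 : 0 < 1 - ‖z‖ ^ 2 := by nlinarith [norm_nonneg z]
  nlinarith [mul_pos h1 h2]

lemma diskInvolution_diskInvolution (ha : a ∈ ball (0 : ℂ) 1) (hz : z ∈ ball (0 : ℂ) 1) :
    diskInvolution a (diskInvolution a z) = z := by
  have hne := one_sub_conj_mul_ne_zero ha hz
  have hne' := one_sub_conj_mul_ne_zero ha (diskInvolution_mem_ball ha hz)
  have haa := one_sub_conj_mul_ne_zero ha ha
  rw [diskInvolution, div_eq_iff hne', diskInvolution]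
  generalize (starRingEnd ℂ) a = b at *
  rw [mul_comm] at hne
  field_simp
  ring

lemma diskInvolution_eq_zero_iff (ha : a ∈ ball (0 : ℂ) 1) (hz : z ∈ ball (0 : ℂ) 1) :
    diskInvolution a z = 0 ↔ z = a := by
  rw [diskInvolution, div_eq_zero_iff, or_iff_left (one_sub_conj_mul_ne_zero ha hz), sub_eq_zero,
    eq_comm]

lemma hasDerivAt_diskInvolution (ha : a ∈ ball (0 : ℂ) 1) (hz : z ∈ ball (0 : ℂ) 1) :
    HasDerivAt (diskInvolution a)
      (((starRingEnd ℂ) a * a - 1) / (1 - (starRingEnd ℂ) a * z) ^ 2) z := by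
  have h := ((hasDerivAt_id z).const_sub a).div
    (((hasDerivAt_id z).const_mul ((starRingEnd ℂ) a)).const_sub 1)
    (one_sub_conj_mul_ne_zero ha hz)
  refine HasDerivAt.congr_deriv h ?_
  simp only [id]
  ring

lemma differentiableOn_diskInvolution (ha : a ∈ ball (0 : ℂ) 1) :
    DifferentiableOn ℂ (diskInvolution a) (ball 0 1) := fun _ hz ↦
  (hasDerivAt_diskInvolution ha hz).differentiableAt.differentiableWithinAt

@[simp] lemma diskInvolution_zero : diskInvolution a 0 = a := by simp [diskInvolution]

end diskInvolution

/-- Every local inverse of `g` on a disk contained in `Ω` extends to the whole disk, with values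
in `U`. -/
def HasDiskSections (g : ℂ → ℂ) (U Ω : Set ℂ) : Prop :=
  ∀ (c : ℂ) (R : ℝ), ball c R ⊆ Ω → ∀ z ∈ U, g z ∈ ball c R →
    ∃ h : ℂ → ℂ, DifferentiableOn ℂ h (ball c R) ∧ MapsTo h (ball c R) U ∧ h (g z) = z ∧
      ∀ w ∈ ball c R, g (h w) = w

/-- A pointed open subset of the unit disk with a holomorphic map `π` to the unit disk such that
`ψ ∘ π` maps to `Ω` and has sections over disks. -/
structure IsIntermediateCover (ψ : ℂ → ℂ) (Ω : Set ℂ) (p : ℂ) (U : Set ℂ) (π : ℂ → ℂ) : Prop where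
  isOpen : IsOpen U
  subset_ball : U ⊆ ball 0 1
  zero_mem : 0 ∈ U
  differentiableOn : DifferentiableOn ℂ π U
  mapsTo_ball : MapsTo π U (ball 0 1)
  map_zero : π 0 = p
  mapsTo : MapsTo (fun z ↦ ψ (π z)) U Ω
  hasDiskSections : HasDiskSections (fun z ↦ ψ (π z)) U Ω

/-- A nowhere vanishing holomorphic function on a disk has a holomorphic square root, with any
prescribed choice of sign. -/
lemma exists_differentiableOn_sq_eq {k : ℂ → ℂ} {c w₀ q₀ : ℂ} {R : ℝ}
    (hk : DifferentiableOn ℂ k (ball c R)) (hne : ∀ w ∈ ball c R, k w ≠ 0) (hw₀ : w₀ ∈ ball c R)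
    (hq₀ : q₀ ^ 2 = k w₀) :
    ∃ q : ℂ → ℂ, DifferentiableOn ℂ q (ball c R) ∧ (∀ w, q w ^ 2 = k w) ∧ q w₀ = q₀ := by
  have hsc : IsSimplyConnected (ball c R) := by
    have := (convex_ball c R).contractibleSpace ⟨w₀, hw₀⟩
    exact inferInstanceAs (SimplyConnectedSpace (ball c R))
  obtain ⟨q, hqc, hq⟩ := Complex.exists_continuousOn_pow_eq hsc isOpen_ball hk.continuousOn
    (by rintro ⟨w, hw, hw0⟩; exact hne w hw hw0) two_ne_zero
  have hqd : DifferentiableOn ℂ q (ball c R) := fun w hw ↦ by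
    have hw0 : q w ≠ 0 := fun h ↦ hne w hw (by rw [← hq w, h]; simp)
    exact (differentiableAt_of_comp_eq (hasStrictDerivAt_pow 2 (q w)) (by simpa using hw0)
      (hk.differentiableAt (isOpen_ball.mem_nhds hw)) (hqc.continuousAt (isOpen_ball.mem_nhds hw))
      (.of_forall hq)).differentiableWithinAt
  rcases sq_eq_sq_iff_eq_or_eq_neg.1 ((hq w₀).trans hq₀.symm) with h | h
  · exact ⟨q, hqd, hq, h⟩
  · exact ⟨fun w ↦ -q w, hqd.neg, fun w ↦ by rw [neg_sq, hq w], by simp [h]⟩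

/-- Koebe's osculation: pulling back along the double cover of the disk branched over an omitted
point `a` multiplies the derivative at the base point by `2 √|a| / (1 + |a|)`. -/
lemma IsIntermediateCover.exists_osculation {ψ π : ℂ → ℂ} {Ω U : Set ℂ} {p a : ℂ}
    (hU : IsIntermediateCover ψ Ω p U π) (ha : a ∈ ball (0 : ℂ) 1) (haU : a ∉ U) :
    ∃ U' π', IsIntermediateCover ψ Ω p U' π' ∧
      ‖deriv π' 0‖ = ‖deriv π 0‖ * (2 * √‖a‖ / (1 + ‖a‖)) := by
  obtain ⟨b, hba⟩ : ∃ b : ℂ, b ^ 2 = a := IsAlgClosed.exists_pow_nat_eq a two_pos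
  have hbn : ‖b‖ ^ 2 = ‖a‖ := by rw [← norm_pow, hba]
  have hb : b ∈ ball (0 : ℂ) 1 := by
    rw [mem_ball_zero_iff] at ha ⊢
    nlinarith [norm_nonneg b]
  have hsq : ∀ {z : ℂ}, z ∈ ball (0 : ℂ) 1 → z ^ 2 ∈ ball (0 : ℂ) 1 := fun {z} hz ↦ by
    rw [mem_ball_zero_iff] at hz ⊢
    rw [norm_pow]
    exact pow_lt_one₀ (norm_nonneg _) hz two_ne_zero
  set P : ℂ → ℂ := fun z ↦ diskInvolution a (diskInvolution b z ^ 2) with hP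
  have hPm : MapsTo P (ball 0 1) (ball 0 1) := fun z hz ↦
    diskInvolution_mem_ball ha (hsq (diskInvolution_mem_ball hb hz))
  have hP0 : P 0 = 0 := by
    simp only [hP, diskInvolution_zero, hba]
    exact (diskInvolution_eq_zero_iff ha ha).2 rfl
  have hPd : DifferentiableOn ℂ P (ball 0 1) :=
    (differentiableOn_diskInvolution ha).comp ((differentiableOn_diskInvolution hb).pow 2)
      fun z hz ↦ hsq (diskInvolution_mem_ball hb hz)
  have h0 : (0 : ℂ) ∈ ball (0 : ℂ) 1 := mem_ball_self one_pos
  refine ⟨ball 0 1 ∩ P ⁻¹' U, π ∘ P, ⟨hPd.continuousOn.isOpen_inter_preimage isOpen_ball hU.isOpen,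
    inter_subset_left, ⟨h0, by rw [mem_preimage, hP0]; exact hU.zero_mem⟩,
    hU.differentiableOn.comp (hPd.mono inter_subset_left) fun z hz ↦ hz.2,
    fun z hz ↦ hU.mapsTo_ball hz.2, by rw [Function.comp_apply, hP0, hU.map_zero],
    fun z hz ↦ hU.mapsTo hz.2, ?_⟩, ?_⟩
  · intro c R hcR z hz hzc
    obtain ⟨h, hd, hm, hz', hs⟩ := hU.hasDiskSections c R hcR (P z) hz.2 hzc
    have hmD : MapsTo h (ball c R) (ball 0 1) := fun w hw ↦ hU.subset_ball (hm hw)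
    obtain ⟨q, hqd, hq, hqz⟩ := exists_differentiableOn_sq_eq
      (k := fun w ↦ diskInvolution a (h w)) (q₀ := diskInvolution b z)
      ((differentiableOn_diskInvolution ha).comp hd hmD)
      (fun w hw h0 ↦ haU (by
        rw [← (diskInvolution_eq_zero_iff ha (hmD hw)).1 h0]; exact hm hw)) hzc
      (by
        change _ = diskInvolution a (h (ψ (π (P z))))
        rw [hz', hP, diskInvolution_diskInvolution ha (hsq (diskInvolution_mem_ball hb hz.1))])
    have hqm : MapsTo q (ball c R) (ball 0 1) := fun w hw ↦ by
      have h1 := diskInvolution_mem_ball ha (hmD hw)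
      rw [← hq w, mem_ball_zero_iff, norm_pow] at h1
      rw [mem_ball_zero_iff]
      nlinarith [norm_nonneg (q w)]
    have hPq : ∀ w ∈ ball c R, P (diskInvolution b (q w)) = h w := fun w hw ↦ by
      simp only [hP]
      rw [diskInvolution_diskInvolution hb (hqm hw), hq w,
        diskInvolution_diskInvolution ha (hmD hw)]
    refine ⟨fun w ↦ diskInvolution b (q w), (differentiableOn_diskInvolution hb).comp hqd hqm,
      fun w hw ↦ ⟨diskInvolution_mem_ball hb (hqm hw), ?_⟩, ?_, fun w hw ↦ ?_⟩
    · rw [mem_preimage, hPq w hw]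
      exact hm hw
    · change diskInvolution b (q (ψ (π (P z)))) = z
      rw [show q (ψ (π (P z))) = _ from hqz, diskInvolution_diskInvolution hb hz.1]
    · change ψ (π (P (diskInvolution b (q w)))) = w
      rw [hPq w hw]
      exact hs w hw
  · have hπ : HasDerivAt π (deriv π 0) (P 0) := by
      rw [hP0]
      exact (hU.differentiableOn.differentiableAt (hU.isOpen.mem_nhds hU.zero_mem)).hasDerivAt
    have hab : HasDerivAt (diskInvolution a)
        (((starRingEnd ℂ) a * a - 1) / (1 - (starRingEnd ℂ) a * a) ^ 2)
        (diskInvolution b 0 ^ 2) := by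
      rw [diskInvolution_zero, hba]
      exact hasDerivAt_diskInvolution ha ha
    have hP' := hab.comp (0 : ℂ) ((hasDerivAt_diskInvolution hb h0).pow 2)
    have hd := (hπ.comp (0 : ℂ) hP').deriv
    have hconj : ∀ z : ℂ, (starRingEnd ℂ) z * z = ((‖z‖ ^ 2 : ℝ) : ℂ) := fun z ↦ by
      rw [Complex.conj_mul']; push_cast; rfl
    have hnorm : ∀ t : ℝ, ‖(t : ℂ) - 1‖ = |t - 1| ∧ ‖1 - (t : ℂ)‖ = |1 - t| := fun t ↦ by
      constructor <;> rw [← Complex.ofReal_one, ← Complex.ofReal_sub, Complex.norm_real,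
        Real.norm_eq_abs]
    have hd' : deriv (π ∘ P) 0 = _ := hd
    rw [hd', norm_mul, ← hbn, Real.sqrt_sq (norm_nonneg b)]
    congr 1
    rw [mem_ball_zero_iff] at hb
    have hbp := norm_nonneg b
    have hb2 : ‖b‖ ^ 2 < 1 := by nlinarith
    have hb4 : (‖b‖ ^ 2) ^ 2 < 1 := by nlinarith
    simp only [mul_zero, sub_zero, diskInvolution_zero, norm_mul, norm_div, norm_pow, hconj,
      (hnorm _).1, (hnorm _).2, ← hbn, norm_one]
    rw [abs_of_neg (by linarith : (‖b‖ ^ 2) ^ 2 - 1 < 0), abs_of_neg (by linarith : ‖b‖ ^ 2 - 1 < 0),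
      abs_of_pos (by linarith : 0 < 1 - (‖b‖ ^ 2) ^ 2)]
    have h1 : 1 - ‖b‖ ^ 4 ≠ 0 := by nlinarith
    have h2 : 1 + ‖b‖ ^ 2 ≠ 0 := by positivity
    simp
    field_simp
    ring

/-- A holomorphic covering map of the disk has sections over disks. -/
lemma IsHolomorphicCoveringOnto.hasDiskSections {ψ : ℂ → ℂ} {D Ω : Set ℂ} (hD : IsOpen D)
    (hψ : IsHolomorphicCoveringOnto ψ D Ω) : HasDiskSections ψ D Ω := by
  intro c R hcR z hz hzc
  have hm : MapsTo ψ D Ω := fun w hw ↦ hψ.2.1 ▸ mem_image_of_mem ψ hw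
  have hcov := hψ.2.2 hm
  have := (convex_ball c R).contractibleSpace ⟨ψ z, hzc⟩
  have : LocallyPathConnectedSpace (ball c R) := isOpen_ball.locallyPathConnectedSpace
  obtain ⟨F, ⟨hF0, hF⟩, -⟩ := hcov.existsUnique_continuousMap_lifts
    (⟨inclusion hcR, continuous_inclusion hcR⟩ : C(ball c R, Ω)) ⟨ψ z, hzc⟩ ⟨z, hz⟩ rfl
  classical
  set h : ℂ → ℂ := fun w ↦ if hw : w ∈ ball c R then (F ⟨w, hw⟩ : ℂ) else 0
  have hval : ∀ w (hw : w ∈ ball c R), h w = F ⟨w, hw⟩ := fun w hw ↦ dif_pos hw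
  have hs : ∀ w ∈ ball c R, ψ (h w) = w := fun w hw ↦ by
    rw [hval w hw]
    exact congr_arg Subtype.val (congr_fun hF ⟨w, hw⟩)
  have hmem : MapsTo h (ball c R) D := fun w hw ↦ by
    rw [hval w hw]
    exact (F ⟨w, hw⟩).2
  have hcont : ContinuousOn h (ball c R) := by
    rw [continuousOn_iff_continuous_domRestrict]
    have : (ball c R).domRestrict h = fun w ↦ (F w : ℂ) := funext fun w ↦ hval w w.2
    rw [this]
    exact continuous_subtype_val.comp F.continuous
  refine ⟨h, fun w hw ↦ ?_, hmem, ?_, hs⟩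
  · have hnhds := isOpen_ball.mem_nhds hw
    refine (differentiableAt_of_comp_eq_id (F := ψ) ?_ ?_ ?_).differentiableWithinAt
    · filter_upwards [hD.mem_nhds (hmem hw)] with y hy
      exact hψ.1.differentiableAt (hD.mem_nhds hy)
    · filter_upwards [hnhds] with y hy
      exact hcont.continuousAt (isOpen_ball.mem_nhds hy)
    · filter_upwards [hnhds] with y hy using hs y hy
  · rw [hval _ hzc, hF0]

/-- A section of a holomorphic map over a disk inverts its derivative. -/
lemma deriv_mul_deriv_eq_one {g h : ℂ → ℂ} {U : Set ℂ} {c w : ℂ} {R : ℝ} (hU : IsOpen U)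
    (hg : DifferentiableOn ℂ g U) (hh : DifferentiableOn ℂ h (ball c R)) (hw : w ∈ ball c R)
    (hmem : h w ∈ U) (hs : ∀ w ∈ ball c R, g (h w) = w) : deriv g (h w) * deriv h w = 1 := by
  have h1 := (hg.differentiableAt (hU.mem_nhds hmem)).hasDerivAt.comp w
    (hh.differentiableAt (isOpen_ball.mem_nhds hw)).hasDerivAt
  refine h1.unique ((hasDerivAt_id w).congr_of_eventuallyEq ?_)
  filter_upwards [isOpen_ball.mem_nhds hw] with y hy using hs y hy

/-- A holomorphic map with sections over disks in a connected open set is a covering. -/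
lemma HasDiskSections.isHolomorphicCoveringOnto {g : ℂ → ℂ} {D Ω : Set ℂ} (hD : IsOpen D)
    (hne : D.Nonempty) (hg : DifferentiableOn ℂ g D) (hm : MapsTo g D Ω)
    (hs : HasDiskSections g D Ω) (hΩ : IsOpen Ω) (hc : IsPreconnected Ω) :
    IsHolomorphicCoveringOnto g D Ω := by
  have hmeet : ∀ c R, ball c R ⊆ Ω → ∀ z ∈ D, g z ∈ ball c R → ball c R ⊆ g '' D :=
    fun c R hcR z hz hzc w hw ↦ by
      obtain ⟨h, -, hhm, -, hhs⟩ := hs c R hcR z hz hzc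
      exact ⟨h w, hhm hw, hhs w hw⟩
  have himage : g '' D = Ω := by
    refine hm.image_subset.antisymm ?_
    refine hc.subset_of_closure_inter_subset ?_ ?_ ?_
    · refine isOpen_iff_mem_nhds.2 ?_
      rintro _ ⟨z, hz, rfl⟩
      obtain ⟨R, hR, hRΩ⟩ := Metric.isOpen_iff.1 hΩ _ (hm hz)
      exact mem_of_superset (ball_mem_nhds _ hR) (hmeet _ _ hRΩ z hz (mem_ball_self hR))
    · obtain ⟨z, hz⟩ := hne
      exact ⟨g z, hm hz, mem_image_of_mem g hz⟩
    · rintro w ⟨hw, hwΩ⟩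
      obtain ⟨R, hR, hRΩ⟩ := Metric.isOpen_iff.1 hΩ w hwΩ
      obtain ⟨_, hzc, ⟨z, hz, rfl⟩⟩ := mem_closure_iff.1 hw _ isOpen_ball (mem_ball_self hR)
      exact hmeet _ _ hRΩ z hz hzc (mem_ball_self hR)
  refine ⟨hg, himage, fun hm' ↦ ?_⟩
  have hcont : Continuous (hm'.restrict g D Ω) := hg.continuousOn.mapsToRestrict hm'
  have hinj : IsLocallyInjective (hm'.restrict g D Ω) := by
    intro e
    obtain ⟨R, hR, hRΩ⟩ := Metric.isOpen_iff.1 hΩ _ (hm e.2)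
    obtain ⟨h, hhd, hhm, hhe, hhs⟩ := hs _ R hRΩ e e.2 (mem_ball_self hR)
    have hd := deriv_mul_deriv_eq_one hD hg hhd (mem_ball_self hR) (hhm (mem_ball_self hR)) hhs
    rw [hhe] at hd
    have hst : HasStrictDerivAt g (deriv g e) e :=
      ((hg.analyticOnNhd hD) e e.2).hasStrictDerivAt
    have hinv := (hst.hasStrictFDerivAt_equiv
      (left_ne_zero_of_mul_eq_one hd)).eventually_left_inverse
    obtain ⟨W, hW, hWo, heW⟩ := _root_.eventually_nhds_iff.1 hinv
    refine ⟨Subtype.val ⁻¹' W, hWo.preimage continuous_subtype_val, heW, fun x hx y hy hxy ↦ ?_⟩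
    have hxy' : g x = g y := congr_arg Subtype.val hxy
    exact Subtype.ext ((hW x hx).symm.trans ((congr_arg _ hxy').trans (hW y hy)))
  intro x
  obtain ⟨R, hR, hRΩ⟩ := Metric.isOpen_iff.1 hΩ x x.2
  refine (isEvenlyCovered_of_sections hcont hinj (U := Subtype.val ⁻¹' ball (x : ℂ) R)
    (isOpen_ball.preimage continuous_subtype_val) ?_ (mem_ball_self hR) fun e he ↦ ?_)
  · rw [← IsInducing.subtypeVal.isPreconnected_image, Subtype.image_preimage_coe,
      inter_eq_self_of_subset_right hRΩ]
    exact (convex_ball _ _).isPreconnected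
  · obtain ⟨h, hhd, hhm, hhe, hhs⟩ := hs _ R hRΩ e e.2 he
    classical
    set s : Ω → D := fun y ↦ if hy : (y : ℂ) ∈ ball (x : ℂ) R then ⟨h y, hhm hy⟩ else e with hsdef
    have hsv : ∀ y : Ω, (y : ℂ) ∈ ball (x : ℂ) R → (s y : ℂ) = h y := fun y hy ↦ by
      simp only [hsdef, dif_pos hy]
    refine ⟨s, ?_, Subtype.ext ((hsv _ he).trans hhe), fun y hy ↦ Subtype.ext ?_⟩
    · rw [IsInducing.subtypeVal.continuousOn_iff]
      exact (hhd.continuousOn.comp continuous_subtype_val.continuousOn fun y hy ↦ hy).congr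
        fun y hy ↦ hsv y hy
    · change g (s y) = y
      rw [hsv y hy]
      exact hhs y hy

/-- Translating the base point to `0` makes the preimage of `Ω` an intermediate covering. -/
lemma IsIntermediateCover.initial {ψ : ℂ → ℂ} {Ω Ω' : Set ℂ} {p : ℂ}
    (hψ : IsHolomorphicCoveringOnto ψ (ball 0 1) Ω') (hsub : Ω ⊆ Ω') (hΩ : IsOpen Ω)
    (hp : p ∈ ball (0 : ℂ) 1) (hpΩ : ψ p ∈ Ω) :
    IsIntermediateCover ψ Ω p (ball 0 1 ∩ (fun z ↦ ψ (diskInvolution p z)) ⁻¹' Ω)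
      (diskInvolution p) := by
  have hm : MapsTo (diskInvolution p) (ball 0 1) (ball 0 1) := fun z hz ↦
    diskInvolution_mem_ball hp hz
  refine ⟨ContinuousOn.isOpen_inter_preimage ?_ isOpen_ball hΩ, inter_subset_left,
    ⟨mem_ball_self one_pos, by simpa using hpΩ⟩,
    (differentiableOn_diskInvolution hp).mono inter_subset_left, fun z hz ↦ hm hz.1,
    diskInvolution_zero, fun z hz ↦ hz.2, fun c R hcR z hz hzc ↦ ?_⟩
  · exact (hψ.1.comp (differentiableOn_diskInvolution hp) hm).continuousOn
  · obtain ⟨h, hd, hhm, hz', hs⟩ := hψ.hasDiskSections isOpen_ball c R (hcR.trans hsub)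
      (diskInvolution p z) (hm hz.1) hzc
    have hinv : ∀ w ∈ ball c R, diskInvolution p (diskInvolution p (h w)) = h w := fun w hw ↦
      diskInvolution_diskInvolution hp (hhm hw)
    refine ⟨fun w ↦ diskInvolution p (h w), (differentiableOn_diskInvolution hp).comp hd hhm,
      fun w hw ↦ ⟨hm (hhm hw), ?_⟩, ?_, fun w hw ↦ ?_⟩
    · rw [mem_preimage, hinv w hw, hs w hw]
      exact hcR hw
    · change diskInvolution p (h (ψ (diskInvolution p z))) = z
      rw [hz', diskInvolution_diskInvolution hp hz.1]
    · change ψ (diskInvolution p (diskInvolution p (h w))) = w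
      rw [hinv w hw, hs w hw]

/-- The derivatives at the base point of the intermediate coverings are bounded below. -/
lemma IsIntermediateCover.le_norm_deriv {ψ π : ℂ → ℂ} {Ω U : Set ℂ} {p : ℂ} {R : ℝ}
    (hψ : DifferentiableOn ℂ ψ (ball 0 1)) (hU : IsIntermediateCover ψ Ω p U π)
    (hR : 0 < R) (hRΩ : ball (ψ p) R ⊆ Ω) :
    0 < ‖deriv ψ p‖ ∧ R / ‖deriv ψ p‖ ≤ ‖deriv π 0‖ := by
  have hmem : ψ (π 0) ∈ ball (ψ p) R := by
    rw [hU.map_zero]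
    exact mem_ball_self hR
  obtain ⟨h, hd, hhm, hz, hs⟩ := hU.hasDiskSections _ R hRΩ 0 hU.zero_mem hmem
  have hp0 : h (ψ p) = 0 := by rw [← hU.map_zero]; exact hz
  have hpU : p ∈ ball (0 : ℂ) 1 := hU.map_zero ▸ hU.mapsTo_ball hU.zero_mem
  have h1 := deriv_mul_deriv_eq_one hU.isOpen (hψ.comp hU.differentiableOn hU.mapsTo_ball) hd
    (mem_ball_self hR) (hhm (mem_ball_self hR)) hs
  have hle : ‖deriv h (ψ p)‖ ≤ 1 / R := by
    refine Complex.norm_deriv_le_div_of_mapsTo_ball hd (fun w hw ↦ ?_) hR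
    rw [hp0]
    exact ball_subset_closedBall (hU.subset_ball (hhm hw))
  have hchain : deriv (ψ ∘ π) 0 = deriv ψ p * deriv π 0 := by
    rw [← hU.map_zero]
    refine deriv_comp 0 (hψ.differentiableAt (isOpen_ball.mem_nhds ?_))
      (hU.differentiableOn.differentiableAt (hU.isOpen.mem_nhds hU.zero_mem))
    rw [hU.map_zero]
    exact hpU
  rw [hp0, hchain] at h1
  have hn : ‖deriv ψ p‖ * ‖deriv π 0‖ * ‖deriv h (ψ p)‖ = 1 := by
    rw [← norm_mul, ← norm_mul, h1, norm_one]
  have hpos : 0 < ‖deriv ψ p‖ := by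
    refine (norm_nonneg _).lt_of_ne fun h0 ↦ ?_
    rw [← h0] at hn
    simp at hn
  refine ⟨hpos, ?_⟩
  rw [div_le_iff₀ hpos]
  rw [le_div_iff₀ hR] at hle
  have hA : 0 ≤ ‖deriv ψ p‖ * ‖deriv π 0‖ := by positivity
  nlinarith [mul_le_mul_of_nonneg_left hle hA]

/-- A sequence of intermediate coverings whose domains exhaust the disk has a limit. -/
lemma exists_hasDiskSections_of_exhaustion {ψ : ℂ → ℂ} {Ω : Set ℂ} {p : ℂ} {U : ℕ → Set ℂ}
    {π : ℕ → ℂ → ℂ} (hψ : DifferentiableOn ℂ ψ (ball 0 1))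
    (hU : ∀ n, IsIntermediateCover ψ Ω p (U n) (π n))
    (hex : ∀ r < 1, ∀ᶠ n in atTop, ball (0 : ℂ) r ⊆ U n) :
    ∃ f : ℂ → ℂ, DifferentiableOn ℂ (fun z ↦ ψ (f z)) (ball 0 1) ∧
      MapsTo (fun z ↦ ψ (f z)) (ball 0 1) Ω ∧
      HasDiskSections (fun z ↦ ψ (f z)) (ball 0 1) Ω := by
  set u : Ultrafilter ℕ := hyperfilter ℕ
  have hexu : ∀ r < 1, ∀ᶠ n in u, ball (0 : ℂ) r ⊆ U n := fun r hr ↦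
    (hex r hr).filter_mono Nat.hyperfilter_le_atTop
  have hrad : ∀ z ∈ ball (0 : ℂ) 1, ∃ r < 1, 0 < r ∧ z ∈ ball (0 : ℂ) r := fun z hz ↦ by
    rw [mem_ball_zero_iff] at hz
    obtain ⟨r, hr1, hr2⟩ := exists_between hz
    exact ⟨r, hr2, (norm_nonneg z).trans_lt hr1, mem_ball_zero_iff.2 hr1⟩
  have hexz : ∀ z ∈ ball (0 : ℂ) 1, ∀ᶠ n in u, z ∈ U n := fun z hz ↦ by
    obtain ⟨r, hr, -, hzr⟩ := hrad z hz
    exact (hexu r hr).mono fun n hn ↦ hn hzr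
  obtain ⟨f, hf⟩ := exists_tendsto_ultrafilter u (F := π) (V := ball 0 1) fun z hz ↦
    (hexz z hz).mono fun n hn ↦ (hU n).mapsTo_ball hn
  have hbig : ∀ r < 1, ∀ᶠ n in u, DifferentiableOn ℂ (π n) (ball 0 r) ∧
      MapsTo (π n) (ball 0 r) (ball 0 1) := fun r hr ↦
    (hexu r hr).mono fun n hn ↦ ⟨(hU n).differentiableOn.mono hn, (hU n).mapsTo_ball.mono_left hn⟩
  have hloc : ∀ r < 1, TendstoLocallyUniformlyOn π f u (ball 0 r) := fun r hr ↦
    tendstoLocallyUniformlyOn_of_mapsTo_ball isOpen_ball (hbig r hr)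
      fun z hz ↦ hf z (ball_subset_ball hr.le hz)
  have hfr : ∀ r < 1, DifferentiableOn ℂ f (ball 0 r) := fun r hr ↦
    (hloc r hr).differentiableOn ((hbig r hr).mono fun n hn ↦ hn.1) isOpen_ball
  have h0 : (0 : ℂ) ∈ ball (0 : ℂ) 1 := mem_ball_self one_pos
  have hf0 : f 0 = p := by
    refine tendsto_nhds_unique (hf 0 h0) ?_
    simp only [(hU _).map_zero]
    exact tendsto_const_nhds
  have hp : p ∈ ball (0 : ℂ) 1 := (hU 0).map_zero ▸ (hU 0).mapsTo_ball (hU 0).zero_mem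
  have hpΩ : ψ p ∈ Ω := (hU 0).map_zero ▸ (hU 0).mapsTo (hU 0).zero_mem
  have hfd : DifferentiableOn ℂ f (ball 0 1) := fun z hz ↦ by
    obtain ⟨r, hr, -, hzr⟩ := hrad z hz
    exact ((hfr r hr).differentiableAt (isOpen_ball.mem_nhds hzr)).differentiableWithinAt
  have hfm : MapsTo f (ball 0 1) (ball 0 1) := by
    refine mapsTo_ball_of_norm_le_one hfd (fun z hz ↦ ?_) h0
      (by rw [hf0]; exact mem_ball_zero_iff.1 hp)
    refine le_of_tendsto (hf z hz).norm ((hexz z hz).mono fun n hn ↦ ?_)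
    exact (mem_ball_zero_iff.1 ((hU n).mapsTo_ball hn)).le
  have hψc : ∀ z ∈ ball (0 : ℂ) 1, ContinuousAt ψ z := fun z hz ↦
    (hψ.differentiableAt (isOpen_ball.mem_nhds hz)).continuousAt
  have hmΩ : MapsTo (fun z ↦ ψ (f z)) (ball 0 1) Ω := by
    intro z hz
    by_contra hzΩ
    obtain ⟨r, hr, hr0, hzr⟩ := hrad z hz
    have := eqOn_const_of_tendsto_ne (a := f z) ?_ (hloc r hr) hzr rfl 0 (mem_ball_self hr0)
    · rw [hf0] at this
      exact hzΩ (by change ψ (f z) ∈ Ω; rwa [← this])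
    · filter_upwards [hexu r hr, hbig r hr] with n hn hn'
      refine ⟨hn'.1, fun w hw heq ↦ hzΩ ?_⟩
      change ψ (f z) ∈ Ω
      rw [← heq]
      exact (hU n).mapsTo (hn hw)
  refine ⟨f, hψ.comp hfd hfm, hmΩ, fun c R hcR z hz hzc ↦ ?_⟩
  change ψ (f z) ∈ ball c R at hzc
  have hg : Tendsto (fun n ↦ ψ (π n z)) u (𝓝 (ψ (f z))) := (hψc _ (hfm hz)).tendsto.comp (hf z hz)
  have hsec : ∀ n, ∃ h : ℂ → ℂ, z ∈ U n → ψ (π n z) ∈ ball c R →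
      DifferentiableOn ℂ h (ball c R) ∧ MapsTo h (ball c R) (U n) ∧ h (ψ (π n z)) = z ∧
        ∀ w ∈ ball c R, ψ (π n (h w)) = w := fun n ↦ by
    by_cases hn : z ∈ U n ∧ ψ (π n z) ∈ ball c R
    · obtain ⟨h, hh⟩ := (hU n).hasDiskSections c R hcR z hn.1 hn.2
      exact ⟨h, fun _ _ ↦ hh⟩
    · exact ⟨0, fun h1 h2 ↦ (hn ⟨h1, h2⟩).elim⟩
  choose H hH using hsec
  have hgB : ∀ᶠ n in u, ψ (π n z) ∈ ball c R := hg.eventually (isOpen_ball.mem_nhds hzc)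
  have hHe : ∀ᶠ n in u, DifferentiableOn ℂ (H n) (ball c R) ∧ MapsTo (H n) (ball c R) (U n) ∧
      H n (ψ (π n z)) = z ∧ ∀ w ∈ ball c R, ψ (π n (H n w)) = w := by
    filter_upwards [hexz z hz, hgB] with n h1 h2 using hH n h1 h2
  have hHm : ∀ᶠ n in u, DifferentiableOn ℂ (H n) (ball c R) ∧
      MapsTo (H n) (ball c R) (ball 0 1) := hHe.mono fun n hn ↦
    ⟨hn.1, fun w hw ↦ (hU n).subset_ball (hn.2.1 hw)⟩
  obtain ⟨h, hh⟩ := exists_tendsto_ultrafilter u (F := H) (V := ball c R) fun w hw ↦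
    hHm.mono fun n hn ↦ hn.2 hw
  have hHloc := tendstoLocallyUniformlyOn_of_mapsTo_ball isOpen_ball hHm hh
  have hhd : DifferentiableOn ℂ h (ball c R) :=
    hHloc.differentiableOn (hHm.mono fun n hn ↦ hn.1) isOpen_ball
  have hhz : h (ψ (f z)) = z := by
    have h1 := hHloc.tendsto_comp (hhd.continuousOn _ hzc) hzc
      (tendsto_nhdsWithin_iff.2 ⟨hg, hgB⟩)
    refine tendsto_nhds_unique h1 ?_
    exact tendsto_const_nhds.congr' (hHe.mono fun n hn ↦ hn.2.2.1.symm)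
  have hhm : MapsTo h (ball c R) (ball 0 1) := by
    refine mapsTo_ball_of_norm_le_one hhd (fun w hw ↦ ?_) hzc
      (by rw [hhz]; exact mem_ball_zero_iff.1 hz)
    exact le_of_tendsto (hh w hw).norm
      (hHm.mono fun n hn ↦ (mem_ball_zero_iff.1 (hn.2 hw)).le)
  refine ⟨h, hhd, hhm, hhz, fun w hw ↦ ?_⟩
  obtain ⟨r, hr, -, hwr⟩ := hrad (h w) (hhm hw)
  have h1 := (hloc r hr).tendsto_comp ((hfr r hr).continuousOn _ hwr) hwr
    (tendsto_nhdsWithin_iff.2 ⟨hh w hw, (hh w hw).eventually (isOpen_ball.mem_nhds hwr)⟩)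
  refine tendsto_nhds_unique ((hψc _ (hfm (hhm hw))).tendsto.comp h1) ?_
  exact tendsto_const_nhds.congr' (hHe.mono fun n hn ↦ (hn.2.2.2 w hw).symm)

/-- The factor `2 √t / (1 + t)` is monotone on `[0, 1]`. -/
lemma two_mul_sqrt_div_one_add_le {s t : ℝ} (hs : 0 ≤ s) (hst : s ≤ t) (ht : t ≤ 1) :
    2 * √s / (1 + s) ≤ 2 * √t / (1 + t) := by
  have ht0 : 0 ≤ t := hs.trans hst
  have h1 := Real.sqrt_le_sqrt hst
  have h2 := Real.sqrt_nonneg s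
  have h3 : √t ≤ 1 := Real.sqrt_le_one.2 ht
  have hs2 := Real.sq_sqrt hs
  have ht2 := Real.sq_sqrt ht0
  rw [div_le_div_iff₀ (by linarith) (by linarith)]
  have h4 : 0 ≤ (√t - √s) * (1 - √s * √t) :=
    mul_nonneg (by linarith) (by nlinarith)
  have h5 : √s * t = √s * √t ^ 2 := by rw [ht2]
  have h6 : √t * s = √t * √s ^ 2 := by rw [hs2]
  nlinarith

/-- The factor `2 √t / (1 + t)` is less than `1` on `[0, 1)`. -/
lemma two_mul_sqrt_div_one_add_lt_one {t : ℝ} (ht0 : 0 ≤ t) (ht : t < 1) :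
    2 * √t / (1 + t) < 1 := by
  rw [div_lt_one (by linarith)]
  have h3 : √t < 1 := by rw [Real.sqrt_lt' one_pos]; linarith
  nlinarith [Real.sq_sqrt ht0, mul_pos (sub_pos.2 h3) (sub_pos.2 h3)]

/-- Intermediate coverings with almost minimal derivative have domains exhausting the disk. -/
lemma exists_exhaustion {ψ : ℂ → ℂ} {Ω U₀ : Set ℂ} {π₀ : ℂ → ℂ} {p : ℂ}
    (hψ : DifferentiableOn ℂ ψ (ball 0 1)) (hΩ : IsOpen Ω)
    (h₀ : IsIntermediateCover ψ Ω p U₀ π₀) :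
    ∃ (U : ℕ → Set ℂ) (π : ℕ → ℂ → ℂ), (∀ n, IsIntermediateCover ψ Ω p (U n) (π n)) ∧
      ∀ r < 1, ∀ᶠ n in atTop, ball (0 : ℂ) r ⊆ U n := by
  set S : Set ℝ := {x | ∃ U π, IsIntermediateCover ψ Ω p U π ∧ ‖deriv π 0‖ = x}
  have hSne : S.Nonempty := ⟨_, U₀, π₀, h₀, rfl⟩
  have hpΩ : ψ p ∈ Ω := h₀.map_zero ▸ h₀.mapsTo h₀.zero_mem
  obtain ⟨R, hR, hRΩ⟩ := Metric.isOpen_iff.1 hΩ _ hpΩ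
  have hbdd : BddBelow S := ⟨0, by rintro _ ⟨U, π, -, rfl⟩; exact norm_nonneg _⟩
  have hpos : 0 < sInf S := by
    refine (div_pos hR (h₀.le_norm_deriv hψ hR hRΩ).1).trans_le (le_csInf hSne ?_)
    rintro _ ⟨U, π, hU, rfl⟩
    exact (hU.le_norm_deriv hψ hR hRΩ).2
  have hex : ∀ n : ℕ, ∃ (U : Set ℂ) (π : ℂ → ℂ), IsIntermediateCover ψ Ω p U π ∧
      ‖deriv π 0‖ < sInf S + 1 / ((n : ℝ) + 1) := fun n ↦ by
    obtain ⟨_, ⟨U, π, hU, rfl⟩, hlt⟩ := exists_lt_of_csInf_lt hSne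
      (lt_add_of_pos_right (sInf S) (Nat.one_div_pos_of_nat (n := n)))
    exact ⟨U, π, hU, hlt⟩
  choose U π hU hlt using hex
  refine ⟨U, π, hU, fun r hr ↦ ?_⟩
  rcases le_or_gt r 0 with hr0 | hr0
  · simp [ball_eq_empty.2 hr0]
  have hκ := two_mul_sqrt_div_one_add_lt_one hr0.le hr
  have hκ0 : 0 ≤ 2 * √r / (1 + r) := by positivity
  set κ := 2 * √r / (1 + r)
  have hlim : Tendsto (fun n : ℕ ↦ (sInf S + 1 / ((n : ℝ) + 1)) * κ) atTop (𝓝 ((sInf S + 0) * κ)) :=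
    (tendsto_one_div_add_atTop_nhds_zero_nat.const_add _).mul_const _
  have hev := hlim.eventually_lt_const (u := sInf S) (by rw [add_zero]; nlinarith)
  filter_upwards [hev] with n hn a ha
  by_contra haU
  rw [mem_ball_zero_iff] at ha
  obtain ⟨U', π', hU', heq⟩ := (hU n).exists_osculation
    (mem_ball_zero_iff.2 (ha.trans hr)) haU
  have h1 : sInf S ≤ ‖deriv π' 0‖ := csInf_le hbdd ⟨U', π', hU', rfl⟩
  have h2 := two_mul_sqrt_div_one_add_le (norm_nonneg a) ha.le hr.le
  have h3 : ‖deriv π' 0‖ ≤ (sInf S + 1 / ((n : ℝ) + 1)) * κ := by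
    rw [heq]
    exact mul_le_mul (hlt n).le h2 (by positivity) ((norm_nonneg _).trans (hlt n).le)
  linarith

end

/-- If `Ω'` is a nonempty open connected subset of `ℂ` which is holomorphically
covered by the unit disk, then so is every nonempty open connected subset `Ω ⊆ Ω'`. -/
theorem exists_holomorphic_covering_of_subset
    (Ω' Ω : Set ℂ) (hne' : Ω'.Nonempty) (hopen' : IsOpen Ω') (hconn' : IsConnected Ω')
    (ψ : ℂ → ℂ) (hψ : IsHolomorphicCoveringOnto ψ (Metric.ball 0 1) Ω')
    (hsub : Ω ⊆ Ω') (hne : Ω.Nonempty) (hopen : IsOpen Ω) (hconn : IsConnected Ω) :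
    ∃ φ : ℂ → ℂ, IsHolomorphicCoveringOnto φ (Metric.ball 0 1) Ω := by
  obtain ⟨w, hw⟩ := hne
  obtain ⟨p, hp, rfl⟩ : w ∈ ψ '' Metric.ball 0 1 := hψ.2.1 ▸ hsub hw
  obtain ⟨U, π, hU, hex⟩ := exists_exhaustion hψ.1 hopen
    (IsIntermediateCover.initial hψ hsub hopen hp hw)
  obtain ⟨f, hf, hfm, hfs⟩ := exists_hasDiskSections_of_exhaustion hψ.1 hU hex
  exact ⟨fun z ↦ ψ (f z), hfs.isHolomorphicCoveringOnto Metric.isOpen_ball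
    (Metric.nonempty_ball.2 one_pos) hf hfm hopen hconn.isPreconnected⟩
end
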